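/- Let q ≥ 3 be an integer, let ρ(q) = [(ℤ/qℤ)^× : ((ℤ/qℤ)^×)²], and let β^{(2)}_{q,0} be the supremum of Re(ρ) over zeros ρ with 0 < Re(ρ) < 1 of the L-functions L(χ,·) of non-principal real characters χ mod q (χ ≠ χ₀, χ² = χ₀). Define E_{q;R,NR}(x) = (log x / (ρ(q) x^{β^{(2)}_{q,0}}))((ρ(q) − 1)·π(x;q,R) − π(x;q,NR)), where π(x;q,R) (resp. π(x;q,NR)) counts primes p ≤ x coprime to q whose class mod q is a square (resp. a non-square) in (ℤ/qℤ)^×. Then E_{q;R,NR} admits a limiting logarithmic distribution μ_{q;R,NR}. Moreover, if every zero in the critical strip of L(χ,·) for every non-principal real χ mod q has real part 1/2, and L(χ, 1/2) ≠ 0 for every such χ, then the mean of μ_{q;R,NR} equals (1 − ρ(q))/ρ(q). -/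

import Mathlib

open MeasureTheory Filter Topology Complex
open scoped Classical

noncomputable section

/-- `F : ℝ → ℝ` admits the Borel probability measure `μ` as limiting logarithmic
distribution: for every bounded Lipschitz `g : ℝ → ℝ`,
`(1/Y) ∫₂^Y g(F(e^y)) dy → ∫ g dμ` as `Y → ∞`. -/
def HasLimitingLogDistribution (F : ℝ → ℝ) (μ : Measure ℝ) : Prop :=
  IsProbabilityMeasure μ ∧
  ∀ g : ℝ → ℝ, (∃ C, LipschitzWith C g) → (∃ B, ∀ x, |g x| ≤ B) →
    Tendsto (fun Y : ℝ => (1 / Y) * ∫ y in (2:ℝ)..Y, g (F (Real.exp y)))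
      atTop (𝓝 (∫ t, g t ∂μ))

/-- `ρ(q) = [(ℤ/qℤ)^× : ((ℤ/qℤ)^×)²]`, the index of the subgroup of squares. -/
def rhoQ (q : ℕ) : ℕ := ((powMonoidHom 2 : (ZMod q)ˣ →* (ZMod q)ˣ).range).index

/-- `π(x;q,R)`: primes `p ≤ x` coprime to `q` whose class mod `q` is a square. -/
def piModSq (q : ℕ) (x : ℝ) : ℕ :=
  ((Finset.range (⌊x⌋₊ + 1)).filter
    (fun p : ℕ => p.Prime ∧ IsUnit (p : ZMod q) ∧ ∃ y : ZMod q, y * y = (p : ZMod q))).card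

/-- `π(x;q,NR)`: primes `p ≤ x` coprime to `q` whose class mod `q` is a non-square. -/
def piModNonSq (q : ℕ) (x : ℝ) : ℕ :=
  ((Finset.range (⌊x⌋₊ + 1)).filter
    (fun p : ℕ => p.Prime ∧ IsUnit (p : ZMod q) ∧ ¬∃ y : ZMod q, y * y = (p : ZMod q))).card

/-- `β^{(2)}_{q,0}`: the supremum of the real parts of the critical-strip zeros of
`L(χ,·)` over non-principal real characters `χ` mod `q`. -/
def betaQ2 (q : ℕ) [NeZero q] : ℝ :=
  sSup {b : ℝ | ∃ χ : DirichletCharacter ℂ q, χ ≠ 1 ∧ χ ^ 2 = 1 ∧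
    ∃ ρ : ℂ, χ.LFunction ρ = 0 ∧ 0 < ρ.re ∧ ρ.re < 1 ∧ ρ.re = b}

/-- `E_{q;R,NR}(x) = (log x / (ρ(q) x^{β^{(2)}_{q,0}}))((ρ(q)−1) π(x;q,R) − π(x;q,NR))`. -/
def Ernr (q : ℕ) [NeZero q] (x : ℝ) : ℝ :=
  (Real.log x / ((rhoQ q : ℝ) * x ^ betaQ2 q)) *
    (((rhoQ q : ℝ) - 1) * (piModSq q x : ℝ) - (piModNonSq q x : ℝ))

/-- Blaschke factor identity on the sphere. -/
lemma blaschke_norm {R : ℝ} (hR : 0 < R) (w z : ℂ) (hz : ‖z‖ = R) :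
    ‖((R : ℂ) ^ 2 - (starRingEnd ℂ) w * z) / R‖ = ‖z - w‖ := by
  have h1 : ((R : ℂ) ^ 2 - (starRingEnd ℂ) w * z) = (starRingEnd ℂ) (z - w) * z := by
    rw [map_sub, sub_mul, ← hz, ← ofReal_pow, ← normSq_eq_norm_sq, normSq_eq_conj_mul_self]
  rw [h1, norm_div, norm_mul, RCLike.norm_conj, hz, norm_real, Real.norm_eq_abs, abs_of_pos hR]
  field_simp

lemma blaschke_ne {R : ℝ} (w z : ℂ) (hw : ‖w‖ < R) (hz : ‖z‖ ≤ R) :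
    ((R : ℂ) ^ 2 - (starRingEnd ℂ) w * z) ≠ 0 := by
  intro h
  have h0 : 0 ≤ ‖w‖ := norm_nonneg _
  have h2 : ‖(R : ℂ) ^ 2‖ = ‖(starRingEnd ℂ) w * z‖ := by rw [sub_eq_zero.1 h]
  rw [norm_pow, norm_real, norm_mul, RCLike.norm_conj, Real.norm_eq_abs, sq_abs] at h2
  nlinarith [norm_nonneg z]

/-- Extraction of zeros one by one, with Blaschke factors. -/
lemma extract_zeros {r R B : ℝ} (hr : 0 < r) (hrR : r < R) (n : ℕ) : ∀ (f : ℂ → ℂ),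
    DiffContOnCl ℂ f (Metric.ball 0 R) → (∀ z ∈ Metric.closedBall (0:ℂ) R, ‖f z‖ ≤ B) → f 0 ≠ 0 →
    B < ‖f 0‖ * (R / r) ^ n →
    ∃ (Z : Multiset ℂ) (g : ℂ → ℂ), DiffContOnCl ℂ g (Metric.ball 0 R) ∧
      (∀ ρ ∈ Z, ‖ρ‖ ≤ r) ∧
      (∀ z ∈ Metric.closedBall (0:ℂ) R, f z = (Z.map (fun ρ => z - ρ)).prod * g z) ∧
      (∀ z ∈ Metric.closedBall (0:ℂ) r, g z ≠ 0) ∧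
      (∀ z ∈ Metric.closedBall (0:ℂ) R,
        ‖g z * (Z.map (fun ρ => ((R : ℂ) ^ 2 - (starRingEnd ℂ) ρ * z) / R)).prod‖ ≤ B) ∧
      ‖f 0‖ * (R / r) ^ Z.card ≤
        ‖g 0 * (Z.map (fun ρ => ((R : ℂ) ^ 2 - (starRingEnd ℂ) ρ * 0) / R)).prod‖ := by
  have hR : 0 < R := hr.trans hrR
  induction n with
  | zero =>
    intro f hf hB h0 hlt
    exfalso
    have := hB 0 (by simp [hR.le])
    simp at hlt
    linarith
  | succ n ih =>
    intro f hf hB h0 hlt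
    by_cases hz : ∃ ρ ∈ Metric.closedBall (0:ℂ) r, f ρ = 0
    swap
    · push Not at hz
      refine ⟨0, f, hf, by simp, by simp, hz, by simpa using hB, by simp⟩
    obtain ⟨ρ, hρ, hfρ⟩ := hz
    have hρr : ‖ρ‖ ≤ r := by simpa using hρ
    have hρR : ‖ρ‖ < R := hρr.trans_lt hrR
    have hρ0 : ρ ≠ 0 := by rintro rfl; exact h0 hfρ
    have hρpos : 0 < ‖ρ‖ := norm_pos_iff.2 hρ0
    set f1 := dslope f ρ with hf1
    have hnb : Metric.ball (0:ℂ) R ∈ 𝓝 ρ := Metric.isOpen_ball.mem_nhds (by simpa using hρR)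
    have hcl : closure (Metric.ball (0:ℂ) R) = Metric.closedBall 0 R := closure_ball _ hR.ne'
    have hf1d : DiffContOnCl ℂ f1 (Metric.ball 0 R) := by
      refine ⟨(Complex.differentiableOn_dslope hnb).2 hf.differentiableOn, ?_⟩
      refine (continuousOn_dslope (mem_of_superset hnb subset_closure)).2 ⟨hf.continuousOn, ?_⟩
      exact hf.differentiableOn.differentiableAt hnb
    have hff1 : ∀ z, f z = (z - ρ) * f1 z := by
      intro z
      have := sub_smul_dslope f ρ z
      rw [hfρ, sub_zero, smul_eq_mul] at this
      exact this.symm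
    set b : ℂ → ℂ := fun z => ((R : ℂ) ^ 2 - (starRingEnd ℂ) ρ * z) / R with hb
    have hbne : ∀ z ∈ Metric.closedBall (0:ℂ) R, b z ≠ 0 := by
      intro z hz
      have := blaschke_ne ρ z hρR (by simpa using hz)
      exact div_ne_zero this (by exact_mod_cast hR.ne')
    have hbd : Differentiable ℂ b := by
      intro z; simp only [hb]; fun_prop
    set f2 : ℂ → ℂ := fun z => f1 z * b z with hf2
    have hf2d : DiffContOnCl ℂ f2 (Metric.ball 0 R) :=
      ⟨hf1d.1.mul hbd.differentiableOn, hf1d.2.mul hbd.continuous.continuousOn⟩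
    have hf2B : ∀ z ∈ Metric.closedBall (0:ℂ) R, ‖f2 z‖ ≤ B := by
      intro z hz
      refine Complex.norm_le_of_forall_mem_frontier_norm_le Metric.isBounded_ball hf2d ?_
        (by rwa [hcl])
      intro w hw
      rw [frontier_ball _ hR.ne'] at hw
      have hwR : ‖w‖ = R := by simpa using hw
      have h1 := blaschke_norm hR ρ w hwR
      have h2 : ‖f2 w‖ = ‖f w‖ := by
        rw [hff1 w]; simp only [hf2, norm_mul]; rw [show ‖b w‖ = ‖w - ρ‖ from h1]; ring
      rw [h2]
      exact hB w (by simp [hwR])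
    have hf20 : ‖f2 0‖ = ‖f 0‖ * (R / ‖ρ‖) := by
      rw [hff1 0]
      simp only [hf2, hb, norm_mul, mul_zero, sub_zero, zero_sub, norm_neg]
      rw [norm_div, norm_pow, norm_real, Real.norm_eq_abs, abs_of_pos hR]
      field_simp
    have hf20le : ‖f 0‖ * (R / r) ≤ ‖f2 0‖ := by
      rw [hf20]; gcongr
    obtain ⟨Z, g, hg, hZ, hfg, hgne, hgB, hcard⟩ := ih f2 hf2d hf2B
      (by
        have : 0 < ‖f2 0‖ := by
          rw [hf20]; have := norm_pos_iff.2 h0; positivity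
        exact norm_pos_iff.1 this)
      (by
        refine hlt.trans_le ?_
        rw [pow_succ']
        rw [← mul_assoc]
        gcongr)
    refine ⟨ρ ::ₘ Z, fun z => g z / b z, ?_, ?_, ?_, ?_, ?_, ?_⟩
    · refine ⟨hg.1.div hbd.differentiableOn fun z hz => hbne z (Metric.ball_subset_closedBall hz),
        hg.2.div hbd.continuous.continuousOn fun z hz => hbne z (by rwa [hcl] at hz)⟩
    · intro σ hσ
      rcases Multiset.mem_cons.1 hσ with rfl | h
      · exact hρr
      · exact hZ σ h
    · intro z hz
      have h1 := hfg z hz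
      have h2 := hbne z hz
      simp only [hf2] at h1
      rw [hff1 z, Multiset.map_cons, Multiset.prod_cons]
      have : f1 z = (Z.map (fun ρ => z - ρ)).prod * g z / b z := by
        rw [← h1]; field_simp
      rw [this]; ring
    · intro z hz
      exact div_ne_zero (hgne z hz) (hbne z (Metric.closedBall_subset_closedBall hrR.le hz))
    · intro z hz
      have h2 := hbne z hz
      have h3 := hgB z hz
      rw [Multiset.map_cons, Multiset.prod_cons]
      have : g z / b z * (((R : ℂ) ^ 2 - (starRingEnd ℂ) ρ * z) / R * (Z.map (fun ρ => ((R : ℂ) ^ 2 - (starRingEnd ℂ) ρ * z) / R)).prod) = g z * (Z.map (fun ρ => ((R : ℂ) ^ 2 - (starRingEnd ℂ) ρ * z) / R)).prod := by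
        change g z / b z * (b z * _) = _
        rw [← mul_assoc, div_mul_cancel₀ _ h2]
      rw [this]; exact h3
    · have h2 := hbne 0 (by simp [hR.le])
      rw [Multiset.map_cons, Multiset.prod_cons, Multiset.card_cons]
      have : g 0 / b 0 * (((R : ℂ) ^ 2 - (starRingEnd ℂ) ρ * 0) / R * (Z.map (fun ρ => ((R : ℂ) ^ 2 - (starRingEnd ℂ) ρ * 0) / R)).prod) = g 0 * (Z.map (fun ρ => ((R : ℂ) ^ 2 - (starRingEnd ℂ) ρ * 0) / R)).prod := by
        change g 0 / b 0 * (b 0 * _) = _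
        rw [← mul_assoc, div_mul_cancel₀ _ h2]
      rw [this, pow_succ', ← mul_assoc]
      refine le_trans ?_ hcard
      gcongr

/-- Log-derivative bound for a zero-free function (Borel-Caratheodory). -/
lemma logDeriv_bound_zero_free {r r1 M : ℝ} (hr : 0 < r) (hrr : r < r1) (hM : 0 < M)
    (h : ℂ → ℂ) (hd : DifferentiableOn ℂ h (Metric.ball 0 r1))
    (hne : ∀ z ∈ Metric.ball (0:ℂ) r1, h z ≠ 0)
    (hB : ∀ z ∈ Metric.ball (0:ℂ) r1, ‖h z‖ ≤ ‖h 0‖ * Real.exp M) :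
    ∀ z ∈ Metric.closedBall (0:ℂ) r, ‖logDeriv h z‖ ≤ (4 * r1 / (r1 - r) / ((r1 - r) / 2)) * M := by
  have hr1 : 0 < r1 := hr.trans hrr
  have h00 : (0:ℂ) ∈ Metric.ball (0:ℂ) r1 := by simp [hr1]
  have hld : DifferentiableOn ℂ (logDeriv h) (Metric.ball 0 r1) := by
    have : DifferentiableOn ℂ (fun z => deriv h z / h z) (Metric.ball 0 r1) :=
      (hd.deriv Metric.isOpen_ball).div hd hne
    exact this
  obtain ⟨φ0, hφ0⟩ := hld.isExactOn_ball
  set φ : ℂ → ℂ := fun z => φ0 z - φ0 0 with hφ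
  have hφd : ∀ z ∈ Metric.ball (0:ℂ) r1, HasDerivAt φ (logDeriv h z) z := fun z hz =>
    (hφ0 z hz).sub_const _
  have hφdo : DifferentiableOn ℂ φ (Metric.ball 0 r1) := fun z hz =>
    (hφd z hz).differentiableAt.differentiableWithinAt
  have hconst : ∀ z ∈ Metric.ball (0:ℂ) r1, h z * cexp (-φ z) = h 0 := by
    intro z hz
    have hder : ∀ w ∈ Metric.ball (0:ℂ) r1, HasDerivAt (fun w => h w * cexp (-φ w)) 0 w := by
      intro w hw
      have h1 := (hd.differentiableAt (Metric.isOpen_ball.mem_nhds hw)).hasDerivAt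
      have h2 := h1.mul (hφd w hw).neg.cexp
      refine h2.congr_deriv ?_
      rw [logDeriv_apply]
      have := hne w hw
      field_simp
      ring
    have := Metric.isOpen_ball.is_const_of_deriv_eq_zero (convex_ball (0:ℂ) r1).isPreconnected
      (f := fun w => h w * cexp (-φ w))
      (fun w hw => (hder w hw).differentiableAt.differentiableWithinAt)
      (fun w hw => (hder w hw).deriv) hz h00
    rw [this]; simp [hφ]
  have hre : Set.MapsTo φ (Metric.ball 0 r1) {z | z.re ≤ M} := by
    intro z hz
    have h1 := hconst z hz
    have h2 : h z = h 0 * cexp (φ z) := by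
      rw [← h1, mul_assoc, ← Complex.exp_add]; simp
    have h3 := hB z hz
    rw [h2, norm_mul, Complex.norm_exp] at h3
    have h4 : 0 < ‖h 0‖ := norm_pos_iff.2 (hne 0 h00)
    exact Real.exp_le_exp.1 (le_of_mul_le_mul_left h3 h4)
  have hφb : ∀ z ∈ Metric.closedBall (0:ℂ) ((r + r1) / 2), ‖φ z‖ ≤ 4 * r1 / (r1 - r) * M := by
    intro z hz
    have hz' : ‖z‖ ≤ (r + r1) / 2 := by simpa using hz
    have h1 := Complex.borelCaratheodory_zero hM hφdo hre hr1
      (z := z) (by simp; linarith) (by simp [hφ])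
    refine h1.trans ?_
    have h5 : (r1 - r) / 2 ≤ r1 - ‖z‖ := by linarith
    have h6 : 0 < (r1 - r) / 2 := by linarith
    calc 2 * M * ‖z‖ / (r1 - ‖z‖) ≤ 2 * M * r1 / ((r1 - r) / 2) := by
          gcongr
          linarith
      _ = 4 * r1 / (r1 - r) * M := by
          have : r1 - r ≠ 0 := by linarith
          field_simp; ring
  intro z hz
  have hz' : ‖z‖ ≤ r := by simpa using hz
  have hsub : Metric.closedBall z ((r1 - r) / 2) ⊆ Metric.closedBall (0:ℂ) ((r + r1) / 2) := by
    intro w hw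
    have h1 : ‖w - z‖ ≤ (r1 - r) / 2 := by simpa [dist_eq_norm] using hw
    have h2 : ‖w‖ ≤ ‖w - z‖ + ‖z‖ := by simpa using norm_add_le (w - z) z
    simp; linarith
  have hsub2 : Metric.closedBall z ((r1 - r) / 2) ⊆ Metric.ball (0:ℂ) r1 := by
    intro w hw
    have := hsub hw
    simp at this ⊢; linarith
  have hpos : 0 < (r1 - r) / 2 := by linarith
  have h1 := Complex.norm_deriv_le_of_forall_mem_sphere_norm_le (c := z) (R := (r1 - r)/2) (f := φ)
    (C := 4 * r1 / (r1 - r) * M) hpos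
    ((hφdo.mono hsub2).diffContOnCl_ball subset_rfl)
    (fun w hw => hφb w (hsub (Metric.sphere_subset_closedBall hw)))
  rw [(hφd z (by simp; linarith)).deriv] at h1
  refine h1.trans (le_of_eq ?_)
  ring

lemma logDeriv_multiset_prod (φ : ℂ → ℂ → ℂ) (z : ℂ) (Z : Multiset ℂ)
    (hne : ∀ ρ ∈ Z, φ ρ z ≠ 0) (hd : ∀ ρ ∈ Z, DifferentiableAt ℂ (φ ρ) z) :
    DifferentiableAt ℂ (fun z => (Z.map (fun ρ => φ ρ z)).prod) z ∧
    (Z.map (fun ρ => φ ρ z)).prod ≠ 0 ∧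
    logDeriv (fun z => (Z.map (fun ρ => φ ρ z)).prod) z = (Z.map (fun ρ => logDeriv (φ ρ) z)).sum := by
  induction Z using Multiset.induction_on with
  | empty =>
    refine ⟨by simp, by simp, ?_⟩
    simp [logDeriv_apply]
  | cons a Z ih =>
    obtain ⟨h1, h2, h3⟩ := ih (fun ρ h => hne ρ (Multiset.mem_cons_of_mem h))
      (fun ρ h => hd ρ (Multiset.mem_cons_of_mem h))
    have ha := hne a (Multiset.mem_cons_self a Z)
    have hda := hd a (Multiset.mem_cons_self a Z)
    simp only [Multiset.map_cons, Multiset.prod_cons, Multiset.sum_cons]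
    refine ⟨hda.mul h1, mul_ne_zero ha h2, ?_⟩
    rw [logDeriv_mul z ha h2 hda h1, h3]

lemma order_eq_count {R r : ℝ} (hrR : r < R) (f g : ℂ → ℂ) (Z : Multiset ℂ)
    (hg : DifferentiableOn ℂ g (Metric.ball 0 R))
    (hfg : ∀ z ∈ Metric.closedBall (0:ℂ) R, f z = (Z.map (fun ρ => z - ρ)).prod * g z)
    (hgne : ∀ z ∈ Metric.closedBall (0:ℂ) r, g z ≠ 0) (ρ : ℂ) (hρ : ρ ∈ Metric.closedBall (0:ℂ) r) :
    analyticOrderNatAt f ρ = Z.count ρ := by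
  have hρR : ρ ∈ Metric.ball (0:ℂ) R := by
    simp at hρ ⊢; linarith
  have hnb : Metric.ball (0:ℂ) R ∈ 𝓝 ρ := Metric.isOpen_ball.mem_nhds hρR
  set W := Z.filter (fun σ => ¬ (ρ = σ)) with hW
  have hsplit : ∀ z, (Z.map (fun σ => z - σ)).prod = (z - ρ) ^ (Z.count ρ) * (W.map (fun σ => z - σ)).prod := by
    intro z
    conv_lhs => rw [← Multiset.filter_add_not (fun σ => ρ = σ) Z]
    rw [Multiset.map_add, Multiset.prod_add, Multiset.filter_eq, Multiset.map_replicate,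
      Multiset.prod_replicate]
  have hWd := logDeriv_multiset_prod (fun σ z => z - σ) ρ W (by
    intro σ hσ
    rw [hW, Multiset.mem_filter] at hσ
    exact sub_ne_zero.2 hσ.2) (by intro σ _; fun_prop)
  have hWdiff : Differentiable ℂ (fun z => (W.map (fun σ => z - σ)).prod) := by
    clear hWd hsplit
    induction W using Multiset.induction_on with
    | empty => simp
    | cons a Z ih =>
      simp only [Multiset.map_cons, Multiset.prod_cons]
      exact (by fun_prop : Differentiable ℂ fun z : ℂ => z - a).mul ih
  have hG : AnalyticAt ℂ (fun z => (W.map (fun σ => z - σ)).prod * g z) ρ :=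
    (hWdiff.analyticAt ρ).mul (hg.analyticAt hnb)
  have hev : ∀ᶠ z in 𝓝 ρ, f z = (z - ρ) ^ (Z.count ρ) • ((W.map (fun σ => z - σ)).prod * g z) := by
    filter_upwards [hnb] with z hz
    rw [hfg z (Metric.ball_subset_closedBall hz), hsplit z, smul_eq_mul, mul_assoc]
  have hfa : AnalyticAt ℂ f ρ := by
    have : AnalyticAt ℂ (fun z => (z - ρ) ^ (Z.count ρ) • ((W.map (fun σ => z - σ)).prod * g z)) ρ := by
      fun_prop
    exact this.congr (hev.mono fun z hz => hz.symm)
  have := (hfa.analyticOrderAt_eq_natCast (n := Z.count ρ)).2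
    ⟨_, hG, mul_ne_zero hWd.2.1 (hgne ρ hρ), hev⟩
  rw [analyticOrderNatAt, this]; rfl

lemma local_zeros_zero {r r1 R : ℝ} (hr : 0 < r) (hrr : r < r1) (hrR : r1 < R) :
    ∃ K > 0, ∀ (f : ℂ → ℂ) (M : ℝ), 1 ≤ M → DiffContOnCl ℂ f (Metric.ball 0 R) → f 0 ≠ 0 →
      (∀ z ∈ Metric.closedBall (0:ℂ) R, ‖f z‖ ≤ ‖f 0‖ * Real.exp M) →
      ∃ Z : Finset ℂ, (∀ ρ, ρ ∈ Z ↔ ρ ∈ Metric.closedBall (0:ℂ) r1 ∧ f ρ = 0) ∧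
        ∑ ρ ∈ Z, (analyticOrderNatAt f ρ : ℝ) ≤ K * M ∧
        ∀ z ∈ Metric.closedBall (0:ℂ) r, f z ≠ 0 →
          ‖logDeriv f z - ∑ ρ ∈ Z, (analyticOrderNatAt f ρ : ℂ) / (z - ρ)‖ ≤ K * M := by
  have hr1 : 0 < r1 := hr.trans hrr
  have hR : 0 < R := hr1.trans hrR
  set K0 := 4 * r1 / (r1 - r) / ((r1 - r) / 2)
  have hK0 : 0 < K0 := by
    have : 0 < r1 - r := by linarith
    positivity
  have hlog : 0 < Real.log (R / r1) := Real.log_pos (by rw [one_lt_div hr1]; exact hrR)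
  set K1 := 1 / Real.log (R / r1) with hK1
  have hK1p : 0 < K1 := by positivity
  have hRr : 0 < R ^ 2 - r1 ^ 2 := by nlinarith
  set K2 := r1 / (R ^ 2 - r1 ^ 2) with hK2
  have hK2p : 0 < K2 := by positivity
  refine ⟨K0 + K1 + K1 * K2, by positivity, ?_⟩
  intro f M hM hf h0 hB
  have hf0 : 0 < ‖f 0‖ := norm_pos_iff.2 h0
  have hq : 1 < R / r1 := by rw [one_lt_div hr1]; exact hrR
  obtain ⟨n, hn⟩ := pow_unbounded_of_one_lt (Real.exp M) hq
  obtain ⟨Z, g, hg, hZ, hfg, hgne, hgB, hcard⟩ := extract_zeros hr1 hrR n f hf hB h0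
    (by gcongr)
  set P : ℂ → ℂ := fun z => (Z.map (fun ρ => ((R : ℂ) ^ 2 - (starRingEnd ℂ) ρ * z) / R)).prod with hP
  have hRc : (R : ℂ) ≠ 0 := by exact_mod_cast hR.ne'
  have hPp : ∀ z ∈ Metric.closedBall (0:ℂ) R, _ := fun z hz =>
    logDeriv_multiset_prod (fun ρ z => ((R : ℂ) ^ 2 - (starRingEnd ℂ) ρ * z) / R) z Z
    (fun ρ hρ => div_ne_zero (blaschke_ne ρ z ((hZ ρ hρ).trans_lt hrR) (by simpa using hz)) hRc)
    (by intro ρ _; fun_prop)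
  have hcardM : (Z.card : ℝ) ≤ K1 * M := by
    have h1 := hcard.trans (hgB 0 (by simp [hR.le]))
    have h2 := le_of_mul_le_mul_left h1 hf0
    have h3 := Real.log_le_log (by positivity) h2
    rw [Real.log_pow, Real.log_exp] at h3
    rw [hK1, one_div, inv_mul_eq_div, le_div_iff₀ hlog]
    exact h3
  have hbig : ‖f 0‖ ≤ ‖g 0 * P 0‖ := by
    refine le_trans ?_ hcard
    have := one_le_pow₀ hq.le (n := Z.card)
    nlinarith
  have hgd : ∀ z ∈ Metric.ball (0:ℂ) R, DifferentiableAt ℂ g z := fun z hz =>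
    hg.differentiableOn.differentiableAt (Metric.isOpen_ball.mem_nhds hz)
  have hbb : Metric.ball (0:ℂ) r1 ⊆ Metric.ball 0 R := Metric.ball_subset_ball hrR.le
  have hbr : Metric.closedBall (0:ℂ) r ⊆ Metric.ball 0 r1 := Metric.closedBall_subset_ball hrr
  have hlb := logDeriv_bound_zero_free hr hrr (by linarith : 0 < M) (fun z => g z * P z)
    (fun z hz => ((hgd z (hbb hz)).mul
      (hPp z (Metric.ball_subset_closedBall (hbb hz))).1).differentiableWithinAt)
    (fun z hz => mul_ne_zero (hgne z (Metric.ball_subset_closedBall hz))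
      (hPp z (Metric.ball_subset_closedBall (hbb hz))).2.1)
    (fun z hz => (hgB z (Metric.ball_subset_closedBall (hbb hz))).trans (by gcongr))
  have hmem : ∀ ρ, ρ ∈ Z.toFinset ↔ ρ ∈ Metric.closedBall (0:ℂ) r1 ∧ f ρ = 0 := by
    intro ρ
    rw [Multiset.mem_toFinset]
    constructor
    · intro h
      have h1 : ρ ∈ Metric.closedBall (0:ℂ) r1 := by simpa using hZ ρ h
      refine ⟨h1, ?_⟩
      rw [hfg ρ (Metric.closedBall_subset_closedBall hrR.le h1), mul_eq_zero]
      left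
      exact Multiset.prod_eq_zero (Multiset.mem_map.2 ⟨ρ, h, by simp⟩)
    · rintro ⟨h1, h2⟩
      rw [hfg ρ (Metric.closedBall_subset_closedBall hrR.le h1), mul_eq_zero] at h2
      rcases h2 with h2 | h2
      · rw [Multiset.prod_eq_zero_iff, Multiset.mem_map] at h2
        obtain ⟨σ, hσ, h3⟩ := h2
        rw [sub_eq_zero.1 h3]; exact hσ
      · exact absurd h2 (hgne ρ h1)
  have hord : ∀ ρ ∈ Z.toFinset, analyticOrderNatAt f ρ = Z.count ρ := fun ρ hρ =>
    order_eq_count hrR f g Z hg.differentiableOn hfg hgne ρ ((hmem ρ).1 hρ).1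
  refine ⟨Z.toFinset, hmem, ?_, ?_⟩
  · rw [Finset.sum_congr rfl (fun ρ hρ => by rw [hord ρ hρ]), ← Nat.cast_sum,
      Multiset.toFinset_sum_count_eq]
    refine hcardM.trans ?_
    have : 0 ≤ K1 * K2 := by positivity
    gcongr
    linarith
  · intro z hz hfz
    have hsum : ∑ ρ ∈ Z.toFinset, (analyticOrderNatAt f ρ : ℂ) / (z - ρ) =
        (Z.map (fun ρ => 1 / (z - ρ))).sum := by
      rw [Finset.sum_multiset_map_count]
      refine Finset.sum_congr rfl fun ρ hρ => ?_
      rw [hord ρ hρ, nsmul_eq_mul, mul_one_div]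
    rw [hsum]
    have hzr1 := hbr hz
    have hzR := hbb hzr1
    have hzcR := Metric.ball_subset_closedBall hzR
    have hgz := hgne z (Metric.ball_subset_closedBall hzr1)
    have hprod : (Z.map (fun ρ => z - ρ)).prod ≠ 0 := by
      intro h; apply hfz; rw [hfg z hzcR, h, zero_mul]
    have hne : ∀ ρ ∈ Z, z - ρ ≠ 0 := by
      intro ρ hρ h
      exact hprod (Multiset.prod_eq_zero (Multiset.mem_map.2 ⟨ρ, hρ, h⟩))
    have hQ := logDeriv_multiset_prod (fun ρ z => z - ρ) z Z hne (by intro ρ _; fun_prop)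
    have e1 : logDeriv f z = (Z.map (fun ρ => 1 / (z - ρ))).sum + logDeriv g z := by
      have hev : f =ᶠ[𝓝 z] (fun z => (Z.map (fun ρ => z - ρ)).prod * g z) := by
        filter_upwards [Metric.isOpen_ball.mem_nhds hzR] with w hw
        exact hfg w (Metric.ball_subset_closedBall hw)
      have h5 : logDeriv f z = logDeriv (fun z => (Z.map (fun ρ => z - ρ)).prod * g z) z := by
        rw [logDeriv_apply, logDeriv_apply, hev.deriv_eq, hev.eq_of_nhds]
      rw [h5, logDeriv_mul z hprod hgz hQ.1 (hgd z hzR), hQ.2.2]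
      congr 2
      refine Multiset.map_congr rfl fun ρ _ => ?_
      rw [logDeriv_apply]; simp
    have hPz := hPp z hzcR
    have e2 : logDeriv (fun z => g z * P z) z = logDeriv g z +
        (Z.map (fun ρ => logDeriv (fun z => ((R : ℂ) ^ 2 - (starRingEnd ℂ) ρ * z) / R) z)).sum := by
      rw [logDeriv_mul z hgz hPz.2.1 (hgd z hzR) hPz.1, hPz.2.2]
    have e3 := hlb z hz
    have e4 : ‖(Z.map (fun ρ => logDeriv (fun z => ((R : ℂ) ^ 2 - (starRingEnd ℂ) ρ * z) / R) z)).sum‖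
        ≤ Z.card * K2 := by
      refine (norm_multiset_sum_le _).trans ?_
      rw [Multiset.map_map]
      refine (Multiset.sum_le_card_nsmul _ K2 ?_).trans (by simp)
      intro x hx
      rw [Multiset.mem_map] at hx
      obtain ⟨ρ, hρ, rfl⟩ := hx
      have hρr := hZ ρ hρ
      have hb := blaschke_ne ρ z (hρr.trans_lt hrR) (by simpa using hzcR)
      have hder : deriv (fun z => ((R : ℂ) ^ 2 - (starRingEnd ℂ) ρ * z) / R) z = -(starRingEnd ℂ) ρ / R := by
        have : HasDerivAt (fun z : ℂ => ((R : ℂ) ^ 2 - (starRingEnd ℂ) ρ * z) / R) (-((starRingEnd ℂ) ρ * 1) / R) z :=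
          (((hasDerivAt_id z).const_mul ((starRingEnd ℂ) ρ)).const_sub _).div_const _
        rw [this.deriv, mul_one]
      simp only [Function.comp, logDeriv_apply, hder]
      rw [div_div_div_cancel_right₀ hRc, norm_div, norm_neg, RCLike.norm_conj, hK2]
      have hzn : ‖z‖ ≤ r1 := by simpa using Metric.ball_subset_closedBall hzr1
      have hlow : R ^ 2 - r1 ^ 2 ≤ ‖(R : ℂ) ^ 2 - (starRingEnd ℂ) ρ * z‖ := by
        have h6 := norm_sub_norm_le ((R : ℂ) ^ 2) ((starRingEnd ℂ) ρ * z)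
        rw [norm_pow, norm_real, norm_mul, RCLike.norm_conj, Real.norm_eq_abs, sq_abs] at h6
        nlinarith [norm_nonneg z, norm_nonneg ρ]
      gcongr
    have e5 : logDeriv f z - (Z.map (fun ρ => 1 / (z - ρ))).sum = logDeriv (fun z => g z * P z) z -
       (Z.map (fun ρ => logDeriv (fun z => ((R : ℂ) ^ 2 - (starRingEnd ℂ) ρ * z) / R) z)).sum := by
      rw [e1, e2]; ring
    rw [e5]
    refine (norm_sub_le _ _).trans ?_
    have : (Z.card : ℝ) * K2 ≤ K1 * M * K2 := by gcongr
    have h8 : 0 ≤ K1 * M := by positivity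
    have h9 : (K0 + K1 + K1 * K2) * M = K0 * M + K1 * M + K1 * M * K2 := by ring
    rw [h9]
    change _ ≤ K0 * M at e3
    linarith

lemma local_zeros {r r1 R : ℝ} (hr : 0 < r) (hrr : r < r1) (hrR : r1 < R) :
    ∃ K > 0, ∀ (f : ℂ → ℂ) (c : ℂ) (M : ℝ), 1 ≤ M → DiffContOnCl ℂ f (Metric.ball c R) → f c ≠ 0 →
      (∀ z ∈ Metric.closedBall c R, ‖f z‖ ≤ ‖f c‖ * Real.exp M) →
      ∃ Z : Finset ℂ, (∀ ρ, ρ ∈ Z ↔ ρ ∈ Metric.closedBall c r1 ∧ f ρ = 0) ∧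
        ∑ ρ ∈ Z, (analyticOrderNatAt f ρ : ℝ) ≤ K * M ∧
        ∀ z ∈ Metric.closedBall c r, f z ≠ 0 →
          ‖logDeriv f z - ∑ ρ ∈ Z, (analyticOrderNatAt f ρ : ℂ) / (z - ρ)‖ ≤ K * M := by
  obtain ⟨K, hK, h⟩ := local_zeros_zero hr hrr hrR
  refine ⟨K, hK, ?_⟩
  intro f c M hM hf h0 hB
  have hcl : ∀ (z : ℂ) (t : ℝ), z + c ∈ Metric.closedBall c t ↔ z ∈ Metric.closedBall (0:ℂ) t := by
    intro z t; simp [dist_eq_norm]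
  have hbl : ∀ (z : ℂ) (t : ℝ), z + c ∈ Metric.ball c t ↔ z ∈ Metric.ball (0:ℂ) t := by
    intro z t; simp [dist_eq_norm]
  have hR : 0 < R := hr.trans (hrr.trans hrR)
  have hfd : DiffContOnCl ℂ (fun z => f (z + c)) (Metric.ball 0 R) := by
    refine hf.comp (g := fun z => z + c) (by
      have : Differentiable ℂ (fun z : ℂ => z + c) := by fun_prop
      exact this.diffContOnCl) ?_
    intro z hz; exact (hbl z R).2 hz
  obtain ⟨Z, hZ1, hZ2, hZ3⟩ := h (fun z => f (z + c)) M hM hfd (by simpa using h0) (by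
    intro z hz
    simpa using hB (z + c) ((hcl z R).2 hz))
  have hord : ∀ ρ ∈ Z, analyticOrderNatAt (fun z => f (z + c)) ρ = analyticOrderNatAt f (ρ + c) := by
    intro ρ hρ
    have h1 : ρ + c ∈ Metric.ball c R := by
      have := ((hZ1 ρ).1 hρ).1
      rw [hbl]; exact Metric.closedBall_subset_ball hrR this
    have hfa : AnalyticAt ℂ f (ρ + c) :=
      hf.differentiableOn.analyticAt (Metric.isOpen_ball.mem_nhds h1)
    have := analyticOrderAt_comp_of_deriv_ne_zero (f := f) (z₀ := ρ) (g := fun z : ℂ => z + c)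
      (by fun_prop) (by simp)
    rw [analyticOrderNatAt, analyticOrderNatAt, ← this]; rfl
  have hinj : Set.InjOn (fun z : ℂ => z + c) (Z : Set ℂ) := fun a _ b _ h => by simpa using h
  refine ⟨Z.image (fun z => z + c), ?_, ?_, ?_⟩
  · intro ρ
    rw [Finset.mem_image]
    constructor
    · rintro ⟨a, ha, rfl⟩
      rw [hcl]; exact (hZ1 a).1 ha
    · intro h1
      refine ⟨ρ - c, (hZ1 _).2 ⟨?_, by simpa using h1.2⟩, by simp⟩
      rw [← hcl]; simpa using h1.1
  · rw [Finset.sum_image hinj]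
    rw [Finset.sum_congr rfl (fun ρ hρ => by rw [hord ρ hρ])] at hZ2
    exact hZ2
  · intro z hz hfz
    rw [Finset.sum_image hinj]
    have h3 := hZ3 (z - c) ((hcl _ _).1 (by simpa using hz)) (by simpa using hfz)
    rw [Finset.sum_congr rfl (fun ρ hρ => by rw [hord ρ hρ])] at h3
    have h4 : logDeriv (fun z => f (z + c)) (z - c) = logDeriv f z := by
      rw [logDeriv_apply, logDeriv_apply, deriv_comp_add_const]; simp
    rw [h4] at h3
    simpa [sub_sub, add_comm] using h3

lemma integrable_decay {p : ℝ} (hp : 1 < p) : Integrable (fun t : ℝ => (1 + |t|) ^ (-p)) := by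
  have := integrable_one_add_norm (E := ℝ) (μ := volume) (r := p) (by simpa using hp)
  simpa using this

lemma vertical_integrable {E : ℂ → ℂ} {x D p : ℝ} (hp : 1 < p)
    (hE : Continuous (fun t : ℝ => E (x + t * I)))
    (hb : ∀ t : ℝ, ‖E (x + t * I)‖ ≤ D * (1 + |t|) ^ (-p)) :
    Integrable (fun t : ℝ => E (x + t * I)) := by
  refine ((integrable_decay hp).const_mul D).mono' hE.aestronglyMeasurable ?_
  exact Eventually.of_forall hb

/-- Shifting a vertical contour. -/
lemma vertical_shift {E : ℂ → ℂ} {a b D p : ℝ} (hab : a ≤ b) (hp : 1 < p)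
    (hE : DifferentiableOn ℂ E {s | a ≤ s.re ∧ s.re ≤ b})
    (hb : ∀ s : ℂ, a ≤ s.re → s.re ≤ b → ‖E s‖ ≤ D * (1 + |s.im|) ^ (-p)) :
    ∫ t : ℝ, E (a + t * I) = ∫ t : ℝ, E (b + t * I) := by
  have hcont : ∀ x, a ≤ x → x ≤ b → Continuous (fun t : ℝ => E (x + t * I)) := by
    intro x h1 h2
    refine hE.continuousOn.comp_continuous (by fun_prop) ?_
    intro t; simp [h1, h2]
  have hIntg : ∀ x, a ≤ x → x ≤ b → Integrable (fun t : ℝ => E (x + t * I)) := by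
    intro x h1 h2
    refine vertical_integrable (D := D) hp (hcont x h1 h2) ?_
    intro t
    simpa using hb (x + t * I) (by simpa using h1) (by simpa using h2)
  have hlim : ∀ x, a ≤ x → x ≤ b → Tendsto (fun N : ℕ => ∫ t in (-(N:ℝ))..N, E (x + t * I)) atTop
      (𝓝 (∫ t : ℝ, E (x + t * I))) := by
    intro x h1 h2
    exact intervalIntegral_tendsto_integral (hIntg x h1 h2)
      (tendsto_neg_atTop_atBot.comp tendsto_natCast_atTop_atTop) tendsto_natCast_atTop_atTop
  have hD : Tendsto (fun N : ℕ => D * (1 + (N:ℝ)) ^ (-p) * |b - a|) atTop (𝓝 0) := by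
    have h1 : Tendsto (fun N : ℕ => (1 + (N:ℝ)) ^ (-p)) atTop (𝓝 0) :=
      (tendsto_rpow_neg_atTop (by linarith : 0 < p)).comp
        (tendsto_atTop_add_const_left _ _ tendsto_natCast_atTop_atTop)
    simpa using (h1.const_mul D).mul_const |b - a|
  have hhor : ∀ (ε : ℝ), |ε| = 1 → Tendsto (fun N : ℕ => ∫ x in a..b, E (x + (ε * N : ℝ) * I)) atTop (𝓝 0) := by
    intro ε hε
    rw [tendsto_zero_iff_norm_tendsto_zero]
    refine squeeze_zero (fun _ => norm_nonneg _) (fun N => ?_) hD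
    refine intervalIntegral.norm_integral_le_of_norm_le_const ?_
    intro x hx
    rw [Set.uIoc_of_le hab] at hx
    have := hb (x + (ε * N : ℝ) * I) (by simpa using hx.1.le) (by simpa using hx.2)
    simpa [abs_mul, hε] using this
  have hrect : ∀ N : ℕ, (∫ t in (-(N:ℝ))..N, E (b + t * I)) - (∫ t in (-(N:ℝ))..N, E (a + t * I)) =
      I * ((∫ x in a..b, E (x + ((-1) * N : ℝ) * I)) - (∫ x in a..b, E (x + (1 * N : ℝ) * I))) := by
    intro N
    have := Complex.integral_boundary_rect_eq_zero_of_differentiableOn E (a + (-(N:ℝ) : ℝ) * I)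
      (b + (N:ℝ) * I) (by
        refine hE.mono ?_
        intro s hs
        rw [mem_reProdIm] at hs
        simpa [Set.uIcc_of_le hab] using hs.1)
    simp only [add_re, add_im, mul_re, mul_im, ofReal_re, ofReal_im, I_re, I_im, mul_zero, mul_one,
      sub_zero, zero_add, add_zero, smul_eq_mul, zero_mul] at this
    rw [show (-1 * (N:ℝ)) = -(N:ℝ) by ring, one_mul]
    linear_combination (-I) * this - ((∫ t in (-(N:ℝ))..N, E (a + t * I)) - (∫ t in (-(N:ℝ))..N, E (b + t * I))) * I_mul_I
  have h1 := (hlim b hab le_rfl).sub (hlim a le_rfl hab)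
  have h2 := ((hhor (-1) (by simp)).sub (hhor 1 (by simp))).const_mul I
  have h3 := tendsto_nhds_unique h1 (by simpa only [hrect] using h2)
  simp at h3
  exact (sub_eq_zero.1 h3).symm

/-- Plancherel for a Fourier pair of integrable functions. -/
lemma plancherel_pair (u φ : ℝ → ℂ) (hu : Integrable u) (hφ : Integrable φ) (hφc : Continuous φ)
    (h : ∀ y, u y = ∫ w : ℝ, cexp (2 * Real.pi * I * w * y) * φ w) :
    ∫⁻ y, ‖u y‖ₑ ^ 2 = ∫⁻ w, ‖φ w‖ₑ ^ 2 := by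
  have hinv : u = FourierTransformInv.fourierInv φ := by
    ext y
    rw [h y, Real.fourierInv_eq']
    refine integral_congr_ae (Eventually.of_forall fun w => ?_)
    simp only [smul_eq_mul]
    congr 2
    simp [mul_comm]; ring
  have hφu : FourierTransform.fourier u = φ := by
    rw [hinv]
    refine hφc.fourier_fourierInv_eq hφ ?_
    have : FourierTransform.fourier φ = fun y => u (-y) := by
      ext y
      rw [hinv, Real.fourierInv_eq_fourier_neg]; simp
    rw [this]
    exact hu.comp_neg
  have key : ∫ w, φ w * (starRingEnd ℂ) (φ w) = ∫ y, u y * (starRingEnd ℂ) (u y) := by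
    have hcj : Integrable (fun w => (starRingEnd ℂ) (φ w)) := by
      exact (LinearIsometryEquiv.integrable_comp_iff (conjLIE)).2 hφ
    have := VectorFourier.integral_fourierIntegral_smul_eq_flip (L := innerₗ ℝ) (e := Real.fourierChar)
      (μ := volume) (ν := volume) Real.continuous_fourierChar continuous_inner hu hcj
    have e1 : ∀ w, VectorFourier.fourierIntegral Real.fourierChar volume (innerₗ ℝ) u w = φ w := by
      intro w; rw [← hφu]; rfl
    have e2 : ∀ y, VectorFourier.fourierIntegral Real.fourierChar volume (innerₗ ℝ).flip
        (fun w => (starRingEnd ℂ) (φ w)) y = (starRingEnd ℂ) (u y) := by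
      intro y
      rw [hinv, Real.fourierInv_eq, ← integral_conj]
      refine integral_congr_ae (Eventually.of_forall fun w => ?_)
      simp only [Circle.smul_def, smul_eq_mul, map_mul, LinearMap.flip_apply, innerₗ_apply_apply,
        AddChar.map_neg_eq_inv, Circle.coe_inv_eq_conj, real_inner_comm]
    simp only [e1, e2, smul_eq_mul] at this
    exact this
  have hub : ∀ y, ‖u y‖ ≤ ∫ w, ‖φ w‖ := by
    intro y
    rw [h y]
    refine (norm_integral_le_integral_norm _).trans (le_of_eq ?_)
    refine integral_congr_ae (Eventually.of_forall fun w => ?_)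
    simp [Complex.norm_exp]
  have hφb : ∀ w, ‖φ w‖ ≤ ∫ y, ‖u y‖ := by
    intro w
    rw [← hφu, Real.fourier_eq']
    refine (norm_integral_le_integral_norm _).trans (le_of_eq ?_)
    refine integral_congr_ae (Eventually.of_forall fun w => ?_)
    simp [Complex.norm_exp]
  have conv : ∀ (v : ℝ → ℂ) (B : ℝ), Integrable v → (∀ y, ‖v y‖ ≤ B) →
      ∫⁻ y, ‖v y‖ₑ ^ 2 = ENNReal.ofReal (∫ y, v y * (starRingEnd ℂ) (v y)).re := by
    intro v B hv hB
    have hsq : Integrable (fun y => ‖v y‖ ^ 2) := by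
      refine (hv.norm.const_mul B).mono' (hv.1.norm.pow 2) (Eventually.of_forall fun y => ?_)
      have := hB y
      have h9 : ‖v y‖ * ‖v y‖ ≤ B * ‖v y‖ := mul_le_mul_of_nonneg_right this (norm_nonneg _)
      rw [Real.norm_of_nonneg (by positivity), sq]
      exact h9
    have e : ∀ y, v y * (starRingEnd ℂ) (v y) = ((‖v y‖ ^ 2 : ℝ) : ℂ) := by
      intro y; rw [Complex.mul_conj, normSq_eq_norm_sq]
    simp only [e]
    rw [integral_complex_ofReal, ofReal_re, ofReal_integral_eq_lintegral_ofReal hsq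
      (Eventually.of_forall fun y => by positivity)]
    refine lintegral_congr fun y => ?_
    rw [ENNReal.ofReal_pow (norm_nonneg _), ofReal_norm]
  rw [conv u _ hu hub, conv φ _ hφ hφb, key]

/-- moving average -/
def smo (f : ℝ → ℂ) (h : ℝ) (y : ℝ) : ℂ := (1 / h : ℝ) * ∫ v in (y - h)..y, f v

lemma locint_of_bound {f : ℝ → ℂ} (hfm : Measurable f) {C : ℝ}
    (hfb : ∀ y, ‖f y‖ ≤ C * Real.exp (3 / 2 * y)) (a b : ℝ) : IntervalIntegrable f volume a b := by
  have : IntervalIntegrable (fun y => C * Real.exp (3 / 2 * y)) volume a b :=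
    (by fun_prop : Continuous fun y => C * Real.exp (3 / 2 * y)).intervalIntegrable _ _
  refine this.mono_fun hfm.aestronglyMeasurable (Eventually.of_forall fun y => ?_)
  exact (hfb y).trans (le_abs_self _)

lemma smo_eq {f : ℝ → ℂ} (hi : ∀ a b, IntervalIntegrable f volume a b) (h y : ℝ) :
    smo f h y = (1 / h : ℝ) * ((∫ v in (0:ℝ)..y, f v) - ∫ v in (0:ℝ)..(y-h), f v) := by
  rw [smo, intervalIntegral.integral_interval_sub_left (hi _ _) (hi _ _)]

lemma smo_continuous {f : ℝ → ℂ} (hi : ∀ a b, IntervalIntegrable f volume a b) (h : ℝ) :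
    Continuous (smo f h) := by
  have h1 := intervalIntegral.continuous_primitive hi 0
  have : smo f h = fun y => (1 / h : ℝ) * ((∫ v in (0:ℝ)..y, f v) - ∫ v in (0:ℝ)..(y-h), f v) := by
    ext y; exact smo_eq hi h y
  rw [this]
  exact continuous_const.mul (h1.sub (h1.comp (continuous_id.sub continuous_const)))

lemma smo_zero {f : ℝ → ℂ} (hf0 : ∀ y < 0, f y = 0) {h : ℝ} (hh : 0 < h) {y : ℝ} (hy : y < 0) :
    smo f h y = 0 := by
  rw [smo, intervalIntegral.integral_of_le (by linarith), setIntegral_eq_zero_of_forall_eq_zero]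
  · simp
  · intro x hx; exact hf0 x (hx.2.trans_lt hy)

lemma smo_transform {f : ℝ → ℂ} {h : ℝ} (hh : 0 < h) {s : ℂ} (hs : s ≠ 0)
    (hg : Integrable (fun y : ℝ => cexp (-s * y) * f y)) :
    Integrable (fun y : ℝ => cexp (-s * y) * smo f h y) ∧
    ∫ y : ℝ, cexp (-s * y) * smo f h y =
      (∫ y : ℝ, cexp (-s * y) * f y) * ((1 - cexp (-(h * s))) / (h * s)) := by
  set k : ℝ → ℂ := Set.indicator (Set.Ico 0 h) (fun v : ℝ => (1 / h : ℝ) * cexp (-s * v)) with hk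
  have hki : Integrable k := by
    rw [hk, integrable_indicator_iff measurableSet_Ico]
    refine IntegrableOn.mono_set ?_ Set.Ico_subset_Icc_self
    exact (by fun_prop : Continuous (fun v : ℝ => ((1 / h : ℝ) : ℂ) * cexp (-s * v))).integrableOn_Icc
  have hkI : ∫ v, k v = (1 - cexp (-(h * s))) / (h * s) := by
    rw [hk, integral_indicator measurableSet_Ico, integral_Ico_eq_integral_Ioc,
      ← intervalIntegral.integral_of_le hh.le, intervalIntegral.integral_const_mul,
      integral_exp_mul_complex (neg_ne_zero.2 hs)]
    have : (h : ℂ) ≠ 0 := by exact_mod_cast hh.ne'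
    push_cast
    rw [show -s * (h:ℂ) = -(h * s) by ring]
    simp only [mul_zero, Complex.exp_zero]
    field_simp
    ring
  have hconv : convolution (fun y : ℝ => cexp (-s * y) * f y) k (ContinuousLinearMap.mul ℂ ℂ) volume
      = fun y : ℝ => cexp (-s * y) * smo f h y := by
    ext y
    rw [convolution, smo, intervalIntegral.integral_of_le (by linarith), ← integral_indicator measurableSet_Ioc,
      ← integral_const_mul, ← integral_const_mul]
    refine integral_congr_ae (Eventually.of_forall fun t => ?_)
    simp only [ContinuousLinearMap.mul_apply', hk]
    by_cases ht : t ∈ Set.Ioc (y - h) y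
    · rw [Set.indicator_of_mem ht, Set.indicator_of_mem (show y - t ∈ Set.Ico 0 h from
        ⟨by linarith [ht.2], by linarith [ht.1]⟩)]
      have : cexp (-s * y) = cexp (-s * t) * cexp (-s * (y - t : ℝ)) := by
        rw [← Complex.exp_add]; congr 1; push_cast; ring
      rw [this]; ring
    · rw [Set.indicator_of_notMem ht, Set.indicator_of_notMem]
      · simp
      · intro hc; exact ht ⟨by linarith [hc.2], by linarith [hc.1]⟩
  constructor
  · rw [← hconv]
    exact hg.integrable_convolution _ hki
  · rw [← hconv, integral_convolution _ hg hki, hkI]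
    rfl

lemma integrable_laplace {f : ℝ → ℂ} (hfm : Measurable f) (hf0 : ∀ y < 0, f y = 0) {C : ℝ}
    (hfb : ∀ y, ‖f y‖ ≤ C * Real.exp (3 / 2 * y)) {s : ℂ} (hs : 3 / 2 < s.re) :
    Integrable (fun y : ℝ => cexp (-s * y) * f y) := by
  have h1 : Integrable (Set.indicator (Set.Ici 0) (fun y : ℝ => C * Real.exp (-(s.re - 3 / 2) * y))) := by
    rw [integrable_indicator_iff measurableSet_Ici, integrableOn_Ici_iff_integrableOn_Ioi]
    exact (exp_neg_integrableOn_Ioi 0 (by linarith)).const_mul C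
  refine h1.mono' ?_ (Eventually.of_forall fun y => ?_)
  · exact ((by fun_prop : Continuous fun y : ℝ => cexp (-s * y)).measurable.mul hfm).aestronglyMeasurable
  · by_cases hy : y < 0
    · rw [hf0 y hy, Set.indicator_of_notMem (by simpa using hy)]; simp
    · rw [Set.indicator_of_mem (by simpa using hy), norm_mul, Complex.norm_exp]
      have : -(s.re - 3 / 2) * y = -s.re * y + 3 / 2 * y := by ring
      rw [this, Real.exp_add]
      have h2 := hfb y
      have h3 : (-s * (y:ℂ)).re = -s.re * y := by simp
      rw [h3]
      calc Real.exp (-s.re * y) * ‖f y‖ ≤ Real.exp (-s.re * y) * (C * Real.exp (3 / 2 * y)) := by gcongr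
        _ = _ := by ring

lemma norm_one_sub_exp_le {z : ℂ} (hz : 0 ≤ z.re) : ‖1 - cexp (-z)‖ ≤ ‖z‖ := by
  have h1 : ∀ t : ℝ, HasDerivAt (fun t : ℝ => -cexp (-(t * z))) (z * cexp (-(t * z))) t := by
    intro t
    have h2 : HasDerivAt (fun t : ℝ => -(t * z)) (-(1 * z)) t :=
      ((hasDerivAt_id (t:ℝ)).ofReal_comp.mul_const z).neg
    exact h2.cexp.neg.congr_deriv (by ring)
  have h2 := intervalIntegral.integral_eq_sub_of_hasDerivAt (a := 0) (b := 1) (fun t _ => h1 t)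
    ((by fun_prop : Continuous fun t : ℝ => z * cexp (-(t * z))).intervalIntegrable _ _)
  have h3 : 1 - cexp (-z) = ∫ t in (0:ℝ)..1, z * cexp (-(t * z)) := by
    rw [h2]; simp; ring
  rw [h3]
  have := intervalIntegral.norm_integral_le_of_norm_le_const (a := 0) (b := 1) (C := ‖z‖)
    (f := fun t : ℝ => z * cexp (-(t * z))) (by
      intro t ht
      rw [Set.uIoc_of_le zero_le_one] at ht
      rw [norm_mul, Complex.norm_exp]
      refine mul_le_of_le_one_right (norm_nonneg _) ?_
      rw [Real.exp_le_one_iff]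
      simp
      exact mul_nonneg ht.1.le hz)
  simpa using this

lemma norm_smooth_factor_le {h : ℝ} (hh : 0 < h) {s : ℂ} (hs : 0 < s.re) :
    ‖(1 - cexp (-(h * s))) / (h * s)‖ ≤ 1 := by
  have h1 := norm_one_sub_exp_le (z := h * s) (by simp; positivity)
  rw [norm_div]
  exact div_le_one_of_le₀ h1 (norm_nonneg _)

lemma norm_ge_one_add {σ : ℝ} (hσ : 0 < σ) {s : ℂ} (hs : σ ≤ s.re) :
    1 + |s.im| ≤ (1 + 1 / σ) * ‖s‖ := by
  have h1 := Complex.abs_im_le_norm s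
  have h2 : σ ≤ ‖s‖ := hs.trans (Complex.re_le_norm s)
  have : 1 ≤ 1 / σ * ‖s‖ := by
    rw [one_div, inv_mul_eq_div, le_div_iff₀ hσ]; linarith
  linarith

lemma norm_smooth_factor_le' {h σ : ℝ} (hh : 0 < h) (hσ : 0 < σ) {s : ℂ} (hs : σ ≤ s.re) :
    ‖(1 - cexp (-(h * s))) / (h * s)‖ ≤ 2 / h * (1 + 1 / σ) * (1 + |s.im|) ^ (-1 : ℝ) := by
  have hs0 : 0 < ‖s‖ := (hσ.trans_le hs).trans_le (Complex.re_le_norm s)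
  have h1 : ‖1 - cexp (-(h * s))‖ ≤ 2 := by
    refine (norm_sub_le _ _).trans ?_
    rw [norm_one, Complex.norm_exp]
    have : Real.exp ((-(h * s)).re) ≤ 1 := by
      rw [Real.exp_le_one_iff]; simp
      exact mul_nonneg hh.le (hσ.le.trans hs)
    linarith
  have h2 := norm_ge_one_add hσ hs
  have h3 : 0 < 1 + |s.im| := by positivity
  rw [norm_div, norm_mul, norm_real, Real.norm_of_nonneg hh.le, Real.rpow_neg_one]
  calc ‖1 - cexp (-(h * s))‖ / (h * ‖s‖) ≤ 2 / (h * ‖s‖) := by gcongr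
    _ = 2 / h * (1 / ‖s‖) := by field_simp
    _ ≤ 2 / h * ((1 + 1 / σ) * (1 + |s.im|)⁻¹) := by
      gcongr
      rw [div_le_iff₀ hs0, mul_assoc, mul_comm _ ‖s‖, ← mul_assoc, ← div_eq_mul_inv, le_div_iff₀ h3]
      linarith
    _ = _ := by ring

lemma smo_inversion {f : ℝ → ℂ} (hfm : Measurable f) (hf0 : ∀ y < 0, f y = 0) {C : ℝ}
    (hfb : ∀ y, ‖f y‖ ≤ C * Real.exp (3 / 2 * y)) {σ D : ℝ} (hσ : 0 < σ) (hσ2 : σ ≤ 2) {F : ℂ → ℂ}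
    (hF : DifferentiableOn ℂ F {s | σ ≤ s.re ∧ s.re ≤ 2})
    (hL : ∀ s : ℂ, s.re = 2 → ∫ y : ℝ, cexp (-s * y) * f y = F s)
    (hFb : ∀ s : ℂ, σ ≤ s.re → s.re ≤ 2 → ‖F s‖ ≤ D * (1 + |s.im|) ^ (-(3 / 4) : ℝ)) {h : ℝ} (hh : 0 < h) :
    Continuous (fun w : ℝ => F (σ + (2 * Real.pi * w : ℝ) * I) *
      ((1 - cexp (-(h * (σ + (2 * Real.pi * w : ℝ) * I)))) / (h * (σ + (2 * Real.pi * w : ℝ) * I)))) ∧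
    Integrable (fun w : ℝ => F (σ + (2 * Real.pi * w : ℝ) * I) *
      ((1 - cexp (-(h * (σ + (2 * Real.pi * w : ℝ) * I)))) / (h * (σ + (2 * Real.pi * w : ℝ) * I)))) ∧
    ∀ y : ℝ, cexp (-σ * y) * smo f h y = ∫ w : ℝ, cexp (2 * Real.pi * I * w * y) *
      (F (σ + (2 * Real.pi * w : ℝ) * I) *
      ((1 - cexp (-(h * (σ + (2 * Real.pi * w : ℝ) * I)))) / (h * (σ + (2 * Real.pi * w : ℝ) * I)))) := by
  have hi := locint_of_bound hfm hfb
  set Fh : ℂ → ℂ := fun s => F s * ((1 - cexp (-(h * s))) / (h * s)) with hFh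
  have hD : 0 ≤ D := by
    have := (norm_nonneg _).trans (hFb 2 (by simpa using hσ2) (by simp))
    simpa using this
  set D' := D * (2 / h * (1 + 1 / σ)) with hD'
  have hFhd : DifferentiableOn ℂ Fh {s | σ ≤ s.re ∧ s.re ≤ 2} := by
    refine hF.mul (DifferentiableOn.div (by fun_prop) (by fun_prop) ?_)
    intro s hs
    have : s ≠ 0 := by rintro rfl; simp at hs; linarith
    have : (h:ℂ) ≠ 0 := by exact_mod_cast hh.ne'
    positivity
  have hFhb : ∀ s : ℂ, σ ≤ s.re → s.re ≤ 2 → ‖Fh s‖ ≤ D' * (1 + |s.im|) ^ (-(7 / 4) : ℝ) := by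
    intro s h1 h2
    have h3 : (0:ℝ) < 1 + |s.im| := by positivity
    rw [hFh, norm_mul, show (-(7 / 4) : ℝ) = -(3/4) + -1 by norm_num, Real.rpow_add h3]
    calc _ ≤ (D * (1 + |s.im|) ^ (-(3 / 4) : ℝ)) * (2 / h * (1 + 1 / σ) * (1 + |s.im|) ^ (-1 : ℝ)) := by
          gcongr
          · exact hFb s h1 h2
          · exact norm_smooth_factor_le' hh hσ h1
      _ = _ := by rw [hD']; ring
  have hcont : ∀ x, σ ≤ x → x ≤ 2 → Continuous (fun t : ℝ => Fh (x + t * I)) := by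
    intro x h1 h2
    refine hFhd.continuousOn.comp_continuous (by fun_prop) ?_
    intro t; simp [h1, h2]
  have hIntg : ∀ x, σ ≤ x → x ≤ 2 → Integrable (fun t : ℝ => Fh (x + t * I)) := by
    intro x h1 h2
    refine vertical_integrable (D := D') (p := 7/4) (by norm_num) (hcont x h1 h2) ?_
    intro t
    simpa using hFhb (x + t * I) (by simpa using h1) (by simpa using h2)
  have h2π : (2 * Real.pi) ≠ 0 := by positivity
  have hcontw : ∀ x, σ ≤ x → x ≤ 2 → Continuous (fun w : ℝ => Fh (x + (2 * Real.pi * w : ℝ) * I)) :=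
    fun x h1 h2 => (hcont x h1 h2).comp (by fun_prop : Continuous fun w : ℝ => 2 * Real.pi * w)
  have hintw : ∀ x, σ ≤ x → x ≤ 2 → Integrable (fun w : ℝ => Fh (x + (2 * Real.pi * w : ℝ) * I)) :=
    fun x h1 h2 => (hIntg x h1 h2).comp_mul_left' h2π
  -- change of variables
  have hcv : ∀ (x : ℝ) (y : ℝ), ∫ w : ℝ, cexp (2 * Real.pi * I * w * y) * Fh (x + (2 * Real.pi * w : ℝ) * I)
      = |(2 * Real.pi)⁻¹| • (cexp (-x * y) * ∫ t : ℝ, cexp ((x + t * I) * y) * Fh (x + t * I)) := by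
    intro x y
    have := Measure.integral_comp_mul_left
      (fun t : ℝ => cexp (t * I * y) * Fh (x + t * I)) (2 * Real.pi)
    rw [← integral_const_mul]
    have e : ∀ t : ℝ, cexp (-x * y) * (cexp ((x + t * I) * y) * Fh (x + t * I)) =
        cexp (t * I * y) * Fh (x + t * I) := by
      intro t; rw [← mul_assoc, ← Complex.exp_add]; congr 2; ring
    simp only [e]
    rw [← this]
    refine integral_congr_ae (Eventually.of_forall fun w => ?_)
    simp only
    congr 2; push_cast; ring
  -- inversion at 2
  have hinv2 : ∀ y : ℝ, cexp (-(2:ℝ) * y) * smo f h y =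
      ∫ w : ℝ, cexp (2 * Real.pi * I * w * y) * Fh ((2:ℝ) + (2 * Real.pi * w : ℝ) * I) := by
    set u : ℝ → ℂ := fun y => cexp (-(2:ℝ) * y) * smo f h y with hu
    have huc : Continuous u := (by fun_prop : Continuous fun y : ℝ => cexp (-(2:ℝ) * y)).mul
      (smo_continuous hi h)
    have htr : ∀ s : ℂ, s.re = 2 → Integrable (fun y : ℝ => cexp (-s * y) * smo f h y) ∧
        ∫ y : ℝ, cexp (-s * y) * smo f h y = Fh s := by
      intro s hs
      have := smo_transform (f := f) hh (s := s) (by rintro rfl; simp at hs)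
        (integrable_laplace hfm hf0 hfb (by rw [hs]; norm_num))
      rw [hL s hs] at this
      exact this
    have hui : Integrable u := by
      have := (htr 2 (by simp)).1
      simpa [hu] using this
    have hFu : FourierTransform.fourier u = fun w : ℝ => Fh ((2:ℝ) + (2 * Real.pi * w : ℝ) * I) := by
      ext w
      rw [Real.fourier_eq', ← (htr ((2:ℝ) + (2 * Real.pi * w : ℝ) * I) (by simp)).2]
      refine integral_congr_ae (Eventually.of_forall fun y => ?_)
      simp only [hu, smul_eq_mul]
      rw [← mul_assoc, ← Complex.exp_add]
      congr 2
      simp; ring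
    have := huc.fourierInv_fourier_eq hui (by rw [hFu]; exact hintw 2 hσ2 le_rfl)
    intro y
    have h3 := congrFun this y
    change _ = u y at h3
    change u y = _
    rw [← h3, hFu, Real.fourierInv_eq']
    refine integral_congr_ae (Eventually.of_forall fun w => ?_)
    simp only [smul_eq_mul]
    congr 2
    simp [mul_comm]; ring
  refine ⟨hcontw σ le_rfl hσ2, hintw σ le_rfl hσ2, fun y => ?_⟩
  have hsh := vertical_shift (E := fun s => cexp (s * y) * Fh s) (a := σ) (b := 2) (p := 7/4)
    (D := Real.exp (2 * |y|) * D') hσ2 (by norm_num)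
    (DifferentiableOn.mul (by fun_prop) hFhd) (by
      intro s h1 h2
      rw [norm_mul, Complex.norm_exp, mul_assoc]
      have : (s * (y:ℂ)).re ≤ 2 * |y| := by
        simp
        calc s.re * y ≤ s.re * |y| := by gcongr; linarith; exact le_abs_self y
          _ ≤ 2 * |y| := by gcongr
      gcongr
      exact hFhb s h1 h2)
  have e1 := hinv2 y
  rw [hcv] at e1
  change _ = ∫ w : ℝ, cexp (2 * Real.pi * I * w * y) * Fh (σ + (2 * Real.pi * w : ℝ) * I)
  rw [hcv, hsh]
  have e2 : cexp (-σ * y) = cexp (-σ * y) * cexp (2 * y) * cexp (-(2:ℝ) * y) := by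
    rw [← Complex.exp_add, ← Complex.exp_add]; congr 1; push_cast; ring
  rw [e2, mul_assoc, e1]
  have e3 : cexp (2 * y) * cexp (-(2:ℝ) * y) = 1 := by
    rw [← Complex.exp_add]; simp
  simp only [Complex.real_smul]
  linear_combination (cexp (-σ * y) * (|(2 * Real.pi)⁻¹| : ℝ) * ∫ t : ℝ, cexp (((2:ℝ) + t * I) * y) * Fh ((2:ℝ) + t * I)) * (e3 - e3)

lemma smo_tendsto {f : ℝ → ℂ} (hi : ∀ a b, IntervalIntegrable f volume a b) :
    ∀ᵐ y, Tendsto (fun n : ℕ => smo f (1 / ((n:ℝ) + 1)) y) atTop (𝓝 (f y)) := by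
  have hli : LocallyIntegrable f := by
    intro x
    refine ⟨Set.Icc (x - 1) (x + 1), Icc_mem_nhds (by linarith) (by linarith), ?_⟩
    have := (hi (x - 1) (x + 1))
    rwa [intervalIntegrable_iff_integrableOn_Icc_of_le (by linarith)] at this
  filter_upwards [_root_.LocallyIntegrable.ae_hasDerivAt_integral hli] with y hy
  have hd := hy 0
  rw [hasDerivAt_iff_tendsto_slope_zero] at hd
  have h1 : Tendsto (fun n : ℕ => -(1 / ((n:ℝ) + 1))) atTop (𝓝[≠] 0) := by
    rw [tendsto_nhdsWithin_iff]
    constructor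
    · simpa using (tendsto_one_div_add_atTop_nhds_zero_nat (𝕜 := ℝ)).neg
    · refine Eventually.of_forall fun n => ?_
      have : (0:ℝ) < 1 / ((n:ℝ) + 1) := by positivity
      simp only [Set.mem_compl_iff, Set.mem_singleton_iff]
      linarith
  have h2 := hd.comp h1
  refine h2.congr fun n => ?_
  simp only [Function.comp]
  rw [smo_eq hi, Complex.real_smul]
  have : ((n:ℝ) + 1) ≠ 0 := by positivity
  rw [show (-(1 / ((n:ℝ) + 1)))⁻¹ = - (1 / (1 / ((n:ℝ) + 1))) by field_simp]
  push_cast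
  rw [← sub_eq_add_neg]
  ring

/-- Theorem P. -/
theorem laplace_plancherel {f : ℝ → ℂ} (hfm : Measurable f) (hf0 : ∀ y < 0, f y = 0) {C : ℝ}
    (hfb : ∀ y, ‖f y‖ ≤ C * Real.exp (3 / 2 * y)) {σ' σ D : ℝ} (hσ' : 0 < σ') (hσσ : σ' < σ) (hσ2 : σ ≤ 2)
    {F : ℂ → ℂ}
    (hF : DifferentiableOn ℂ F {s | σ' ≤ s.re ∧ s.re ≤ 2})
    (hL : ∀ s : ℂ, s.re = 2 → ∫ y : ℝ, cexp (-s * y) * f y = F s)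
    (hFb : ∀ s : ℂ, σ' ≤ s.re → s.re ≤ 2 → ‖F s‖ ≤ D * (1 + |s.im|) ^ (-(3 / 4) : ℝ)) :
    ∫⁻ y : ℝ, ‖cexp (-σ * y) * f y‖ₑ ^ 2 ≤ ∫⁻ t : ℝ, ‖F (σ + t * I)‖ₑ ^ 2 := by
  have hi := locint_of_bound hfm hfb
  have hσ : 0 < σ := hσ'.trans hσσ
  have hh : ∀ h > 0, ∫⁻ y : ℝ, ‖cexp (-σ * y) * smo f h y‖ₑ ^ 2 ≤ ∫⁻ t : ℝ, ‖F (σ + t * I)‖ₑ ^ 2 := by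
    intro h hh
    obtain ⟨-, hi1, he1⟩ := smo_inversion hfm hf0 hfb hσ' (hσσ.le.trans hσ2) hF hL hFb hh
    obtain ⟨hc2, hi2, he2⟩ := smo_inversion hfm hf0 hfb hσ hσ2
      (hF.mono fun s hs => ⟨hσσ.le.trans hs.1, hs.2⟩) hL
      (fun s h1 h2 => hFb s (hσσ.le.trans h1) h2) hh
    have hub : ∃ B, ∀ y : ℝ, ‖cexp (-σ' * y) * smo f h y‖ ≤ B := by
      refine ⟨∫ w : ℝ, ‖F (σ' + (2 * Real.pi * w : ℝ) * I) *
      ((1 - cexp (-(h * (σ' + (2 * Real.pi * w : ℝ) * I)))) / (h * (σ' + (2 * Real.pi * w : ℝ) * I)))‖, fun y => ?_⟩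
      rw [he1 y]
      refine (norm_integral_le_integral_norm _).trans (le_of_eq ?_)
      refine integral_congr_ae (Eventually.of_forall fun w => ?_)
      simp only
      rw [norm_mul, Complex.norm_exp]
      simp
    obtain ⟨B, hB⟩ := hub
    have hui : Integrable (fun y : ℝ => cexp (-σ * y) * smo f h y) := by
      have h1 : Integrable (Set.indicator (Set.Ici 0) (fun y : ℝ => B * Real.exp (-(σ - σ') * y))) := by
        rw [integrable_indicator_iff measurableSet_Ici, integrableOn_Ici_iff_integrableOn_Ioi]
        exact (exp_neg_integrableOn_Ioi 0 (by linarith)).const_mul B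
      refine h1.mono' ?_ (Eventually.of_forall fun y => ?_)
      · exact ((by fun_prop : Continuous fun y : ℝ => cexp (-σ * y)).mul (smo_continuous hi h)).aestronglyMeasurable
      · by_cases hy : y < 0
        · rw [smo_zero hf0 hh hy, Set.indicator_of_notMem (by simpa using hy)]; simp
        · rw [Set.indicator_of_mem (by simpa using hy)]
          have e : cexp (-σ * y) = (Real.exp (-(σ - σ') * y) : ℝ) * cexp (-σ' * y) := by
            rw [ofReal_exp, ← Complex.exp_add]; congr 1; push_cast; ring
          rw [e, mul_assoc, norm_mul, norm_real, Real.norm_of_nonneg (Real.exp_nonneg _), mul_comm]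
          gcongr
          exact hB y
    rw [plancherel_pair _ _ hui hi2 hc2 he2]
    calc _ ≤ ∫⁻ w : ℝ, ‖F (σ + (2 * Real.pi * w : ℝ) * I)‖ₑ ^ 2 := by
          refine lintegral_mono fun w => ?_
          rw [enorm_mul]
          have : ‖(1 - cexp (-(h * (σ + (2 * Real.pi * w : ℝ) * I)))) / (h * (σ + (2 * Real.pi * w : ℝ) * I))‖ₑ ≤ 1 := by
            rw [← ofReal_norm]
            exact ENNReal.ofReal_le_one.2 (norm_smooth_factor_le hh (by simpa using hσ))
          gcongr
          exact mul_le_of_le_one_right' this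
      _ = ENNReal.ofReal |(2 * Real.pi)⁻¹| * ∫⁻ t : ℝ, ‖F (σ + t * I)‖ₑ ^ 2 := by
          have h8 := lintegral_map_equiv (μ := volume) (fun t : ℝ => ‖F (σ + t * I)‖ₑ ^ 2) (MeasurableEquiv.mulLeft₀ (2 * Real.pi) (by positivity))
          refine h8.symm.trans ?_
          have := Real.map_volume_mul_left (a := 2 * Real.pi) (by positivity)
          change ∫⁻ a, _ ∂(Measure.map (fun x => 2 * Real.pi * x) volume) = _
          rw [this, lintegral_smul_measure]; rfl
      _ ≤ _ := by
          refine mul_le_of_le_one_left' ?_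
          refine ENNReal.ofReal_le_one.2 ?_
          rw [abs_of_pos (by positivity)]
          refine inv_le_one_of_one_le₀ ?_
          linarith [Real.pi_gt_three]
  have hlim := smo_tendsto hi
  calc _ = ∫⁻ y : ℝ, liminf (fun n : ℕ => ‖cexp (-σ * y) * smo f (1 / ((n:ℝ) + 1)) y‖ₑ ^ 2) atTop := by
        refine lintegral_congr_ae ?_
        filter_upwards [hlim] with y hy
        have : Tendsto (fun n : ℕ => ‖cexp (-σ * y) * smo f (1 / ((n:ℝ) + 1)) y‖ₑ ^ 2) atTop
            (𝓝 (‖cexp (-σ * y) * f y‖ₑ ^ 2)) :=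
          ((ENNReal.continuous_pow 2).tendsto _).comp ((continuous_enorm.tendsto _).comp (hy.const_mul _))
        exact this.liminf_eq.symm
    _ ≤ liminf (fun n : ℕ => ∫⁻ y : ℝ, ‖cexp (-σ * y) * smo f (1 / ((n:ℝ) + 1)) y‖ₑ ^ 2) atTop := by
        refine lintegral_liminf_le fun n => ?_
        exact (((by fun_prop : Continuous fun y : ℝ => cexp (-σ * y)).mul
          (smo_continuous hi _)).measurable.enorm).pow_const 2
    _ ≤ _ := by
        refine liminf_le_of_frequently_le' (Eventually.frequently (Eventually.of_forall fun n => ?_))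
        exact hh _ (by positivity)

structure NiceL (L : ℂ → ℂ) : Prop where
  diff : DifferentiableOn ℂ L {s | 0 < s.re}
  growth : ∃ A > 0, ∀ s : ℂ, 1 / 8 ≤ s.re → s.re ≤ 4 → ‖L s‖ ≤ A * (|s.im| + 2) ^ (A:ℝ)
  low : ∃ c > 0, ∀ s : ℂ, s.re = 2 → c ≤ ‖L s‖

lemma isOpen_rePos : IsOpen {s : ℂ | 0 < s.re} := isOpen_lt continuous_const Complex.continuous_re

lemma NiceL.local {L : ℂ → ℂ} (hL : NiceL L) : ∃ K > 0, ∀ t : ℝ, ∃ Z : Finset ℂ,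
    (∀ ρ, ρ ∈ Z ↔ ρ ∈ Metric.closedBall ((2:ℝ) + t * I) (185/100) ∧ L ρ = 0) ∧
    ∑ ρ ∈ Z, (analyticOrderNatAt L ρ : ℝ) ≤ K * Real.log (|t| + 2) ∧
    ∀ z ∈ Metric.closedBall ((2:ℝ) + t * I) (183/100), L z ≠ 0 →
      ‖logDeriv L z - ∑ ρ ∈ Z, (analyticOrderNatAt L ρ : ℂ) / (z - ρ)‖ ≤ K * Real.log (|t| + 2) := by
  obtain ⟨A, hA, hgr⟩ := hL.growth
  obtain ⟨c, hc, hlow⟩ := hL.low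
  obtain ⟨K, hK, hloc⟩ := local_zeros (r := 183/100) (r1 := 185/100) (R := 15/8)
    (by norm_num) (by norm_num) (by norm_num)
  have hl2 : 0 < Real.log 2 := Real.log_pos (by norm_num)
  set B := 2 * A + |Real.log (A / c)| / Real.log 2 + 1 / Real.log 2 with hB
  have hBp : 0 < B := by positivity
  refine ⟨K * B, by positivity, fun t => ?_⟩
  have hlt : Real.log 2 ≤ Real.log (|t| + 2) := Real.log_le_log (by norm_num) (by linarith [abs_nonneg t])
  have hlt0 : 0 < Real.log (|t| + 2) := hl2.trans_le hlt
  have hM : 1 ≤ B * Real.log (|t| + 2) := by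
    have h1 : 1 / Real.log 2 * Real.log 2 ≤ B * Real.log (|t| + 2) := by
      gcongr
      rw [hB]
      have : 0 ≤ 2 * A + |Real.log (A / c)| / Real.log 2 := by positivity
      linarith
    rwa [one_div, inv_mul_cancel₀ hl2.ne'] at h1
  have hre : ∀ z ∈ Metric.closedBall ((2:ℝ) + t * I : ℂ) (15/8), 1/8 ≤ z.re ∧ z.re ≤ 4 ∧ |z.im| ≤ |t| + 2 := by
    intro z hz
    rw [Metric.mem_closedBall, dist_eq_norm] at hz
    have h1 := (Complex.abs_re_le_norm _).trans hz
    have h2 := (Complex.abs_im_le_norm _).trans hz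
    simp at h1 h2
    rw [abs_le] at h1
    have h3 : |z.im| ≤ |z.im - t| + |t| := by simpa using abs_add_le (z.im - t) t
    refine ⟨by linarith [h1.1], by linarith [h1.2], by linarith⟩
  have hcl := hloc L ((2:ℝ) + t * I) (B * Real.log (|t| + 2)) hM
    ((hL.diff.mono (fun z hz => by
      have := (hre z hz).1
      simp only [Set.mem_setOf_eq]; linarith)).diffContOnCl_ball subset_rfl)
    (by
      have := hlow ((2:ℝ) + t * I) (by simp)
      exact norm_pos_iff.1 (hc.trans_le this))
    (by
      intro z hz
      obtain ⟨h1, h2, h3⟩ := hre z hz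
      have h4 := hgr z h1 h2
      have h5 := hlow ((2:ℝ) + t * I) (by simp)
      have hb : (0:ℝ) < |t| + 2 := by positivity
      have h6 : |z.im| + 2 ≤ (|t| + 2) ^ 2 := by nlinarith [abs_nonneg t]
      calc ‖L z‖ ≤ A * ((|t| + 2) ^ 2) ^ A := h4.trans (by gcongr)
        _ = c * Real.exp (Real.log (A / c) + 2 * A * Real.log (|t| + 2)) := by
            rw [Real.exp_add, Real.exp_log (by positivity), ← Real.rpow_natCast, ← Real.rpow_mul hb.le,
              Real.rpow_def_of_pos hb]
            rw [show Real.log (|t| + 2) * (((2:ℕ):ℝ) * A) = 2 * A * Real.log (|t| + 2) by push_cast; ring]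
            field_simp
        _ ≤ ‖L ((2:ℝ) + t * I)‖ * Real.exp (B * Real.log (|t| + 2)) := by
            gcongr
            have h7 : Real.log (A / c) ≤ |Real.log (A / c)| / Real.log 2 * Real.log (|t| + 2) := by
              calc Real.log (A / c) ≤ |Real.log (A / c)| := le_abs_self _
                _ = |Real.log (A / c)| / Real.log 2 * Real.log 2 := by field_simp
                _ ≤ _ := by gcongr
            have h8 : 0 ≤ 1 / Real.log 2 * Real.log (|t| + 2) := by positivity
            rw [hB]
            linarith)
  obtain ⟨Z, hZ1, hZ2, hZ3⟩ := hcl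
  refine ⟨Z, hZ1, ?_, ?_⟩
  · rw [mul_assoc]; exact hZ2
  · rw [mul_assoc]; exact hZ3

lemma mem_disc {x t t' : ℝ} (h1 : 1/4 ≤ x) (h2 : x ≤ 2) (ht : |t' - t| ≤ 1/2) :
    ((x:ℂ) + t' * I) ∈ Metric.closedBall ((2:ℝ) + t * I : ℂ) (183/100) := by
  rw [Metric.mem_closedBall, dist_eq_norm]
  have e : ((x:ℂ) + t' * I - ((2:ℝ) + t * I)) = ((x - 2 : ℝ) : ℂ) + ((t' - t : ℝ) : ℂ) * I := by
    push_cast; ring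
  rw [e, Complex.norm_add_mul_I, Real.sqrt_le_left (by norm_num)]
  have := abs_le.1 ht
  nlinarith

lemma norm_sum_div_le {Z : Finset ℂ} {m : ℂ → ℕ} {s : ℂ} {d : ℝ} (hd : 0 < d)
    (h : ∀ ρ ∈ Z, d ≤ ‖s - ρ‖) :
    ‖∑ ρ ∈ Z, (m ρ : ℂ) / (s - ρ)‖ ≤ (∑ ρ ∈ Z, (m ρ : ℝ)) / d := by
  refine (norm_sum_le _ _).trans ?_
  rw [Finset.sum_div]
  refine Finset.sum_le_sum fun ρ hρ => ?_
  rw [norm_div, Complex.norm_natCast]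
  have := h ρ hρ
  gcongr

lemma re_sub_le_norm (s ρ : ℂ) : s.re - ρ.re ≤ ‖s - ρ‖ := by
  simpa using Complex.re_le_norm (s - ρ)

lemma NiceL.pointwise {L : ℂ → ℂ} (hL : NiceL L) {β : ℝ} (hβ : 1/4 ≤ β)
    (hz : ∀ ρ : ℂ, 0 < ρ.re → L ρ = 0 → ρ.re ≤ β) :
    ∃ K > 0, ∀ s : ℂ, β < s.re → s.re ≤ 2 →
      ‖logDeriv L s‖ ≤ K * (1 + 1 / (s.re - β)) * Real.log (|s.im| + 2) := by
  obtain ⟨K, hK, h⟩ := hL.local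
  refine ⟨K, hK, fun s h1 h2 => ?_⟩
  obtain ⟨Z, hZ1, hZ2, hZ3⟩ := h s.im
  have hs : s ∈ Metric.closedBall ((2:ℝ) + s.im * I : ℂ) (183/100) := by
    have := mem_disc (x := s.re) (t := s.im) (t' := s.im) (by linarith) h2 (by simp)
    rwa [Complex.re_add_im] at this
  have hne : L s ≠ 0 := by
    intro h0
    have := hz s (by linarith) h0
    linarith
  have h3 := hZ3 s hs hne
  have hd : 0 < s.re - β := by linarith
  have h4 := norm_sum_div_le (Z := Z) (m := fun ρ => analyticOrderNatAt L ρ) (s := s) hd (by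
    intro ρ hρ
    obtain ⟨h5, h6⟩ := (hZ1 ρ).1 hρ
    have h7 : 0 < ρ.re := by
      rw [Metric.mem_closedBall, dist_eq_norm] at h5
      have h1 := (Complex.abs_re_le_norm _).trans h5
      simp at h1
      rw [abs_le] at h1
      linarith [h1.1]
    have := hz ρ h7 h6
    linarith [re_sub_le_norm s ρ])
  have h5 : ‖logDeriv L s‖ ≤ K * Real.log (|s.im| + 2) + K * Real.log (|s.im| + 2) / (s.re - β) := by
    calc ‖logDeriv L s‖ = ‖(logDeriv L s - ∑ ρ ∈ Z, (analyticOrderNatAt L ρ : ℂ) / (s - ρ)) + ∑ ρ ∈ Z, (analyticOrderNatAt L ρ : ℂ) / (s - ρ)‖ := by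
          congr 1; ring
      _ ≤ _ := (norm_add_le _ _).trans (add_le_add h3 (h4.trans (by gcongr)))
  refine h5.trans (le_of_eq ?_)
  field_simp

lemma integral_lorentz {η : ℝ} (hη : 0 < η) (γ : ℝ) :
    Integrable (fun t : ℝ => (η ^ 2 + (t - γ) ^ 2)⁻¹) ∧ ∫ t : ℝ, (η ^ 2 + (t - γ) ^ 2)⁻¹ = Real.pi / η := by
  have e : ∀ t : ℝ, (η ^ 2 + (t - γ) ^ 2)⁻¹ = (η ^ 2)⁻¹ * (1 + ((t - γ) / η) ^ 2)⁻¹ := by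
    intro t
    rw [← mul_inv]; congr 1; field_simp
  simp only [e]
  constructor
  · refine Integrable.const_mul ?_ _
    exact (integrable_inv_one_add_sq.comp_div hη.ne').comp_sub_right γ
  · rw [integral_const_mul, integral_sub_right_eq_self (fun t : ℝ => (1 + (t / η) ^ 2)⁻¹) γ,
      Measure.integral_comp_div (fun t : ℝ => (1 + t ^ 2)⁻¹), integral_univ_inv_one_add_sq, smul_eq_mul, abs_of_pos hη]
    field_simp

lemma enorm_sq_eq (z : ℂ) : ‖z‖ₑ ^ 2 = ENNReal.ofReal (‖z‖ ^ 2) := by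
  rw [ENNReal.ofReal_pow (norm_nonneg _), ofReal_norm]

lemma norm_sq_sum_le {W : Finset ℂ} {m : ℂ → ℕ} {β η : ℝ} (hη : 0 < η) (hW : ∀ ρ ∈ W, ρ.re ≤ β) (t : ℝ) :
    ‖∑ ρ ∈ W, (m ρ : ℂ) / ((β + η : ℝ) + t * I - ρ)‖ ^ 2 ≤
      (∑ ρ ∈ W, (m ρ : ℝ)) * ∑ ρ ∈ W, (m ρ : ℝ) * (η ^ 2 + (t - ρ.im) ^ 2)⁻¹ := by
  have h1 : ∀ ρ ∈ W, η ^ 2 + (t - ρ.im) ^ 2 ≤ ‖((β + η : ℝ) + t * I - ρ : ℂ)‖ ^ 2 := by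
    intro ρ hρ
    have := hW ρ hρ
    rw [← Complex.normSq_eq_norm_sq, Complex.normSq_apply]
    simp
    nlinarith
  have h2 : ‖∑ ρ ∈ W, (m ρ : ℂ) / ((β + η : ℝ) + t * I - ρ)‖ ≤
      ∑ ρ ∈ W, Real.sqrt (m ρ) * (Real.sqrt (m ρ) * ‖((β + η : ℝ) + t * I - ρ : ℂ)‖⁻¹) := by
    refine (norm_sum_le _ _).trans (le_of_eq (Finset.sum_congr rfl fun ρ _ => ?_))
    rw [norm_div, Complex.norm_natCast, ← mul_assoc, Real.mul_self_sqrt (Nat.cast_nonneg _), div_eq_mul_inv]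
  calc _ ≤ (∑ ρ ∈ W, Real.sqrt (m ρ) * (Real.sqrt (m ρ) * ‖((β + η : ℝ) + t * I - ρ : ℂ)‖⁻¹)) ^ 2 := by
        gcongr
    _ ≤ (∑ ρ ∈ W, Real.sqrt (m ρ) ^ 2) * ∑ ρ ∈ W, (Real.sqrt (m ρ) * ‖((β + η : ℝ) + t * I - ρ : ℂ)‖⁻¹) ^ 2 :=
        Finset.sum_mul_sq_le_sq_mul_sq _ _ _
    _ ≤ _ := by
        have e : ∀ ρ : ℂ, Real.sqrt (m ρ) ^ 2 = m ρ := fun ρ => Real.sq_sqrt (Nat.cast_nonneg _)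
        simp only [mul_pow, e]
        refine mul_le_mul_of_nonneg_left (Finset.sum_le_sum fun ρ hρ => ?_) (by positivity)
        rw [inv_pow]
        have := h1 ρ hρ
        gcongr

lemma ms_sum {W : Finset ℂ} {m : ℂ → ℕ} {β η : ℝ} (hη : 0 < η) (hW : ∀ ρ ∈ W, ρ.re ≤ β) :
    ∫⁻ t : ℝ, ‖∑ ρ ∈ W, (m ρ : ℂ) / ((β + η : ℝ) + t * I - ρ)‖ₑ ^ 2 ≤
      ENNReal.ofReal (Real.pi * (∑ ρ ∈ W, (m ρ : ℝ)) ^ 2 / η) := by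
  have hIntg : Integrable (fun t : ℝ => (∑ ρ ∈ W, (m ρ : ℝ)) * ∑ ρ ∈ W, (m ρ : ℝ) * (η ^ 2 + (t - ρ.im) ^ 2)⁻¹) := by
    refine Integrable.const_mul (integrable_finset_sum _ fun ρ _ => ?_) _
    exact (integral_lorentz hη ρ.im).1.const_mul _
  have hI : ∫ t : ℝ, (∑ ρ ∈ W, (m ρ : ℝ)) * ∑ ρ ∈ W, (m ρ : ℝ) * (η ^ 2 + (t - ρ.im) ^ 2)⁻¹ =
      Real.pi * (∑ ρ ∈ W, (m ρ : ℝ)) ^ 2 / η := by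
    rw [integral_const_mul, integral_finset_sum _ (fun ρ _ => (integral_lorentz hη ρ.im).1.const_mul _)]
    simp only [integral_const_mul, (integral_lorentz hη _).2]
    rw [← Finset.sum_mul]; ring
  rw [← hI, ofReal_integral_eq_lintegral_ofReal hIntg (Eventually.of_forall fun t => by
    simp only [Pi.zero_apply]
    positivity)]
  refine lintegral_mono fun t => ?_
  rw [enorm_sq_eq]
  exact ENNReal.ofReal_le_ofReal (norm_sq_sum_le hη hW t)

/-- The transform with finitely many poles removed. -/
def FS (L : ℂ → ℂ) (S : Finset ℂ) (s : ℂ) : ℂ :=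
  -logDeriv L s / s + ∑ ρ ∈ S, ((analyticOrderNatAt L ρ : ℂ) / ρ) / (s - ρ)

lemma FS_decomp {L : ℂ → ℂ} (S Z : Finset ℂ) (s : ℂ) (hs : s ≠ 0) (hS : ∀ ρ ∈ S, ρ ≠ 0 ∧ s - ρ ≠ 0) :
    s * FS L S s = -(logDeriv L s - ∑ ρ ∈ Z, (analyticOrderNatAt L ρ : ℂ) / (s - ρ)) +
      ∑ ρ ∈ S, (analyticOrderNatAt L ρ : ℂ) / ρ + ∑ ρ ∈ S \ Z, (analyticOrderNatAt L ρ : ℂ) / (s - ρ)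
      - ∑ ρ ∈ Z \ S, (analyticOrderNatAt L ρ : ℂ) / (s - ρ) := by
  have h1 : s * FS L S s = -logDeriv L s + (∑ ρ ∈ S, (analyticOrderNatAt L ρ : ℂ) / ρ +
      ∑ ρ ∈ S, (analyticOrderNatAt L ρ : ℂ) / (s - ρ)) := by
    rw [FS, mul_add, mul_div_cancel₀ _ hs, Finset.mul_sum, ← Finset.sum_add_distrib]
    congr 1
    refine Finset.sum_congr rfl fun ρ hρ => ?_
    obtain ⟨h2, h3⟩ := hS ρ hρ
    field_simp
    ring
  have h2 := Finset.sum_inter_add_sum_sdiff S Z (fun ρ => (analyticOrderNatAt L ρ : ℂ) / (s - ρ))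
  have h3 := Finset.sum_inter_add_sum_sdiff Z S (fun ρ => (analyticOrderNatAt L ρ : ℂ) / (s - ρ))
  rw [Finset.inter_comm] at h3
  rw [h1, ← h2, ← h3]
  ring

def wInt (n : ℤ) : ℝ := (1 + |(n:ℝ)|) ^ (-(3/2) : ℝ)

lemma wInt_pos (n : ℤ) : 0 < wInt n := by unfold wInt; positivity

lemma wInt_summable : Summable wInt := by
  have h := (Real.summable_one_div_int_add_rpow 0 (3/2)).2 (by norm_num)
  have h2 : Summable (fun n : ℤ => if n = 0 then (1:ℝ) else 0) := (hasSum_ite_eq 0 (1:ℝ)).summable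
  refine Summable.of_nonneg_of_le (fun n => (wInt_pos n).le) (fun n => ?_) (h.add h2)
  unfold wInt
  by_cases hn : n = 0
  · subst hn; simp
  · have : 0 < |(n:ℝ)| := abs_pos.2 (by exact_mod_cast hn)
    simp only [add_zero, hn, if_false]
    rw [Real.rpow_neg (by positivity), one_div]
    gcongr
    linarith

lemma log_int_le (n : ℤ) : Real.log (|(n:ℝ) + 1/2| + 2) ^ 2 * (1 + |(n:ℝ)|)⁻¹ ^ 2 ≤ 64 * wInt n := by
  have h0 : 0 ≤ |(n:ℝ)| := abs_nonneg _
  have h1 : |(n:ℝ) + 1/2| + 2 ≤ 3 * (1 + |(n:ℝ)|) := by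
    have := abs_add_le (n:ℝ) (1/2)
    rw [abs_of_pos (by norm_num : (0:ℝ) < 1/2)] at this
    linarith
  have h2 : 0 ≤ Real.log (|(n:ℝ) + 1/2| + 2) := Real.log_nonneg (by linarith [abs_nonneg ((n:ℝ) + 1/2)])
  have h3 : Real.log (|(n:ℝ) + 1/2| + 2) ≤ 8 * (1 + |(n:ℝ)|) ^ (1/4:ℝ) := by
    have := Real.log_le_rpow_div (x := |(n:ℝ) + 1/2| + 2) (by positivity) (ε := 1/4) (by norm_num)
    refine this.trans ?_
    have h4 : (|(n:ℝ) + 1/2| + 2) ^ (1/4:ℝ) ≤ (16 * (1 + |(n:ℝ)|)) ^ (1/4:ℝ) := by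
      apply Real.rpow_le_rpow (by positivity) (by linarith) (by norm_num)
    rw [Real.mul_rpow (by norm_num) (by positivity)] at h4
    have h5 : (16:ℝ) ^ (1/4:ℝ) = 2 := by
      rw [show (16:ℝ) = 2 ^ (4:ℝ) by norm_num, ← Real.rpow_mul (by norm_num)]; norm_num
    rw [h5] at h4
    linarith
  calc _ ≤ (8 * (1 + |(n:ℝ)|) ^ (1/4:ℝ)) ^ 2 * (1 + |(n:ℝ)|)⁻¹ ^ 2 := by gcongr
    _ = _ := by
      unfold wInt
      rw [mul_pow, ← Real.rpow_natCast (_ ^ (1/4:ℝ)), ← Real.rpow_mul (by positivity), ← Real.rpow_neg_one,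
        ← Real.rpow_natCast ((1 + |(n:ℝ)|) ^ (-1:ℝ)), ← Real.rpow_mul (by positivity), mul_assoc, ← Real.rpow_add (by positivity)]
      norm_num

lemma inv_sq_le_wInt (n : ℤ) : (1 + |(n:ℝ)|)⁻¹ ^ 2 ≤ wInt n := by
  have h0 : 0 ≤ |(n:ℝ)| := abs_nonneg _
  unfold wInt
  rw [← Real.rpow_neg_one, ← Real.rpow_natCast, ← Real.rpow_mul (by positivity)]
  apply Real.rpow_le_rpow_of_exponent_le (by linarith)
  norm_num

/-- the pieces of local information on the n-th interval -/
structure LocZ (L : ℂ → ℂ) (K : ℝ) (Z : ℤ → Finset ℂ) : Prop where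
  mem : ∀ n ρ, ρ ∈ Z n ↔ ρ ∈ Metric.closedBall ((2:ℝ) + ((n + 1/2 : ℝ)) * I : ℂ) (185/100) ∧ L ρ = 0
  cnt : ∀ n, ∑ ρ ∈ Z n, (analyticOrderNatAt L ρ : ℝ) ≤ K * Real.log (|(n:ℝ) + 1/2| + 2)
  app : ∀ n : ℤ, ∀ z ∈ Metric.closedBall ((2:ℝ) + ((n + 1/2 : ℝ)) * I : ℂ) (183/100), L z ≠ 0 →
      ‖logDeriv L z - ∑ ρ ∈ Z n, (analyticOrderNatAt L ρ : ℂ) / (z - ρ)‖ ≤ K * Real.log (|(n:ℝ) + 1/2| + 2)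

lemma NiceL.locZ {L : ℂ → ℂ} (hL : NiceL L) : ∃ K > 0, ∃ Z, LocZ L K Z := by
  obtain ⟨K, hK, h⟩ := hL.local
  choose Z h1 h2 h3 using fun n : ℤ => h (n + 1/2)
  exact ⟨K, hK, Z, ⟨h1, h2, h3⟩⟩

lemma LocZ.re_le {L : ℂ → ℂ} {K : ℝ} {Z} (h : LocZ L K Z) {β : ℝ} (hz : ∀ ρ, 0 < ρ.re → L ρ = 0 → ρ.re ≤ β)
    {n : ℤ} {ρ : ℂ} (hρ : ρ ∈ Z n) : 0 < ρ.re ∧ L ρ = 0 ∧ ρ.re ≤ β := by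
  obtain ⟨h1, h2⟩ := (h.mem n ρ).1 hρ
  have h3 : 0 < ρ.re := by
    rw [Metric.mem_closedBall, dist_eq_norm] at h1
    have := (Complex.abs_re_le_norm _).trans h1
    simp at this
    rw [abs_le] at this
    linarith [this.1]
  exact ⟨h3, h2, hz ρ h3 h2⟩

/-- the S-constant -/
def AS (L : ℂ → ℂ) (S : Finset ℂ) : ℝ := ∑ ρ ∈ S, (analyticOrderNatAt L ρ : ℝ) / ‖ρ‖ + ∑ ρ ∈ S, (analyticOrderNatAt L ρ : ℝ) / (2/100)

lemma AS_nonneg (L : ℂ → ℂ) (S : Finset ℂ) : 0 ≤ AS L S := by unfold AS; positivity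

lemma LocZ.pt {L : ℂ → ℂ} {K : ℝ} {Z} (h : LocZ L K Z) {β : ℝ} (hβ : 1/4 ≤ β) (hβ1 : β ≤ 1)
    (hz : ∀ ρ, 0 < ρ.re → L ρ = 0 → ρ.re ≤ β) {S : Finset ℂ} (hS : ∀ ρ ∈ S, L ρ = 0 ∧ ρ.re = β)
    {η : ℝ} (hη : 0 < η) (hη1 : η ≤ 1) (n : ℤ) {t : ℝ} (ht : t ∈ Set.Ioc (n:ℝ) (n+1)) :
    ‖FS L S ((β + η : ℝ) + t * I)‖ ^ 2 ≤ 200 * (1 + |(n:ℝ)|)⁻¹ ^ 2 * ((K * Real.log (|(n:ℝ) + 1/2| + 2) + AS L S) ^ 2 +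
      ‖∑ ρ ∈ Z n \ S, (analyticOrderNatAt L ρ : ℂ) / ((β + η : ℝ) + t * I - ρ)‖ ^ 2) := by
  set s : ℂ := (β + η : ℝ) + t * I with hs
  have hsre : s.re = β + η := by simp [hs]
  have hsim : s.im = t := by simp [hs]
  have hs0 : s ≠ 0 := fun h0 => by rw [h0] at hsre; simp at hsre; linarith
  have hmem : s ∈ Metric.closedBall ((2:ℝ) + ((n + 1/2 : ℝ)) * I : ℂ) (183/100) := by
    apply mem_disc (by linarith) (by linarith)
    rw [abs_le]; constructor <;> linarith [ht.1, ht.2]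
  have hLs : L s ≠ 0 := fun h0 => by
    have := hz s (by rw [hsre]; linarith) h0
    linarith
  have hd := FS_decomp (L := L) S (Z n) s hs0 (fun ρ hρ => by
    have := (hS ρ hρ).2
    refine ⟨fun h0 => ?_, fun h0 => ?_⟩
    · rw [h0] at this; simp at this; linarith
    · have h2 := congrArg Complex.re h0
      simp [hsre] at h2; linarith)
  have h1 := h.app n s hmem hLs
  have h2 : ‖∑ ρ ∈ S, (analyticOrderNatAt L ρ : ℂ) / ρ‖ ≤ ∑ ρ ∈ S, (analyticOrderNatAt L ρ : ℝ) / ‖ρ‖ := by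
    refine (norm_sum_le _ _).trans (le_of_eq (Finset.sum_congr rfl fun ρ _ => ?_))
    rw [norm_div, Complex.norm_natCast]
  have h3 : ‖∑ ρ ∈ S \ Z n, (analyticOrderNatAt L ρ : ℂ) / (s - ρ)‖ ≤ ∑ ρ ∈ S, (analyticOrderNatAt L ρ : ℝ) / (2/100) := by
    refine (norm_sum_le _ _).trans ?_
    refine le_trans (Finset.sum_le_sum (g := fun ρ => (analyticOrderNatAt L ρ : ℝ) / (2/100)) fun ρ hρ => ?_) 
      (Finset.sum_le_sum_of_subset_of_nonneg Finset.sdiff_subset fun ρ _ _ => by positivity)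
    rw [norm_div, Complex.norm_natCast]
    rw [Finset.mem_sdiff, h.mem] at hρ
    have h4 : ρ ∉ Metric.closedBall ((2:ℝ) + ((n + 1/2 : ℝ)) * I : ℂ) (185/100) := fun h5 => hρ.2 ⟨h5, (hS ρ hρ.1).1⟩
    rw [Metric.mem_closedBall] at hmem h4
    have h6 := dist_triangle ρ s ((2:ℝ) + ((n + 1/2 : ℝ)) * I : ℂ)
    rw [dist_comm ρ s, dist_eq_norm s ρ] at h6
    gcongr
    linarith
  have h4 : ‖s‖ * ‖FS L S s‖ ≤ K * Real.log (|(n:ℝ) + 1/2| + 2) + AS L S + ‖∑ ρ ∈ Z n \ S, (analyticOrderNatAt L ρ : ℂ) / (s - ρ)‖ := by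
    rw [← norm_mul, hd]
    refine (norm_sub_le _ _).trans (add_le_add_left ?_ _)
    refine (norm_add_le _ _).trans ?_
    refine (add_le_add_left (norm_add_le _ _) _).trans ?_
    rw [norm_neg, AS]; linarith
  have h5 : (1 + |(n:ℝ)|) / 10 ≤ ‖s‖ := by
    have := norm_ge_one_add (σ := 1/4) (s := s) (by norm_num) (by rw [hsre]; linarith)
    rw [hsim] at this
    have h6 : |(n:ℝ)| ≤ |t| + 1 := by
      have := abs_sub_abs_le_abs_sub (n:ℝ) t
      have h7 : |(n:ℝ) - t| ≤ 1 := by rw [abs_le]; constructor <;> linarith [ht.1, ht.2]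
      linarith
    norm_num at this
    linarith [abs_nonneg t]
  set X := K * Real.log (|(n:ℝ) + 1/2| + 2) + AS L S
  set Y := ‖∑ ρ ∈ Z n \ S, (analyticOrderNatAt L ρ : ℂ) / (s - ρ)‖
  have hn : 0 < 1 + |(n:ℝ)| := by positivity
  have h6 : (1 + |(n:ℝ)|) / 10 * ‖FS L S s‖ ≤ X + Y := (mul_le_mul_of_nonneg_right h5 (norm_nonneg _)).trans h4
  have h7 : ((1 + |(n:ℝ)|) / 10 * ‖FS L S s‖) ^ 2 ≤ (X + Y) ^ 2 := by gcongr
  have h8 : ‖FS L S s‖ ^ 2 = 100 * (1 + |(n:ℝ)|)⁻¹ ^ 2 * ((1 + |(n:ℝ)|) / 10 * ‖FS L S s‖) ^ 2 := by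
    field_simp
    norm_num
  rw [h8]
  calc _ ≤ 100 * (1 + |(n:ℝ)|)⁻¹ ^ 2 * (2 * (X ^ 2 + Y ^ 2)) := by
        gcongr
        nlinarith [sq_nonneg (X - Y)]
    _ = _ := by ring

lemma LocZ.int_gen {L : ℂ → ℂ} {K : ℝ} (hK : 0 < K) {Z} (h : LocZ L K Z) {β : ℝ} (hβ : 1/4 ≤ β) (hβ1 : β ≤ 1)
    (hz : ∀ ρ, 0 < ρ.re → L ρ = 0 → ρ.re ≤ β) {S : Finset ℂ} (hS : ∀ ρ ∈ S, L ρ = 0 ∧ ρ.re = β)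
    {η : ℝ} (hη : 0 < η) (hη1 : η ≤ 1) (n : ℤ) :
    ∫⁻ t in Set.Ioc (n:ℝ) (n+1), ‖FS L S ((β + η : ℝ) + t * I)‖ₑ ^ 2 ≤
      ENNReal.ofReal (wInt n * (400 * (64 * K ^ 2 + AS L S ^ 2)) + wInt n * (12800 * Real.pi * K ^ 2) / η) := by
  set c := 200 * (1 + |(n:ℝ)|)⁻¹ ^ 2 with hc
  have hc0 : 0 ≤ c := by positivity
  set ℓ := Real.log (|(n:ℝ) + 1/2| + 2) with hℓ
  have hl : 0 ≤ ℓ := Real.log_nonneg (by linarith [abs_nonneg ((n:ℝ) + 1/2)])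
  have hW : ∀ ρ ∈ Z n \ S, ρ.re ≤ β := fun ρ hρ => (h.re_le hz (Finset.mem_sdiff.1 hρ).1).2.2
  have hcnt : ∑ ρ ∈ Z n \ S, (analyticOrderNatAt L ρ : ℝ) ≤ K * ℓ :=
    (Finset.sum_le_sum_of_subset_of_nonneg Finset.sdiff_subset fun ρ _ _ => by positivity).trans (h.cnt n)
  calc _ ≤ ∫⁻ t in Set.Ioc (n:ℝ) (n+1), (ENNReal.ofReal (c * (K * ℓ + AS L S) ^ 2) + ENNReal.ofReal c *
        ‖∑ ρ ∈ Z n \ S, (analyticOrderNatAt L ρ : ℂ) / ((β + η : ℝ) + t * I - ρ)‖ₑ ^ 2) := by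
        refine setLIntegral_mono' measurableSet_Ioc fun t ht => ?_
        rw [enorm_sq_eq, enorm_sq_eq, ← ENNReal.ofReal_mul hc0, ← ENNReal.ofReal_add (by positivity) (by positivity), ← mul_add]
        exact ENNReal.ofReal_le_ofReal (h.pt hβ hβ1 hz hS hη hη1 n ht)
    _ = ENNReal.ofReal (c * (K * ℓ + AS L S) ^ 2) + ENNReal.ofReal c * ∫⁻ t in Set.Ioc (n:ℝ) (n+1),
        ‖∑ ρ ∈ Z n \ S, (analyticOrderNatAt L ρ : ℂ) / ((β + η : ℝ) + t * I - ρ)‖ₑ ^ 2 := by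
        rw [lintegral_add_left measurable_const, lintegral_const_mul' _ _ ENNReal.ofReal_ne_top]
        simp
    _ ≤ ENNReal.ofReal (c * (K * ℓ + AS L S) ^ 2) + ENNReal.ofReal c * ENNReal.ofReal (Real.pi * (K * ℓ) ^ 2 / η) := by
        gcongr
        refine (setLIntegral_le_lintegral _ _).trans ((ms_sum hη hW).trans (ENNReal.ofReal_le_ofReal ?_))
        gcongr
    _ ≤ _ := by
        rw [← ENNReal.ofReal_mul hc0, ← ENNReal.ofReal_add (by positivity) (by positivity)]
        apply ENNReal.ofReal_le_ofReal
        have e1 := log_int_le n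
        have e2 := inv_sq_le_wInt n
        rw [← hℓ] at e1
        set u := (1 + |(n:ℝ)|)⁻¹ ^ 2
        have hu : 0 ≤ u := by positivity
        refine add_le_add ?_ ?_
        · have : (K * ℓ + AS L S) ^ 2 ≤ 2 * (K ^ 2 * ℓ ^ 2) + 2 * AS L S ^ 2 := by nlinarith [sq_nonneg (K * ℓ - AS L S)]
          calc _ ≤ c * (2 * (K ^ 2 * ℓ ^ 2) + 2 * AS L S ^ 2) := by gcongr
            _ = 400 * K ^ 2 * (ℓ ^ 2 * u) + 400 * AS L S ^ 2 * u := by rw [hc]; ring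
            _ ≤ 400 * K ^ 2 * (64 * wInt n) + 400 * AS L S ^ 2 * wInt n := by gcongr
            _ = _ := by ring
        · calc _ = 200 * Real.pi * K ^ 2 * (ℓ ^ 2 * u) / η := by rw [hc]; ring
            _ ≤ 200 * Real.pi * K ^ 2 * (64 * wInt n) / η := by gcongr
            _ = _ := by ring

lemma LocZ.int_fin {L : ℂ → ℂ} {K : ℝ} {Z} (h : LocZ L K Z) {β : ℝ} (hβ : 1/4 ≤ β) (hβ1 : β ≤ 1)
    (hz : ∀ ρ, 0 < ρ.re → L ρ = 0 → ρ.re ≤ β) {S : Finset ℂ} (hS : ∀ ρ ∈ S, L ρ = 0 ∧ ρ.re = β)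
    (n : ℤ) (hn : ∀ ρ ∈ Z n, ρ.re = β → ρ ∈ S) :
    ∃ b ≥ 0, ∀ η : ℝ, 0 < η → η ≤ 1 → ∫⁻ t in Set.Ioc (n:ℝ) (n+1), ‖FS L S ((β + η : ℝ) + t * I)‖ₑ ^ 2 ≤ ENNReal.ofReal b := by
  set M := ∑ ρ ∈ Z n \ S, (analyticOrderNatAt L ρ : ℝ) / (β - ρ.re) with hM
  refine ⟨200 * (1 + |(n:ℝ)|)⁻¹ ^ 2 * ((K * Real.log (|(n:ℝ) + 1/2| + 2) + AS L S) ^ 2 + M ^ 2), by positivity, fun η hη hη1 => ?_⟩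
  calc _ ≤ ∫⁻ t in Set.Ioc (n:ℝ) (n+1), ENNReal.ofReal (200 * (1 + |(n:ℝ)|)⁻¹ ^ 2 * ((K * Real.log (|(n:ℝ) + 1/2| + 2) + AS L S) ^ 2 + M ^ 2)) := by
        refine setLIntegral_mono' measurableSet_Ioc fun t ht => ?_
        rw [enorm_sq_eq]
        apply ENNReal.ofReal_le_ofReal
        refine (h.pt hβ hβ1 hz hS hη hη1 n ht).trans ?_
        gcongr
        refine (norm_sum_le _ _).trans (Finset.sum_le_sum fun ρ hρ => ?_)
        rw [Finset.mem_sdiff] at hρ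
        have h1 : ρ.re < β := lt_of_le_of_ne (h.re_le hz hρ.1).2.2 (fun h2 => hρ.2 (hn ρ hρ.1 h2))
        rw [norm_div, Complex.norm_natCast]
        have h2 : β - ρ.re ≤ ‖((β + η : ℝ) + t * I - ρ : ℂ)‖ := by
          refine le_trans ?_ (Complex.re_le_norm _)
          simp; linarith
        have h3 : 0 < β - ρ.re := by linarith
        gcongr
    _ = _ := by simp

lemma iUnion_Ioc_lintegral (f : ℝ → ENNReal) : ∫⁻ t, f t = ∑' n : ℤ, ∫⁻ t in Set.Ioc (n:ℝ) (n+1), f t := by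
  rw [← lintegral_iUnion (fun _ => measurableSet_Ioc), iUnion_Ioc_intCast, setLIntegral_univ]
  exact Set.pairwise_disjoint_Ioc_intCast ℝ

theorem NiceL.mean_sq {L : ℂ → ℂ} (hL : NiceL L) {β : ℝ} (hβ : 1/4 ≤ β) (hβ1 : β ≤ 1)
    (hz : ∀ ρ, 0 < ρ.re → L ρ = 0 → ρ.re ≤ β) {ε : ℝ} (hε : 0 < ε) :
    ∃ S : Finset ℂ, (∀ ρ ∈ S, L ρ = 0 ∧ ρ.re = β) ∧ ∃ C, ∀ η : ℝ, 0 < η → η ≤ 1 →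
      ∫⁻ t : ℝ, ‖FS L S ((β + η : ℝ) + t * I)‖ₑ ^ 2 ≤ ENNReal.ofReal (C + ε / η) := by
  obtain ⟨K, hK, Z, h⟩ := hL.locZ
  set D := 12800 * Real.pi * K ^ 2 with hD
  have hDp : 0 < D := by positivity
  obtain ⟨J, hJ⟩ : ∃ J : Finset ℤ, ∑' n : {n // n ∉ J}, wInt n < ε / D := by
    have := tendsto_tsum_compl_atTop_zero wInt
    exact (this.eventually_lt_const (show (0:ℝ) < ε / D by positivity)).exists
  set S := (J.biUnion Z).filter (fun ρ => ρ.re = β) with hSdef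
  have hS : ∀ ρ ∈ S, L ρ = 0 ∧ ρ.re = β := by
    intro ρ hρ
    rw [hSdef, Finset.mem_filter, Finset.mem_biUnion] at hρ
    obtain ⟨⟨n, _, h1⟩, h2⟩ := hρ
    exact ⟨(h.re_le hz h1).2.1, h2⟩
  have hfin : ∀ n : ℤ, ∃ b ≥ 0, n ∈ J → ∀ η : ℝ, 0 < η → η ≤ 1 → ∫⁻ t in Set.Ioc (n:ℝ) (n+1), ‖FS L S ((β + η : ℝ) + t * I)‖ₑ ^ 2 ≤ ENNReal.ofReal b := by
    intro n
    by_cases hn : n ∈ J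
    · obtain ⟨b, hb, h1⟩ := h.int_fin hβ hβ1 hz hS n (fun ρ hρ h2 => by
        rw [hSdef, Finset.mem_filter, Finset.mem_biUnion]
        exact ⟨⟨n, hn, hρ⟩, h2⟩)
      exact ⟨b, hb, fun _ => h1⟩
    · exact ⟨0, le_rfl, fun h1 => absurd h1 hn⟩
  choose b hb0 hb using hfin
  set E := 400 * (64 * K ^ 2 + AS L S ^ 2) with hE
  have hE0 : 0 ≤ E := by positivity
  refine ⟨S, hS, ∑ n ∈ J, b n + E * ∑' n, wInt n, fun η hη hη1 => ?_⟩
  rw [iUnion_Ioc_lintegral, ← ENNReal.sum_add_tsum_compl J]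
  have hsw : Summable (fun n : {n // n ∉ J} => wInt n) := wInt_summable.subtype _
  have e1 : ∑ n ∈ J, ∫⁻ t in Set.Ioc (n:ℝ) (n+1), ‖FS L S ((β + η : ℝ) + t * I)‖ₑ ^ 2 ≤ ENNReal.ofReal (∑ n ∈ J, b n) := by
    rw [ENNReal.ofReal_sum_of_nonneg (fun n _ => hb0 n)]
    exact Finset.sum_le_sum fun n hn => hb n hn η hη hη1
  have e2 : ∑' n : ((J : Set ℤ)ᶜ : Set ℤ), ∫⁻ t in Set.Ioc ((n:ℤ):ℝ) ((n:ℤ)+1), ‖FS L S ((β + η : ℝ) + t * I)‖ₑ ^ 2 ≤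
      ENNReal.ofReal (E * ∑' n, wInt n + ε / η) := by
    calc _ ≤ ∑' n : ((J : Set ℤ)ᶜ : Set ℤ), ENNReal.ofReal (wInt n * E + wInt n * D / η) :=
          ENNReal.tsum_le_tsum fun n => h.int_gen hK hβ hβ1 hz hS hη hη1 n
      _ = ENNReal.ofReal (∑' n : ((J : Set ℤ)ᶜ : Set ℤ), (wInt n * E + wInt n * D / η)) := by
          rw [ENNReal.ofReal_tsum_of_nonneg]
          · intro n
            have := wInt_pos n
            positivity
          · have := (wInt_summable.subtype ((J : Set ℤ)ᶜ)).mul_right (E + D / η)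
            refine this.congr fun n => ?_
            simp only [Function.comp]; ring
      _ ≤ _ := by
          apply ENNReal.ofReal_le_ofReal
          have e : ∀ n : ((J : Set ℤ)ᶜ : Set ℤ), wInt n * E + wInt n * D / η = (E + D / η) * wInt n := fun n => by ring
          simp only [e]
          rw [tsum_mul_left]
          have e3 : ∑' n : ((J : Set ℤ)ᶜ : Set ℤ), wInt n ≤ ∑' n, wInt n :=
            wInt_summable.tsum_subtype_le wInt _ (fun n => (wInt_pos n).le)
          have e4 : ∑' n : ((J : Set ℤ)ᶜ : Set ℤ), wInt n ≤ ε / D := hJ.le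
          rw [add_mul]
          refine add_le_add (mul_le_mul_of_nonneg_left e3 hE0) ?_
          calc _ ≤ D / η * (ε / D) := by gcongr
            _ = _ := by field_simp
  refine (add_le_add e1 e2).trans ?_
  rw [← ENNReal.ofReal_add (Finset.sum_nonneg fun n _ => hb0 n)]
  · apply ENNReal.ofReal_le_ofReal; linarith
  · have : 0 ≤ ∑' n, wInt n := tsum_nonneg fun n => (wInt_pos n).le
    positivity

lemma logDeriv_diffOn {L : ℂ → ℂ} (hd : DifferentiableOn ℂ L {s | 0 < s.re}) {s : ℂ} (hs : 0 < s.re) (hLs : L s ≠ 0) :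
    DifferentiableAt ℂ (logDeriv L) s := by
  have h1 : DifferentiableAt ℂ L s := (hd s hs).differentiableAt (isOpen_rePos.mem_nhds hs)
  have h2 : DifferentiableAt ℂ (deriv L) s := ((hd.deriv isOpen_rePos) s hs).differentiableAt (isOpen_rePos.mem_nhds hs)
  exact h2.div h1 hLs

lemma log_le_quarter (t : ℝ) : Real.log (|t| + 2) ≤ 8 * (1 + |t|) ^ (1/4:ℝ) := by
  have h0 := abs_nonneg t
  have := Real.log_le_rpow_div (x := |t| + 2) (by positivity) (ε := 1/4) (by norm_num)
  refine this.trans ?_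
  have h4 : (|t| + 2) ^ (1/4:ℝ) ≤ (16 * (1 + |t|)) ^ (1/4:ℝ) := by
    apply Real.rpow_le_rpow (by positivity) (by linarith) (by norm_num)
  rw [Real.mul_rpow (by norm_num) (by positivity)] at h4
  have h5 : (16:ℝ) ^ (1/4:ℝ) = 2 := by
    rw [show (16:ℝ) = 2 ^ (4:ℝ) by norm_num, ← Real.rpow_mul (by norm_num)]; norm_num
  rw [h5] at h4
  linarith

lemma NiceL.logDeriv_div_bound {L : ℂ → ℂ} (hL : NiceL L) {β : ℝ} (hβ : 1/4 ≤ β)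
    (hz : ∀ ρ, 0 < ρ.re → L ρ = 0 → ρ.re ≤ β) {σ' : ℝ} (hσ : β < σ') :
    ∃ D, 0 ≤ D ∧ ∀ s : ℂ, σ' ≤ s.re → s.re ≤ 2 → ‖-logDeriv L s / s‖ ≤ D * (1 + |s.im|) ^ (-(3/4):ℝ) := by
  obtain ⟨K, hK, h⟩ := hL.pointwise hβ hz
  have hδ : 0 < σ' - β := by linarith
  refine ⟨5 * (K * (1 + 1 / (σ' - β)) * 8), by positivity, fun s h1 h2 => ?_⟩
  have h3 := h s (by linarith) h2
  have h4 := norm_ge_one_add (σ := 1/4) (s := s) (by norm_num) (by linarith)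
  norm_num at h4
  have hp : 0 < 1 + |s.im| := by positivity
  have hs0 : 0 < ‖s‖ := by linarith
  rw [norm_div, norm_neg, div_le_iff₀ hs0]
  have h5 : (1 + |s.im|) ^ (-(3/4):ℝ) * (1 + |s.im|) = (1 + |s.im|) ^ (1/4:ℝ) := by
    nth_rw 2 [← Real.rpow_one (1 + |s.im|)]
    rw [← Real.rpow_add hp]; norm_num
  calc _ ≤ K * (1 + 1 / (s.re - β)) * Real.log (|s.im| + 2) := h3
    _ ≤ K * (1 + 1 / (σ' - β)) * (8 * (1 + |s.im|) ^ (1/4:ℝ)) := by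
        have := log_le_quarter s.im
        have h6 : 0 ≤ Real.log (|s.im| + 2) := Real.log_nonneg (by linarith [abs_nonneg s.im])
        gcongr
    _ = 5 * (K * (1 + 1 / (σ' - β)) * 8) * (1 + |s.im|) ^ (-(3/4):ℝ) * ((1 + |s.im|) / 5) := by
        rw [← h5]; ring
    _ ≤ _ := by gcongr; linarith

lemma pole_bound {δ : ℝ} (hδ : 0 < δ) {s ρ : ℂ} (h : δ ≤ s.re - ρ.re) :
    ‖s - ρ‖⁻¹ ≤ (1 + 1/δ) * (1 + |ρ.im|) * (1 + |s.im|) ^ (-(3/4):ℝ) := by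
  have h4 := norm_ge_one_add (σ := δ) (s := s - ρ) hδ (by simpa using h)
  have hp : 0 < 1 + |s.im| := by positivity
  have h5 : 1 + |s.im| ≤ (1 + |(s - ρ).im|) * (1 + |ρ.im|) := by
    have : |s.im| ≤ |(s - ρ).im| + |ρ.im| := by
      have := abs_add_le (s - ρ).im ρ.im
      simpa using this
    nlinarith [abs_nonneg (s - ρ).im, abs_nonneg ρ.im]
  have hs0 : 0 < ‖s - ρ‖ := by
    have : δ ≤ ‖s - ρ‖ := h.trans (by simpa using Complex.re_le_norm (s - ρ))
    linarith
  have h6 : (1 + |s.im|) ^ (-1:ℝ) ≤ (1 + |s.im|) ^ (-(3/4):ℝ) :=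
    Real.rpow_le_rpow_of_exponent_le (by linarith [abs_nonneg s.im]) (by norm_num)
  rw [Real.rpow_neg_one] at h6
  refine le_trans ?_ (mul_le_mul_of_nonneg_left h6 (by positivity))
  rw [inv_le_iff_one_le_mul₀ hs0]
  have h7 : 1 + |s.im| ≤ (1 + 1/δ) * ‖s - ρ‖ * (1 + |ρ.im|) := h5.trans (by gcongr)
  calc (1:ℝ) = (1 + |s.im|)⁻¹ * (1 + |s.im|) := by field_simp
    _ ≤ (1 + |s.im|)⁻¹ * ((1 + 1/δ) * ‖s - ρ‖ * (1 + |ρ.im|)) := by gcongr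
    _ = _ := by ring

lemma FS_bound {L : ℂ → ℂ} (hL : NiceL L) {β : ℝ} (hβ : 1/4 ≤ β)
    (hz : ∀ ρ, 0 < ρ.re → L ρ = 0 → ρ.re ≤ β) {S : Finset ℂ} (hS : ∀ ρ ∈ S, L ρ = 0 ∧ ρ.re = β) {σ' : ℝ} (hσ : β < σ') :
    ∃ D, ∀ s : ℂ, σ' ≤ s.re → s.re ≤ 2 → ‖FS L S s‖ ≤ D * (1 + |s.im|) ^ (-(3/4):ℝ) := by
  obtain ⟨D, hD, h⟩ := hL.logDeriv_div_bound hβ hz hσ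
  have hδ : 0 < σ' - β := by linarith
  refine ⟨D + ∑ ρ ∈ S, ‖((analyticOrderNatAt L ρ : ℂ) / ρ)‖ * ((1 + 1/(σ' - β)) * (1 + |ρ.im|)), fun s h1 h2 => ?_⟩
  rw [FS, add_mul, Finset.sum_mul]
  refine (norm_add_le _ _).trans (add_le_add (h s h1 h2) ((norm_sum_le _ _).trans (Finset.sum_le_sum fun ρ hρ => ?_)))
  rw [norm_div, div_eq_mul_inv, mul_assoc]
  gcongr
  exact pole_bound hδ (by rw [(hS ρ hρ).2]; linarith)

lemma FS_diff {L : ℂ → ℂ} (hL : NiceL L) {β : ℝ} (hβ : 1/4 ≤ β)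
    (hz : ∀ ρ, 0 < ρ.re → L ρ = 0 → ρ.re ≤ β) {S : Finset ℂ} (hS : ∀ ρ ∈ S, L ρ = 0 ∧ ρ.re = β) {s : ℂ} (hs : β < s.re) :
    DifferentiableAt ℂ (FS L S) s := by
  have h0 : s ≠ 0 := fun h => by rw [h] at hs; simp at hs; linarith
  have h1 := logDeriv_diffOn hL.diff (s := s) (by linarith) (fun h => by have := hz s (by linarith) h; linarith)
  unfold FS
  refine (h1.neg.div differentiableAt_id h0).add (DifferentiableAt.fun_sum fun ρ hρ => ?_)
  refine (differentiableAt_const _).div (differentiableAt_id.sub_const ρ) (fun h => ?_)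
  have := congrArg Complex.re h
  simp [(hS ρ hρ).2] at this; linarith

/-- explicit part -/
def gS (L : ℂ → ℂ) (S : Finset ℂ) (y : ℝ) : ℂ := ∑ ρ ∈ S, ((analyticOrderNatAt L ρ : ℂ) / ρ) * cexp (ρ * y)

lemma gS_laplace {L : ℂ → ℂ} {S : Finset ℂ} {s : ℂ} (hs : ∀ ρ ∈ S, ρ.re < s.re) :
    Integrable (fun y : ℝ => cexp (-s * y) * (Set.Ioi 0).indicator (gS L S) y) ∧
    ∫ y : ℝ, cexp (-s * y) * (Set.Ioi 0).indicator (gS L S) y = ∑ ρ ∈ S, ((analyticOrderNatAt L ρ : ℂ) / ρ) / (s - ρ) := by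
  have e : (fun y : ℝ => cexp (-s * y) * (Set.Ioi 0).indicator (gS L S) y) =
      (Set.Ioi 0).indicator (fun y : ℝ => ∑ ρ ∈ S, ((analyticOrderNatAt L ρ : ℂ) / ρ) * cexp ((ρ - s) * y)) := by
    ext y
    by_cases hy : y ∈ Set.Ioi (0:ℝ)
    · simp only [Set.indicator_of_mem hy, gS, Finset.mul_sum]
      refine Finset.sum_congr rfl fun ρ _ => ?_
      rw [mul_left_comm, ← Complex.exp_add]; congr 2; ring
    · simp [Set.indicator_of_notMem hy]
  have hi : ∀ ρ ∈ S, IntegrableOn (fun y : ℝ => ((analyticOrderNatAt L ρ : ℂ) / ρ) * cexp ((ρ - s) * y)) (Set.Ioi 0) := by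
    intro ρ hρ
    exact Integrable.const_mul (integrableOn_exp_mul_complex_Ioi (by simpa using hs ρ hρ) 0) _
  rw [e]
  constructor
  · rw [integrable_indicator_iff measurableSet_Ioi]
    exact integrable_finset_sum _ hi
  · rw [integral_indicator measurableSet_Ioi, integral_finset_sum _ hi]
    refine Finset.sum_congr rfl fun ρ hρ => ?_
    rw [integral_const_mul, integral_exp_mul_complex_Ioi (by simpa using hs ρ hρ)]
    have h1 : ρ - s ≠ 0 := fun h => by have h1 := hs ρ hρ; have := congrArg Complex.re h; simp at this; linarith
    have h2 : s - ρ ≠ 0 := fun h => h1 (by rw [← neg_sub, h, neg_zero])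
    have h3 : -cexp ((ρ - s) * (0:ℝ)) / (ρ - s) = 1 / (s - ρ) := by
      simp; rw [← neg_sub s ρ, neg_div_neg_eq, one_div]
    rw [h3]; ring

theorem NiceL.cesaro {L : ℂ → ℂ} (hL : NiceL L) {β : ℝ} (hβ : 1/4 ≤ β) (hβ1 : β ≤ 1)
    (hz : ∀ ρ, 0 < ρ.re → L ρ = 0 → ρ.re ≤ β) {f : ℝ → ℂ} (hfm : Measurable f) (hf0 : ∀ y < 0, f y = 0)
    {C : ℝ} (hfb : ∀ y, ‖f y‖ ≤ C * Real.exp (3/2 * y))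
    (hLap : ∀ s : ℂ, s.re = 2 → ∫ y : ℝ, cexp (-s * y) * f y = -logDeriv L s / s) {ε : ℝ} (hε : 0 < ε) :
    ∃ S : Finset ℂ, (∀ ρ ∈ S, L ρ = 0 ∧ ρ.re = β) ∧ ∀ᶠ Y : ℝ in atTop,
      ∫⁻ y in Set.Ioc 0 Y, ‖cexp (-β * y) * f y + ∑ ρ ∈ S, ((analyticOrderNatAt L ρ : ℂ) / ρ) * cexp (ρ.im * I * y)‖ₑ ^ 2
        ≤ ENNReal.ofReal (ε * Y) := by
  have hc : 0 < Real.exp (-2) * (ε / 2) := by positivity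
  obtain ⟨S, hS, C1, hC1⟩ := hL.mean_sq hβ hβ1 hz hc
  refine ⟨S, hS, ?_⟩
  filter_upwards [eventually_ge_atTop 1, eventually_ge_atTop (2 * C1 / (Real.exp (-2) * ε))] with Y hY1 hY2
  have hY0 : 0 < Y := by linarith
  set η := 1 / Y with hη
  have hη0 : 0 < η := by positivity
  have hη1 : η ≤ 1 := by rw [hη, div_le_one hY0]; exact hY1
  set fS : ℝ → ℂ := fun y => f y + (Set.Ioi 0).indicator (gS L S) y with hfS
  have hgm : Measurable (gS L S) := by
    unfold gS
    fun_prop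
  obtain ⟨D, hD⟩ := FS_bound hL hβ hz hS (σ' := β + η / 2) (by linarith)
  have hC0 : 0 ≤ C := by have := (norm_nonneg _).trans (hfb 0); simpa using this
  have key := laplace_plancherel (f := fS) (C := C + ∑ ρ ∈ S, ‖(analyticOrderNatAt L ρ : ℂ) / ρ‖) (σ' := β + η / 2) (σ := β + η) (F := FS L S) (D := D)
    (hfm.add (hgm.indicator measurableSet_Ioi))
    (fun y hy => by simp [hfS, hf0 y hy, hy.le])
    (fun y => by
      rw [add_mul]
      refine (norm_add_le _ _).trans (add_le_add (hfb y) ?_)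
      by_cases hy : y ∈ Set.Ioi (0:ℝ)
      · rw [Set.indicator_of_mem hy, gS, Finset.sum_mul]
        refine (norm_sum_le _ _).trans (Finset.sum_le_sum fun ρ hρ => ?_)
        rw [norm_mul]
        gcongr
        rw [Complex.norm_exp]
        have hy' : 0 < y := hy
        simp [(hS ρ hρ).2]
        nlinarith
      · rw [Set.indicator_of_notMem hy, norm_zero]
        positivity)
    (by linarith) (by linarith) (by linarith)
    (fun s hs => (FS_diff hL hβ hz hS (by have := hs.1; linarith)).differentiableWithinAt)
    (fun s hs => by
      obtain ⟨i1, i2⟩ := gS_laplace (L := L) (S := S) (s := s) (fun ρ hρ => by rw [hs, (hS ρ hρ).2]; linarith)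
      have i3 := integrable_laplace hfm hf0 hfb (s := s) (by rw [hs]; norm_num)
      simp only [hfS, mul_add]
      rw [integral_add i3 i1, i2, hLap s hs, FS])
    hD
  have k2 := hC1 η hη0 hη1
  have k3 := key.trans k2
  have hpt : ∀ y ∈ Set.Ioc 0 Y, ‖cexp (-β * y) * f y + ∑ ρ ∈ S, ((analyticOrderNatAt L ρ : ℂ) / ρ) * cexp (ρ.im * I * y)‖ₑ ^ 2 ≤
      ENNReal.ofReal (Real.exp 2) * ‖cexp (-(β + η : ℝ) * y) * fS y‖ₑ ^ 2 := by
    intro y hy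
    have e1 : cexp (-β * y) * f y + ∑ ρ ∈ S, ((analyticOrderNatAt L ρ : ℂ) / ρ) * cexp (ρ.im * I * y) =
        cexp (η * y) * (cexp (-(β + η : ℝ) * y) * fS y) := by
      rw [← mul_assoc, ← Complex.exp_add, hfS]
      simp only [Set.indicator_of_mem (show y ∈ Set.Ioi (0:ℝ) from hy.1), gS]
      rw [mul_add, Finset.mul_sum]
      have e3 : (η * y + -(β + η : ℝ) * y : ℂ) = -β * y := by push_cast; ring
      rw [e3]
      congr 1
      refine Finset.sum_congr rfl fun ρ hρ => ?_
      rw [mul_left_comm, ← Complex.exp_add]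
      congr 2
      have : ρ = β + ρ.im * I := by
        conv_lhs => rw [← Complex.re_add_im ρ, (hS ρ hρ).2]
      nth_rw 2 [this]
      ring
    rw [e1, enorm_sq_eq, enorm_sq_eq, ← ENNReal.ofReal_mul (Real.exp_pos _).le]
    apply ENNReal.ofReal_le_ofReal
    rw [norm_mul, mul_pow]
    gcongr
    rw [Complex.norm_exp, ← Real.exp_nat_mul]
    gcongr
    have : η * y ≤ 1 := by rw [hη, one_div, inv_mul_le_iff₀ hY0]; linarith [hy.2]
    simp
    linarith
  calc _ ≤ ∫⁻ y in Set.Ioc 0 Y, ENNReal.ofReal (Real.exp 2) * ‖cexp (-(β + η : ℝ) * y) * fS y‖ₑ ^ 2 :=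
        setLIntegral_mono' measurableSet_Ioc hpt
    _ = ENNReal.ofReal (Real.exp 2) * ∫⁻ y in Set.Ioc 0 Y, ‖cexp (-(β + η : ℝ) * y) * fS y‖ₑ ^ 2 := by
        rw [lintegral_const_mul' _ _ ENNReal.ofReal_ne_top]
    _ ≤ ENNReal.ofReal (Real.exp 2) * ENNReal.ofReal (C1 + Real.exp (-2) * (ε / 2) / η) := by
        gcongr
        exact (setLIntegral_le_lintegral _ _).trans k3
    _ ≤ _ := by
        rw [← ENNReal.ofReal_mul (Real.exp_pos _).le]
        apply ENNReal.ofReal_le_ofReal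
        rw [div_le_iff₀ (by positivity)] at hY2
        have e4 : Real.exp 2 * Real.exp (-2) = 1 := by rw [← Real.exp_add]; norm_num
        have e5 : C1 + Real.exp (-2) * (ε / 2) / η ≤ Real.exp (-2) * (ε * Y) := by
          rw [hη, div_div_eq_mul_div, div_one]; linarith
        calc _ ≤ Real.exp 2 * (Real.exp (-2) * (ε * Y)) := by gcongr
          _ = _ := by rw [← mul_assoc, e4, one_mul]

/-- The integral `∫_1^∞ B(t) t^{-s-1} dt`. -/
def HB (B : ℝ → ℂ) (s : ℂ) : ℂ := ∫ t in Set.Ioi (1:ℝ), B t * (t:ℂ) ^ (-(s+1))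

lemma HB_eq_mellin (B : ℝ → ℂ) (s : ℂ) : HB B s = mellin ((Set.Ioi (1:ℝ)).indicator B) (-s) := by
  rw [HB, mellin, ← integral_indicator measurableSet_Ioi, ← integral_indicator measurableSet_Ioi]
  congr 1
  ext t
  by_cases h : t ∈ Set.Ioi (1:ℝ)
  · have h' : t ∈ Set.Ioi (0:ℝ) := lt_trans zero_lt_one (Set.mem_Ioi.1 h)
    simp only [Set.indicator_of_mem h, Set.indicator_of_mem h', smul_eq_mul]
    rw [mul_comm]; congr 2; ring
  · by_cases h' : t ∈ Set.Ioi (0:ℝ)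
    · simp [Set.indicator_of_notMem h, Set.indicator_of_mem h']
    · simp [Set.indicator_of_notMem h, Set.indicator_of_notMem h']

lemma HB_diff {B : ℝ → ℂ} (hBm : Measurable B) {M : ℝ} (hB : ∀ t, 1 < t → ‖B t‖ ≤ M) :
    DifferentiableOn ℂ (HB B) {s | 0 < s.re} := by
  intro s hs
  have hs' : 0 < s.re := hs
  have hb : ∀ t, ‖(Set.Ioi (1:ℝ)).indicator B t‖ ≤ |M| := by
    intro t
    by_cases h : t ∈ Set.Ioi (1:ℝ)
    · rw [Set.indicator_of_mem h]; exact (hB t h).trans (le_abs_self _)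
    · rw [Set.indicator_of_notMem h, norm_zero]; positivity
  have hm : Measurable ((Set.Ioi (1:ℝ)).indicator B) := hBm.indicator measurableSet_Ioi
  have h1 : DifferentiableAt ℂ (mellin ((Set.Ioi (1:ℝ)).indicator B)) (-s) := by
    refine mellin_differentiableAt_of_isBigO_rpow (a := 0) (b := -s.re - 1) ?_ ?_ (by simpa using hs') ?_ (by simp)
    · have : LocallyIntegrable ((Set.Ioi (1:ℝ)).indicator B) := by
        refine (locallyIntegrable_const (|M|:ℝ)).mono hm.aestronglyMeasurable (Eventually.of_forall fun t => ?_)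
        simpa using hb t
      exact this.locallyIntegrableOn _
    · refine Asymptotics.IsBigO.of_bound |M| (Eventually.of_forall fun t => ?_)
      simpa using hb t
    · refine Asymptotics.IsBigO.of_bound 1 ?_
      filter_upwards [Ioo_mem_nhdsGT (zero_lt_one (α := ℝ))] with t ht
      rw [Set.indicator_of_notMem (by simpa using ht.2.le)]
      simp
  have h2 : HB B = mellin ((Set.Ioi (1:ℝ)).indicator B) ∘ (fun s => -s) := by
    ext s; exact HB_eq_mellin B s
  rw [h2]
  exact (h1.comp s differentiableAt_id.neg).differentiableWithinAt

lemma HB_norm_le {B : ℝ → ℂ} {M : ℝ} (hB : ∀ t, 1 < t → ‖B t‖ ≤ M) {s : ℂ} (hs : 0 < s.re) :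
    ‖HB B s‖ ≤ M / s.re := by
  unfold HB
  have h1 : IntegrableOn (fun t : ℝ => M * t ^ (-(s.re+1))) (Set.Ioi 1) :=
    (integrableOn_Ioi_rpow_of_lt (by linarith) zero_lt_one).const_mul M
  refine (norm_integral_le_of_norm_le h1 ?_).trans (le_of_eq ?_)
  · filter_upwards [ae_restrict_mem measurableSet_Ioi] with t ht
    have ht' : (1:ℝ) < t := ht
    rw [norm_mul, Complex.norm_cpow_eq_rpow_re_of_pos (by linarith)]
    simp only [neg_re, add_re, one_re]
    gcongr
    exact hB t ht
  · rw [integral_const_mul, integral_Ioi_rpow_of_lt (by linarith) zero_lt_one]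
    rw [Real.one_rpow]
    have : -(s.re + 1) + 1 = -s.re := by ring
    rw [this]; field_simp

lemma rePos_identity {f g : ℂ → ℂ} (hf : DifferentiableOn ℂ f {s | 0 < s.re}) (hg : DifferentiableOn ℂ g {s | 0 < s.re})
    (h : ∀ s : ℂ, 1 < s.re → f s = g s) : ∀ s : ℂ, 0 < s.re → f s = g s := by
  have hc : IsPreconnected {s : ℂ | 0 < s.re} := (convex_halfSpace_re_gt 0).isPreconnected
  have := (hf.analyticOnNhd isOpen_rePos).eqOn_of_preconnected_of_eventuallyEq (hg.analyticOnNhd isOpen_rePos) hc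
    (z₀ := 2) (by simp) (by
      have : {s : ℂ | 1 < s.re} ∈ 𝓝 (2:ℂ) := (isOpen_lt continuous_const Complex.continuous_re).mem_nhds (by simp)
      filter_upwards [this] with s hs using h s hs)
  exact fun s hs => this hs

/-! Non-principal characters -/

lemma char_partial_periodic {q : ℕ} [NeZero q] {χ : DirichletCharacter ℂ q} (hχ : χ ≠ 1) :
    Function.Periodic (fun n : ℕ => ∑ k ∈ Finset.range n, χ (k : ZMod q)) q := by
  intro n
  simp only [Finset.sum_range_add]
  have h1 : ∑ k ∈ Finset.range q, χ (((n + k : ℕ)) : ZMod q) = ∑ a : ZMod q, χ a := by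
    rw [← Equiv.sum_comp (Equiv.addLeft (n : ZMod q))]
    refine Finset.sum_bij' (fun k _ => (k : ZMod q)) (fun a _ => a.val) (fun _ _ => Finset.mem_univ _)
      (fun a _ => Finset.mem_range.2 (ZMod.val_lt a)) (fun k hk => ZMod.val_cast_of_lt (Finset.mem_range.1 hk))
      (fun a _ => by simp) (fun k _ => by simp)
  rw [h1, MulChar.sum_eq_zero_of_ne_one hχ, add_zero]

lemma char_partial_bound {q : ℕ} [NeZero q] {χ : DirichletCharacter ℂ q} (hχ : χ ≠ 1) (n : ℕ) :
    ‖∑ k ∈ Finset.Icc 1 n, χ (k : ZMod q)‖ ≤ q + 1 := by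
  have h1 : ∑ k ∈ Finset.range (n+1), χ (k : ZMod q) = χ ((0:ℕ) : ZMod q) + ∑ k ∈ Finset.Icc 1 n, χ (k : ZMod q) := by
    rw [Finset.range_eq_Ico, Finset.sum_eq_sum_Ico_succ_bot (by omega)]
    rfl
  have h2 : ‖∑ k ∈ Finset.range (n+1), χ (k : ZMod q)‖ ≤ q := by
    have := (char_partial_periodic hχ).map_mod_nat (n+1)
    rw [← this]
    refine (norm_sum_le _ _).trans ((Finset.sum_le_sum fun k _ => χ.norm_le_one _).trans ?_)
    simp
    exact (Nat.mod_lt _ (NeZero.pos q)).le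
  have h3 : ∑ k ∈ Finset.Icc 1 n, χ (k : ZMod q) = ∑ k ∈ Finset.range (n+1), χ (k : ZMod q) - χ ((0:ℕ) : ZMod q) := by
    rw [h1]; ring
  rw [h3]
  exact (norm_sub_le _ _).trans (add_le_add h2 (χ.norm_le_one _))

lemma LFunction_eq_HB {q : ℕ} [NeZero q] {χ : DirichletCharacter ℂ q} (hχ : χ ≠ 1) {s : ℂ} (hs : 0 < s.re) :
    χ.LFunction s = s * HB (fun t => ∑ k ∈ Finset.Icc 1 ⌊t⌋₊, χ (k : ZMod q)) s := by
  have hm : Measurable (fun t : ℝ => ∑ k ∈ Finset.Icc 1 ⌊t⌋₊, χ (k : ZMod q)) :=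
    (measurable_from_nat (f := fun n : ℕ => ∑ k ∈ Finset.Icc 1 n, χ (k : ZMod q))).comp Nat.measurable_floor
  refine rePos_identity (f := χ.LFunction) (g := fun s => s * HB (fun t => ∑ k ∈ Finset.Icc 1 ⌊t⌋₊, χ (k : ZMod q)) s)
    (χ.differentiable_LFunction hχ).differentiableOn ?_ ?_ s hs
  · exact differentiableOn_id.mul (HB_diff hm (fun t _ => char_partial_bound hχ _))
  · intro s hs
    rw [χ.LFunction_eq_LSeries hs, LSeries_eq_mul_integral _ le_rfl (by linarith) (χ.LSeriesSummable_of_one_lt_re hs)]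
    · rfl
    · refine Asymptotics.IsBigO.of_bound (q + 1) (Eventually.of_forall fun n => ?_)
      simpa using char_partial_bound hχ n

lemma char_low {q : ℕ} (χ : DirichletCharacter ℂ q) : ∃ c > 0, ∀ s : ℂ, s.re = 2 → c ≤ ‖LSeries (fun n => χ n) s‖ := by
  have hsum : Summable (fun n : ℕ => ((n:ℝ) ^ (2:ℕ))⁻¹) := Real.summable_nat_pow_inv.2 (by norm_num)
  set T := ∑' n : ℕ, ((n:ℝ) ^ (2:ℕ))⁻¹ with hT
  have hT0 : 0 ≤ T := tsum_nonneg fun n => by positivity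
  refine ⟨(T + 1)⁻¹, by positivity, fun s hs => ?_⟩
  have h1 := DirichletCharacter.LSeries.mul_mu_eq_one χ (s := s) (by rw [hs]; norm_num)
  have h2 : ‖LSeries ((fun n : ℕ => χ n) * (fun n : ℕ => ((ArithmeticFunction.moebius n : ℤ) : ℂ))) s‖ ≤ T := by
    refine tsum_of_norm_bounded hsum.hasSum fun n => ?_
    by_cases hn : n = 0
    · simp [hn]
    rw [LSeries.norm_term_eq, if_neg hn, hs]
    simp only [Pi.mul_apply, norm_mul]
    rw [Real.rpow_two, div_eq_mul_inv]
    refine mul_le_of_le_one_left (by positivity) ?_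
    refine mul_le_one₀ (χ.norm_le_one _) (norm_nonneg _) ?_
    rw [Complex.norm_intCast]
    exact_mod_cast ArithmeticFunction.abs_moebius_le_one
  have h3 := congrArg norm h1
  rw [norm_mul, norm_one] at h3
  rw [inv_le_iff_one_le_mul₀ (by positivity), ← h3]
  gcongr
  linarith

lemma norm_le_add (s : ℂ) (h1 : 0 ≤ s.re) (h : s.re ≤ 4) : ‖s‖ ≤ 4 * (|s.im| + 2) := by
  have := Complex.norm_le_abs_re_add_abs_im s
  rw [abs_of_nonneg h1] at this
  linarith [abs_nonneg s.im]

lemma le_pow_of_one_le {A u : ℝ} (hA : 1 ≤ A) (hu : 2 ≤ u) {k : ℕ} {c x : ℝ} (hc : c ≤ A) (hc0 : 0 ≤ c) (hk : (k:ℝ) ≤ A) (hx : x ≤ c * u ^ k) :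
    x ≤ A * u ^ A := by
  refine hx.trans ?_
  rw [← Real.rpow_natCast]
  gcongr
  linarith

lemma char_nice {q : ℕ} [NeZero q] {χ : DirichletCharacter ℂ q} (hχ : χ ≠ 1) : NiceL χ.LFunction where
  diff := (χ.differentiable_LFunction hχ).differentiableOn
  growth := by
    refine ⟨32 * (q + 1), by positivity, fun s h1 h2 => ?_⟩
    have hq : (0:ℝ) ≤ q := Nat.cast_nonneg _
    refine le_pow_of_one_le (k := 1) (c := 32 * (q + 1)) (by linarith) (by linarith [abs_nonneg s.im]) le_rfl (by positivity) (by push_cast; linarith) ?_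
    rw [LFunction_eq_HB hχ (by linarith), norm_mul]
    have h3 := HB_norm_le (B := fun t => ∑ k ∈ Finset.Icc 1 ⌊t⌋₊, χ (k : ZMod q)) (fun t _ => char_partial_bound hχ _) (s := s) (by linarith)
    have h4 := norm_le_add s (by linarith) h2
    calc _ ≤ 4 * (|s.im| + 2) * ((q + 1) / (1/8)) := by
          gcongr
          exact h3.trans (by gcongr)
      _ = _ := by ring
  low := by
    obtain ⟨c, hc, h⟩ := char_low χ
    exact ⟨c, hc, fun s hs => by
      rw [χ.LFunction_eq_LSeries (by rw [hs]; norm_num)]; exact h s hs⟩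

lemma NiceL.one : NiceL (fun _ => 1) where
  diff := differentiableOn_const _
  growth := ⟨1, one_pos, fun s _ _ => by simp; linarith [abs_nonneg s.im]⟩
  low := ⟨1, one_pos, fun s _ => by simp⟩

lemma NiceL.mul {f g : ℂ → ℂ} (hf : NiceL f) (hg : NiceL g) : NiceL (fun s => f s * g s) where
  diff := hf.diff.mul hg.diff
  growth := by
    obtain ⟨A, hA, h1⟩ := hf.growth
    obtain ⟨B, hB, h2⟩ := hg.growth
    refine ⟨A + B + A * B, by positivity, fun s h3 h4 => ?_⟩
    have hu : 1 ≤ |s.im| + 2 := by linarith [abs_nonneg s.im]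
    have hu0 : 0 < |s.im| + 2 := by linarith
    rw [norm_mul]
    calc _ ≤ (A * (|s.im| + 2) ^ A) * (B * (|s.im| + 2) ^ B) := by
          gcongr
          · exact h1 s h3 h4
          · exact h2 s h3 h4
      _ = A * B * (|s.im| + 2) ^ (A + B) := by rw [Real.rpow_add hu0]; ring
      _ ≤ _ := by
          have : 0 ≤ A * B := by positivity
          have e1 := Real.rpow_le_rpow_of_exponent_le hu (show A + B ≤ A + B + A * B by linarith)
          exact mul_le_mul (by linarith) e1 (by positivity) (by positivity)
  low := by
    obtain ⟨A, hA, h1⟩ := hf.low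
    obtain ⟨B, hB, h2⟩ := hg.low
    refine ⟨A * B, by positivity, fun s h3 => ?_⟩
    rw [norm_mul]
    have := h1 s h3
    have := h2 s h3
    gcongr

lemma NiceL.prod {ι : Type*} {f : ι → ℂ → ℂ} (X : Finset ι) (hf : ∀ i ∈ X, NiceL (f i)) : NiceL (fun s => ∏ i ∈ X, f i s) := by
  induction X using Finset.induction_on with
  | empty => simpa using NiceL.one
  | insert a X ha ih =>
    simp only [Finset.prod_insert ha]
    exact (hf a (Finset.mem_insert_self _ _)).mul (ih fun i hi => hf i (Finset.mem_insert_of_mem hi))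

lemma exp_tail {s : ℂ} (hs : 0 < s.re) (c : ℝ) :
    IntegrableOn (fun y : ℝ => cexp (-s * y)) (Set.Ici c) ∧ ∫ y in Set.Ici c, cexp (-s * y) = cexp (-s * c) / s ∧
    ∫ y in Set.Ici c, ‖cexp (-s * y)‖ = ‖cexp (-s * c)‖ / s.re := by
  have h0 : s ≠ 0 := fun h => by rw [h] at hs; simp at hs
  refine ⟨?_, ?_, ?_⟩
  · rw [integrableOn_Ici_iff_integrableOn_Ioi]
    exact integrableOn_exp_mul_complex_Ioi (by simpa using hs) c
  · rw [integral_Ici_eq_integral_Ioi, integral_exp_mul_complex_Ioi (by simpa using hs), neg_div_neg_eq]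
  · rw [integral_Ici_eq_integral_Ioi]
    have e : ∀ y : ℝ, ‖cexp (-s * y)‖ = Real.exp (-s.re * y) := fun y => by rw [Complex.norm_exp]; simp
    simp only [e]
    rw [integral_exp_mul_Ioi (by linarith), neg_div_neg_eq]

lemma mem_floor_iff {k : ℕ} (hk : k ≠ 0) (y : ℝ) : k ∈ Finset.Icc 1 ⌊Real.exp y⌋₊ ↔ y ∈ Set.Ici (Real.log k) := by
  have hk' : 0 < (k:ℝ) := by positivity
  rw [Finset.mem_Icc, Set.mem_Ici, Nat.le_floor_iff (Real.exp_pos _).le, Real.log_le_iff_le_exp hk']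
  exact ⟨fun h => h.2, fun h => ⟨Nat.one_le_iff_ne_zero.2 hk, h⟩⟩

lemma psum_laplace {a : ℕ → ℂ} {s : ℂ} (hs : 0 < s.re) (hsum : LSeriesSummable a s) :
    ∫ y : ℝ, cexp (-s * y) * ∑ k ∈ Finset.Icc 1 ⌊Real.exp y⌋₊, a k = LSeries a s / s := by
  set F : ℕ → ℝ → ℂ := fun k => if k = 0 then 0 else fun y => a k * (Set.Ici (Real.log k)).indicator (fun y : ℝ => cexp (-s * y)) y with hF
  have hpow : ∀ k : ℕ, k ≠ 0 → cexp (-s * (Real.log k : ℝ)) = ((k:ℂ) ^ s)⁻¹ := by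
    intro k hk
    rw [← Complex.cpow_neg, Complex.cpow_def_of_ne_zero (by exact_mod_cast hk), Complex.ofReal_log (Nat.cast_nonneg _)]
    congr 1
    push_cast; ring
  have hIntg : ∀ k, Integrable (F k) := by
    intro k
    by_cases hk : k = 0
    · simp only [hF, hk, if_true]; exact integrable_zero _ _ _
    · simp only [hF, hk, if_false]
      exact ((integrable_indicator_iff measurableSet_Ici).2 (exp_tail hs _).1).const_mul _
  have hval : ∀ k, ∫ y, F k y = LSeries.term a s k / s := by
    intro k
    by_cases hk : k = 0
    · simp [hF, hk]
    · simp only [hF, hk, if_false]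
      rw [integral_const_mul, integral_indicator measurableSet_Ici, (exp_tail hs _).2.1, hpow k hk, LSeries.term_of_ne_zero hk]
      ring
  have hnorm : ∀ k, ∫ y, ‖F k y‖ = ‖LSeries.term a s k‖ / s.re := by
    intro k
    by_cases hk : k = 0
    · simp [hF, hk]
    · simp only [hF, hk, if_false, norm_mul, norm_indicator_eq_indicator_norm]
      rw [integral_const_mul, integral_indicator measurableSet_Ici, (exp_tail hs _).2.2, hpow k hk, LSeries.term_of_ne_zero hk]
      rw [norm_inv, norm_div]
      ring
  have h1 := hasSum_integral_of_summable_integral_norm hIntg (by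
    simp only [hnorm]
    exact (Summable.norm hsum).div_const _)
  have h2 : ∀ y : ℝ, ∑' k, F k y = cexp (-s * y) * ∑ k ∈ Finset.Icc 1 ⌊Real.exp y⌋₊, a k := by
    intro y
    rw [tsum_eq_sum (s := Finset.Icc 1 ⌊Real.exp y⌋₊), Finset.mul_sum]
    · refine Finset.sum_congr rfl fun k hk => ?_
      have hk0 : k ≠ 0 := by rw [Finset.mem_Icc] at hk; omega
      simp only [hF, hk0, if_false, Set.indicator_of_mem ((mem_floor_iff hk0 y).1 hk)]
      ring
    · intro k hk
      by_cases hk0 : k = 0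
      · simp [hF, hk0]
      · simp only [hF, hk0, if_false]
        rw [Set.indicator_of_notMem (fun h => hk ((mem_floor_iff hk0 y).2 h)), mul_zero]
  simp only [hval, h2] at h1
  rw [← h1.tsum_eq, tsum_div_const]
  rfl

/-- `ψ(x, χ)` at `x = e^y`. -/
def psiChi {q : ℕ} (χ : DirichletCharacter ℂ q) (y : ℝ) : ℂ :=
  ∑ k ∈ Finset.Icc 1 ⌊Real.exp y⌋₊, χ (k : ZMod q) * (ArithmeticFunction.vonMangoldt k : ℂ)

lemma psum_measurable (a : ℕ → ℂ) : Measurable (fun y : ℝ => ∑ k ∈ Finset.Icc 1 ⌊Real.exp y⌋₊, a k) :=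
  (measurable_from_nat (f := fun n : ℕ => ∑ k ∈ Finset.Icc 1 n, a k)).comp (Nat.measurable_floor.comp Real.measurable_exp)

lemma psum_neg (a : ℕ → ℂ) {y : ℝ} (hy : y < 0) : ∑ k ∈ Finset.Icc 1 ⌊Real.exp y⌋₊, a k = 0 := by
  have : ⌊Real.exp y⌋₊ = 0 := Nat.floor_eq_zero.2 (by rwa [Real.exp_lt_one_iff])
  rw [this]; simp

lemma psi_eq_Icc_one (x : ℝ) : Chebyshev.psi x = ∑ k ∈ Finset.Icc 1 ⌊x⌋₊, ArithmeticFunction.vonMangoldt k := rfl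

lemma psi_exp_le : ∃ C, 0 ≤ C ∧ ∀ y : ℝ, Chebyshev.psi (Real.exp y) ≤ C * Real.exp y :=
  ⟨_, by positivity, fun y => Chebyshev.psi_le_const_mul_self (Real.exp_pos y).le⟩

lemma psiChi_laplace {q : ℕ} [NeZero q] (χ : DirichletCharacter ℂ q) {s : ℂ} (hs : 1 < s.re) :
    ∫ y : ℝ, cexp (-s * y) * psiChi χ y = -logDeriv χ.LFunction s / s := by
  have h1 := psum_laplace (s := s) (by linarith) (DirichletCharacter.LSeriesSummable_twist_vonMangoldt χ hs)
  unfold psiChi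
  simp only [Pi.mul_apply] at h1
  rw [h1, DirichletCharacter.LSeries_twist_vonMangoldt_eq χ hs, logDeriv_apply, χ.LFunction_eq_LSeries hs, χ.deriv_LFunction_eq_deriv_LSeries hs]
  ring

lemma psiChi_norm_le {q : ℕ} (χ : DirichletCharacter ℂ q) (y : ℝ) : ‖psiChi χ y‖ ≤ Chebyshev.psi (Real.exp y) := by
  unfold psiChi
  rw [psi_eq_Icc_one]
  refine (norm_sum_le _ _).trans (Finset.sum_le_sum fun k _ => ?_)
  rw [norm_mul, Complex.norm_real, Real.norm_of_nonneg ArithmeticFunction.vonMangoldt_nonneg]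
  exact mul_le_of_le_one_left ArithmeticFunction.vonMangoldt_nonneg (χ.norm_le_one _)

/-! The finite set of nonprincipal real characters -/

def XX (q : ℕ) [NeZero q] : Finset (DirichletCharacter ℂ q) :=
  (Set.toFinite {χ : DirichletCharacter ℂ q | χ ≠ 1 ∧ χ ^ 2 = 1}).toFinset

lemma mem_XX {q : ℕ} [NeZero q] (χ : DirichletCharacter ℂ q) : χ ∈ XX q ↔ χ ≠ 1 ∧ χ ^ 2 = 1 := by
  simp [XX]

def LX (q : ℕ) [NeZero q] (s : ℂ) : ℂ := ∏ χ ∈ XX q, DirichletCharacter.LFunction χ s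

lemma LX_nice (q : ℕ) [NeZero q] : NiceL (LX q) :=
  NiceL.prod (XX q) fun χ hχ => char_nice ((mem_XX χ).1 hχ).1

lemma LX_eq_zero {q : ℕ} [NeZero q] {s : ℂ} : LX q s = 0 ↔ ∃ χ ∈ XX q, DirichletCharacter.LFunction χ s = 0 := by
  rw [LX, Finset.prod_eq_zero_iff]

def fX (q : ℕ) [NeZero q] (y : ℝ) : ℂ := ∑ χ ∈ XX q, psiChi χ y

lemma fX_measurable (q : ℕ) [NeZero q] : Measurable (fX q) :=
  Finset.measurable_fun_sum _ fun _ _ => psum_measurable _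

lemma fX_neg (q : ℕ) [NeZero q] : ∀ y < 0, fX q y = 0 := fun y hy =>
  Finset.sum_eq_zero fun χ _ => psum_neg _ hy

lemma exp_le_threehalf {C x : ℝ} (hC : 0 ≤ C) {y : ℝ} (h : 0 ≤ y → x ≤ C * Real.exp y) (h0 : y < 0 → x ≤ 0) : x ≤ C * Real.exp (3/2 * y) := by
  by_cases hy : 0 ≤ y
  · refine (h hy).trans ?_
    gcongr; linarith
  · exact (h0 (not_le.1 hy)).trans (by positivity)

lemma fX_bound1 (q : ℕ) [NeZero q] : ∃ C, 0 ≤ C ∧ ∀ y, ‖fX q y‖ ≤ C * Real.exp y := by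
  obtain ⟨C, hC, h⟩ := psi_exp_le
  refine ⟨(XX q).card * C, by positivity, fun y => ?_⟩
  refine (norm_sum_le _ _).trans ((Finset.sum_le_sum fun χ _ => (psiChi_norm_le χ y).trans (h y)).trans ?_)
  simp [mul_assoc]

lemma fX_bound (q : ℕ) [NeZero q] : ∃ C, 0 ≤ C ∧ ∀ y, ‖fX q y‖ ≤ C * Real.exp (3/2 * y) := by
  obtain ⟨C, hC, h⟩ := fX_bound1 q
  exact ⟨C, hC, fun y => exp_le_threehalf hC (fun _ => h y) (fun hy => by rw [fX_neg q y hy, norm_zero])⟩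

lemma psiChi_integrable {q : ℕ} [NeZero q] (χ : DirichletCharacter ℂ q) {s : ℂ} (hs : s.re = 2) :
    Integrable (fun y : ℝ => cexp (-s * y) * psiChi χ y) := by
  obtain ⟨C, hC, h⟩ := psi_exp_le
  refine integrable_laplace (C := C) (psum_measurable _) (fun y hy => psum_neg _ hy) (fun y => ?_) (by rw [hs]; norm_num)
  refine exp_le_threehalf hC (fun _ => (psiChi_norm_le χ y).trans (h y)) (fun hy => ?_)
  have : psiChi χ y = 0 := psum_neg _ hy
  exact (congrArg norm this).trans norm_zero |>.le

lemma fX_laplace (q : ℕ) [NeZero q] : ∀ s : ℂ, s.re = 2 → ∫ y : ℝ, cexp (-s * y) * fX q y = -logDeriv (LX q) s / s := by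
  intro s hs
  have h1 : (1:ℝ) < s.re := by rw [hs]; norm_num
  have e : LX q = fun s => ∏ χ ∈ XX q, DirichletCharacter.LFunction χ s := rfl
  rw [e, logDeriv_prod]
  · simp only [fX, Finset.mul_sum]
    rw [integral_finset_sum _ (fun χ _ => psiChi_integrable χ hs)]
    simp only [psiChi_laplace _ h1, neg_div, Finset.sum_neg_distrib]
    rw [Finset.sum_div]
  · intro χ hχ
    rw [χ.LFunction_eq_LSeries h1]
    exact χ.LSeries_ne_zero_of_one_lt_re h1
  · intro χ hχ
    exact (χ.differentiable_LFunction ((mem_XX χ).1 hχ).1) s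

def BZ (t : ℝ) : ℂ := ((⌊t⌋₊ : ℝ) - t : ℝ)

lemma BZ_measurable : Measurable BZ := by
  unfold BZ
  have : Measurable (fun t : ℝ => (⌊t⌋₊ : ℝ)) := (measurable_from_nat (f := fun n : ℕ => (n:ℝ))).comp Nat.measurable_floor
  fun_prop

lemma BZ_norm (t : ℝ) (ht : 1 < t) : ‖BZ t‖ ≤ 1 := by
  unfold BZ
  rw [Complex.norm_real, Real.norm_eq_abs, abs_le]
  have h1 := Nat.floor_le (show 0 ≤ t by linarith)
  have h2 := Nat.lt_floor_add_one t
  constructor <;> linarith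

/-- `(s-1) ζ(s)` continued to `Re s > 0`. -/
def GZ (s : ℂ) : ℂ := s + (s - 1) * s * HB BZ s

lemma GZ_diff : DifferentiableOn ℂ GZ {s | 0 < s.re} := by
  have := HB_diff BZ_measurable BZ_norm
  unfold GZ
  fun_prop

lemma GZ_eq_gt {s : ℂ} (hs : 1 < s.re) : GZ s = (s - 1) * riemannZeta s := by
  have hs1 : s - 1 ≠ 0 := fun h => by have := congrArg Complex.re h; simp at this; linarith
  have hi1 : IntegrableOn (fun t : ℝ => (t:ℂ) ^ (-s)) (Set.Ioi 1) := integrableOn_Ioi_cpow_of_lt (by simpa using hs) one_pos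
  have hv1 : ∫ t : ℝ in Set.Ioi 1, (t:ℂ) ^ (-s) = 1 / (s - 1) := by
    rw [integral_Ioi_cpow_of_lt (by simpa using hs) one_pos]
    simp
    rw [show -s + 1 = -(s - 1) by ring, neg_div_neg_eq, one_div]
  have hi2 : IntegrableOn (fun t : ℝ => BZ t * (t:ℂ) ^ (-(s+1))) (Set.Ioi 1) := by
    have h1 : IntegrableOn (fun t : ℝ => (t:ℝ) ^ (-(s.re+1))) (Set.Ioi 1) := integrableOn_Ioi_rpow_of_lt (by linarith) one_pos
    refine Integrable.mono' h1 ?_ ?_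
    · refine (BZ_measurable.aestronglyMeasurable.mul ?_)
      refine Measurable.aestronglyMeasurable ?_
      fun_prop
    · filter_upwards [ae_restrict_mem measurableSet_Ioi] with t ht
      have ht' : (1:ℝ) < t := ht
      rw [norm_mul, Complex.norm_cpow_eq_rpow_re_of_pos (by linarith)]
      simp only [neg_re, add_re, one_re]
      exact mul_le_of_le_one_left (by positivity) (BZ_norm t ht)
  have h1 : LSeries 1 s = s * ∫ t in Set.Ioi (1 : ℝ), (∑ k ∈ Finset.Icc 1 ⌊t⌋₊, (1 : ℕ → ℂ) k) * t ^ (-(s + 1)) := by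
    refine LSeries_eq_mul_integral _ zero_le_one hs (LSeriesSummable_one_iff.2 hs) ?_
    refine Asymptotics.IsBigO.of_bound 1 (Eventually.of_forall fun n => ?_)
    simp
  rw [← LSeries_one_eq_riemannZeta hs, h1]
  have h2 : ∫ t in Set.Ioi (1 : ℝ), (∑ k ∈ Finset.Icc 1 ⌊t⌋₊, (1 : ℕ → ℂ) k) * (t:ℂ) ^ (-(s + 1)) = HB BZ s + 1 / (s - 1) := by
    rw [HB, ← hv1, ← integral_add hi2 hi1]
    refine setIntegral_congr_fun measurableSet_Ioi fun t ht => ?_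
    have ht' : (1:ℝ) < t := ht
    have ht0 : (t:ℂ) ≠ 0 := by exact_mod_cast (show t ≠ 0 by linarith)
    have e : (t:ℂ) ^ (-s) = t * (t:ℂ) ^ (-(s+1)) := by
      nth_rw 2 [← Complex.cpow_one (t:ℂ)]
      rw [← Complex.cpow_add _ _ ht0]; congr 1; ring
    simp only [e, BZ]
    simp; ring
  rw [h2, GZ]
  field_simp
  ring

lemma GZ_eq {s : ℂ} (hs : 0 < s.re) (hs1 : s ≠ 1) : GZ s = (s - 1) * riemannZeta s := by
  have key : ∀ s : ℂ, s ≠ 1 → DirichletCharacter.LFunctionTrivChar₁ 1 s = (s - 1) * riemannZeta s := by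
    intro s hs
    rw [DirichletCharacter.LFunctionTrivChar₁, Function.update_of_ne hs, DirichletCharacter.LFunctionTrivChar, DirichletCharacter.LFunction_modOne_eq]
  rw [← key s hs1]
  refine rePos_identity GZ_diff (DirichletCharacter.differentiable_LFunctionTrivChar₁ 1).differentiableOn (fun s hs => ?_) s hs
  rw [GZ_eq_gt hs, key s (fun h => by rw [h] at hs; simp at hs)]

lemma GZ_ne {s : ℂ} (hs : 1 ≤ s.re) : GZ s ≠ 0 := by
  by_cases h : s = 1
  · rw [h]; simp [GZ]
  · rw [GZ_eq (by linarith) h]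
    exact mul_ne_zero (sub_ne_zero.2 h) (riemannZeta_ne_zero_of_one_le_re hs)

lemma GZ_nice : NiceL GZ where
  diff := GZ_diff
  growth := by
    refine ⟨200, by norm_num, fun s h1 h2 => ?_⟩
    refine le_pow_of_one_le (k := 2) (c := 200) (by norm_num) (by linarith [abs_nonneg s.im]) le_rfl (by norm_num) (by norm_num) ?_
    have h3 := HB_norm_le BZ_norm (s := s) (by linarith)
    have h4 := norm_le_add s (by linarith) h2
    have h3' : ‖HB BZ s‖ ≤ 8 := h3.trans (by rw [div_le_iff₀ (by linarith)]; linarith)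
    set u := |s.im| + 2 with hu
    have hu2 : 2 ≤ u := by linarith [abs_nonneg s.im]
    have h5 : ‖s - 1‖ ≤ 5 * u := (norm_sub_le _ _).trans (by rw [norm_one]; linarith)
    rw [GZ]
    refine (norm_add_le _ _).trans ?_
    rw [norm_mul, norm_mul]
    calc _ ≤ 4 * u + (5 * u) * (4 * u) * 8 := by gcongr
      _ ≤ _ := by nlinarith
  low := by
    obtain ⟨c, hc, h⟩ := char_low (1 : DirichletCharacter ℂ 1)
    refine ⟨c, hc, fun s hs => ?_⟩
    have h1 : (1:ℝ) < s.re := by rw [hs]; norm_num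
    have h2 := h s hs
    rw [DirichletCharacter.LSeries_modOne_eq, LSeries_one_eq_riemannZeta h1] at h2
    rw [GZ_eq_gt h1, norm_mul]
    have h3 : 1 ≤ ‖s - 1‖ := by
      refine le_trans ?_ (Complex.re_le_norm _)
      simp [hs]; norm_num
    nlinarith [norm_nonneg (riemannZeta s)]

def fZ (y : ℝ) : ℂ := (∑ k ∈ Finset.Icc 1 ⌊Real.exp y⌋₊, (ArithmeticFunction.vonMangoldt k : ℂ)) -
  (Set.Ici 0).indicator (fun y : ℝ => cexp y - 1) y

lemma fZ_laplace (s : ℂ) (hs : s.re = 2) : ∫ y : ℝ, cexp (-s * y) * fZ y = -logDeriv GZ s / s := by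
  have h1 : (1:ℝ) < s.re := by rw [hs]; norm_num
  have hs0 : s ≠ 0 := fun h => by rw [h] at hs; simp at hs
  have hs1 : s - 1 ≠ 0 := fun h => by have := congrArg Complex.re h; simp at this; linarith
  have hz : riemannZeta s ≠ 0 := riemannZeta_ne_zero_of_one_lt_re h1
  have hd : DifferentiableAt ℂ riemannZeta s := differentiableAt_riemannZeta (sub_ne_zero.1 hs1)
  have e1 : logDeriv GZ s = 1 / (s - 1) + logDeriv riemannZeta s := by
    have : GZ =ᶠ[𝓝 s] fun s => (s - 1) * riemannZeta s := by
      filter_upwards [(isOpen_lt continuous_const Complex.continuous_re).mem_nhds h1] with z hz using GZ_eq_gt hz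
    rw [logDeriv_apply, this.deriv_eq, this.eq_of_nhds, ← logDeriv_apply, logDeriv_mul (f := fun z => z - 1) (g := riemannZeta) s hs1 hz (by fun_prop) hd]
    congr 1
    rw [logDeriv_apply]; simp
  obtain ⟨C, hC, hpsi⟩ := psi_exp_le
  have i1 : Integrable (fun y : ℝ => cexp (-s * y) * ∑ k ∈ Finset.Icc 1 ⌊Real.exp y⌋₊, (ArithmeticFunction.vonMangoldt k : ℂ)) := by
    refine integrable_laplace (C := C) (psum_measurable _) (fun y hy => psum_neg _ hy) (fun y => ?_) (by rw [hs]; norm_num)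
    refine exp_le_threehalf hC (fun _ => ?_) (fun hy => ?_)
    · rw [← Complex.ofReal_sum, ← psi_eq_Icc_one, Complex.norm_real, Real.norm_of_nonneg (Chebyshev.psi_nonneg _)]
      exact hpsi y
    · rw [psum_neg _ hy, norm_zero]
  obtain ⟨i2, v2, -⟩ := exp_tail (s := s - 1) (by simp [hs]) 0
  obtain ⟨i3, v3, -⟩ := exp_tail (s := s) (by linarith) 0
  have e2 : (fun y : ℝ => cexp (-s * y) * (Set.Ici 0).indicator (fun y : ℝ => cexp y - 1) y) =
      (Set.Ici 0).indicator (fun y : ℝ => cexp (-(s-1) * y) - cexp (-s * y)) := by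
    ext y
    by_cases hy : y ∈ Set.Ici (0:ℝ)
    · simp only [Set.indicator_of_mem hy, mul_sub, mul_one, ← Complex.exp_add]
      congr 2; ring
    · simp [Set.indicator_of_notMem hy]
  have i4 : Integrable (fun y : ℝ => cexp (-s * y) * (Set.Ici 0).indicator (fun y : ℝ => cexp y - 1) y) := by
    rw [e2, integrable_indicator_iff measurableSet_Ici]; exact i2.sub i3
  have v4 : ∫ y : ℝ, cexp (-s * y) * (Set.Ici 0).indicator (fun y : ℝ => cexp y - 1) y = 1 / (s - 1) - 1 / s := by
    rw [e2, integral_indicator measurableSet_Ici, integral_sub i2 i3, v2, v3]; simp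
  simp only [fZ, mul_sub]
  rw [integral_sub i1 i4, v4, psum_laplace (by linarith) (ArithmeticFunction.LSeriesSummable_vonMangoldt h1),
    ArithmeticFunction.LSeries_vonMangoldt_eq_deriv_riemannZeta_div h1, e1, logDeriv_apply]
  field_simp
  ring

theorem fZ_cesaro {ε : ℝ} (hε : 0 < ε) : ∀ᶠ Y : ℝ in atTop,
    ∫⁻ y in Set.Ioc 0 Y, ‖cexp (-y) * fZ y‖ₑ ^ 2 ≤ ENNReal.ofReal (ε * Y) := by
  obtain ⟨C, hC, hpsi⟩ := psi_exp_le
  obtain ⟨S, hS, h⟩ := GZ_nice.cesaro (β := 1) (by norm_num) le_rfl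
    (fun ρ h1 h2 => by
      by_contra h3
      exact GZ_ne (not_le.1 h3).le h2) (f := fZ) ((psum_measurable _).sub (Measurable.indicator (by fun_prop) measurableSet_Ici))
    (fun y hy => by rw [fZ, psum_neg _ hy, Set.indicator_of_notMem (by simpa using hy)]; simp)
    (C := C + 1) (fun y => by
      refine exp_le_threehalf (by linarith) (fun hy => ?_) (fun hy => ?_)
      · rw [fZ, Set.indicator_of_mem (show y ∈ Set.Ici (0:ℝ) from hy), ← Complex.ofReal_sum, ← psi_eq_Icc_one, add_mul]
        refine (norm_sub_le _ _).trans (add_le_add ?_ ?_)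
        · rw [Complex.norm_real, Real.norm_of_nonneg (Chebyshev.psi_nonneg _)]
          exact hpsi y
        · rw [show cexp y - 1 = ((Real.exp y - 1 : ℝ) : ℂ) by push_cast; rfl, Complex.norm_real, Real.norm_of_nonneg]
          · linarith
          · linarith [Real.add_one_le_exp y]
      · rw [fZ, psum_neg _ hy, Set.indicator_of_notMem (by simpa using hy)]; simp)
    fZ_laplace hε
  have hSe : S = ∅ := by
    rw [Finset.eq_empty_iff_forall_notMem]
    intro ρ hρ
    exact GZ_ne (hS ρ hρ).2.ge (hS ρ hρ).1
  filter_upwards [h] with Y hY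
  rw [hSe] at hY
  simpa using hY

def aR (q : ℕ) (z : ZMod q) : ℝ :=
  if IsUnit z then (if ∃ y : ZMod q, y * y = z then (rhoQ q : ℝ) - 1 else -1) else 0

lemma exists_hom_ne_one {G : Type*} [CommGroup G] [Finite G] {a : G} (ha : a ≠ 1) : ∃ φ : G →* ℂˣ, φ a ≠ 1 := by
  haveI : NeZero ((Monoid.exponent G : ℕ) : ℂ) := ⟨Nat.cast_ne_zero.2 Monoid.exponent_ne_zero_of_finite⟩
  exact CommGroup.exists_apply_ne_one_of_hasEnoughRootsOfUnity G ℂ ha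

lemma exists_char_nonsq {q : ℕ} [NeZero q] (u : (ZMod q)ˣ) (hu : u ∉ (powMonoidHom 2 : (ZMod q)ˣ →* (ZMod q)ˣ).range) :
    ∃ χ : DirichletCharacter ℂ q, χ ^ 2 = 1 ∧ χ (u : ZMod q) ≠ 1 := by
  set H := (powMonoidHom 2 : (ZMod q)ˣ →* (ZMod q)ˣ).range with hH
  have h1 : (QuotientGroup.mk' H u) ≠ 1 := by
    rwa [Ne, QuotientGroup.mk'_apply, QuotientGroup.eq_one_iff]
  obtain ⟨φ, hφ⟩ := exists_hom_ne_one h1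
  refine ⟨MulChar.ofUnitHom (φ.comp (QuotientGroup.mk' H)), ?_, ?_⟩
  · ext v
    rw [MulChar.pow_apply_coe, MulChar.ofUnitHom_coe, MulChar.one_apply_coe, ← Units.val_pow_eq_pow_val, ← map_pow]
    have : (QuotientGroup.mk' H) (v ^ 2) = 1 := by
      rw [QuotientGroup.mk'_apply, QuotientGroup.eq_one_iff]
      exact ⟨v, rfl⟩
    rw [MonoidHom.comp_apply, this, map_one, Units.val_one]
  · rw [MulChar.ofUnitHom_coe]
    intro h
    exact hφ (Units.ext h)

lemma sq_iff {q : ℕ} [NeZero q] (u : (ZMod q)ˣ) : (∃ y : ZMod q, y * y = u) ↔ u ∈ (powMonoidHom 2 : (ZMod q)ˣ →* (ZMod q)ˣ).range := by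
  constructor
  · rintro ⟨y, hy⟩
    have : IsUnit y := isUnit_of_mul_isUnit_left (y := y) (by rw [hy]; exact u.isUnit)
    refine ⟨this.unit, Units.ext ?_⟩
    simp [sq, hy]
  · rintro ⟨v, rfl⟩
    exact ⟨v, by simp [sq]⟩

lemma sum_insert_XX {q : ℕ} [NeZero q] (u : (ZMod q)ˣ) : ∑ χ ∈ insert 1 (XX q), χ (u : ZMod q) =
    if u ∈ (powMonoidHom 2 : (ZMod q)ˣ →* (ZMod q)ˣ).range then ((insert 1 (XX q)).card : ℂ) else 0 := by
  have hm : ∀ χ : DirichletCharacter ℂ q, χ ∈ insert 1 (XX q) ↔ χ ^ 2 = 1 := by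
    intro χ
    rw [Finset.mem_insert, mem_XX]
    by_cases h : χ = 1 <;> simp [h]
  split_ifs with h
  · obtain ⟨v, rfl⟩ := h
    rw [Finset.sum_congr rfl (g := fun _ => (1:ℂ))]
    · simp
    · intro χ hχ
      rw [hm] at hχ
      have := congrArg (fun ψ : DirichletCharacter ℂ q => ψ (v : ZMod q)) hχ
      simp only [MulChar.pow_apply_coe, MulChar.one_apply_coe] at this
      simp [this]
  · obtain ⟨χ, h1, h2⟩ := exists_char_nonsq u h
    refine eq_zero_of_mul_eq_self_left h2 ?_
    simp only [Finset.mul_sum, ← MulChar.mul_apply]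
    refine Finset.sum_bij (fun ψ _ => χ * ψ) (fun ψ hψ => ?_) (fun _ _ _ _ h => mul_left_cancel h) (fun ψ hψ => ?_) (fun _ _ => rfl)
    · rw [hm] at hψ ⊢; rw [mul_pow, h1, hψ, one_mul]
    · refine ⟨χ * ψ, ?_, ?_⟩
      · rw [hm] at hψ ⊢; rw [mul_pow, h1, hψ, one_mul]
      · rw [← mul_assoc, ← sq, h1, one_mul]

lemma card_insert_XX {q : ℕ} [NeZero q] : (insert 1 (XX q)).card = rhoQ q := by
  set H := (powMonoidHom 2 : (ZMod q)ˣ →* (ZMod q)ˣ).range with hH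
  have h1 : ∑ u : (ZMod q)ˣ, ∑ χ ∈ insert 1 (XX q), χ (u : ZMod q) = (Nat.card H : ℂ) * ((insert 1 (XX q)).card : ℂ) := by
    simp_rw [sum_insert_XX]
    rw [Finset.sum_ite, Finset.sum_const_zero, add_zero, Finset.sum_const, nsmul_eq_mul]
    congr 2
    rw [← Fintype.card_subtype, Nat.card_eq_fintype_card]
  have h2 : ∑ u : (ZMod q)ˣ, ∑ χ ∈ insert 1 (XX q), χ (u : ZMod q) = (Nat.card (ZMod q)ˣ : ℂ) := by
    rw [Finset.sum_comm, Finset.sum_insert (by rw [mem_XX]; simp)]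
    rw [Finset.sum_eq_zero (s := XX q), add_zero]
    · simp
    · intro χ hχ
      rw [mem_XX] at hχ
      obtain ⟨v, hv⟩ := MulChar.ne_one_iff.1 hχ.1
      refine eq_zero_of_mul_eq_self_left hv ?_
      simp only [Finset.mul_sum, ← map_mul, ← Units.val_mul]
      exact Fintype.sum_bijective _ (Group.mulLeft_bijective v) _ _ fun _ => rfl
  rw [h1] at h2
  have h3 : Nat.card H * (insert 1 (XX q)).card = Nat.card (ZMod q)ˣ := by exact_mod_cast h2
  rw [← H.card_mul_index] at h3
  exact Nat.eq_of_mul_eq_mul_left Nat.card_pos h3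

lemma sum_XX {q : ℕ} [NeZero q] (z : ZMod q) : ∑ χ ∈ XX q, χ z = (aR q z : ℂ) := by
  unfold aR
  by_cases hz : IsUnit z
  · obtain ⟨u, rfl⟩ := hz
    have h := sum_insert_XX u
    rw [Finset.sum_insert (by rw [mem_XX]; simp), MulChar.one_apply_coe, card_insert_XX] at h
    simp only [← sq_iff] at h
    rw [if_pos u.isUnit, ← sub_eq_iff_eq_add'.2 h.symm]
    split_ifs <;> push_cast <;> ring
  · rw [if_neg hz, Finset.sum_eq_zero]
    · simp
    · intro χ _
      exact χ.map_nonunit hz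

lemma rho_ge_two {q : ℕ} [NeZero q] (hq : 3 ≤ q) : 2 ≤ rhoQ q := by
  have h0 : rhoQ q ≠ 0 := Subgroup.index_ne_zero_of_finite
  have h1 : rhoQ q ≠ 1 := by
    intro h
    rw [rhoQ, Subgroup.index_eq_one, MonoidHom.range_eq_top] at h
    have h2 := Finite.injective_iff_surjective.2 h
    have : (-1 : (ZMod q)ˣ) = 1 := h2 (by simp)
    have h3 := congrArg (Units.val) this
    simp only [Units.val_neg, Units.val_one] at h3
    haveI : Fact (2 < q) := ⟨hq⟩
    exact ZMod.neg_one_ne_one h3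
  omega

lemma race_eq (q : ℕ) (x : ℝ) : ((rhoQ q : ℝ) - 1) * (piModSq q x : ℝ) - (piModNonSq q x : ℝ) =
    ∑ p ∈ (Finset.Icc 1 ⌊x⌋₊).filter Nat.Prime, aR q (p : ZMod q) := by
  have e : (Finset.Icc 1 ⌊x⌋₊).filter Nat.Prime = (Finset.range (⌊x⌋₊ + 1)).filter Nat.Prime := by
    ext p
    simp only [Finset.mem_filter, Finset.mem_Icc, Finset.mem_range]
    constructor
    · rintro ⟨h, hp⟩; exact ⟨by omega, hp⟩
    · rintro ⟨h, hp⟩; exact ⟨⟨hp.one_lt.le, by omega⟩, hp⟩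
  rw [e, piModSq, piModNonSq, Finset.sum_filter, Finset.card_filter, Finset.card_filter]
  push_cast
  rw [Finset.mul_sum, ← Finset.sum_sub_distrib]
  refine Finset.sum_congr rfl fun p _ => ?_
  unfold aR
  by_cases h1 : p.Prime <;> by_cases h2 : IsUnit (p : ZMod q) <;> by_cases h3 : ∃ y : ZMod q, y * y = (p : ZMod q) <;> simp [h1, h2, h3]

lemma fX_eq (q : ℕ) [NeZero q] (y : ℝ) : fX q y =
    ((∑ k ∈ Finset.Icc 1 ⌊Real.exp y⌋₊, aR q (k : ZMod q) * ArithmeticFunction.vonMangoldt k : ℝ) : ℂ) := by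
  unfold fX psiChi
  rw [Finset.sum_comm]
  push_cast
  refine Finset.sum_congr rfl fun k _ => ?_
  rw [← sum_XX, Finset.sum_mul]

lemma aR_sq_ge {q : ℕ} [NeZero q] (hq : 3 ≤ q) {z : ZMod q} (hz : IsUnit z) : 1 ≤ (aR q z) ^ 2 := by
  have h : (2:ℝ) ≤ rhoQ q := by exact_mod_cast rho_ge_two hq
  unfold aR
  rw [if_pos hz]
  split_ifs
  · nlinarith
  · norm_num

lemma isUnit_of_prime_gt {q p : ℕ} [NeZero q] (hp : p.Prime) (h : q < p) : IsUnit (p : ZMod q) := by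
  rw [ZMod.isUnit_iff_coprime]
  exact (Nat.Prime.coprime_iff_not_dvd hp).2 fun hd => absurd (Nat.le_of_dvd (Nat.pos_of_ne_zero (NeZero.ne q)) hd) (by omega)

lemma fX_jump (q : ℕ) [NeZero q] {p N : ℕ} (hp : p.Prime) (hpN : p ≤ N) {y : ℝ}
    (hy : y ∈ Set.Ico (Real.log p) (Real.log p + 1 / (2 * (N + 1)))) :
    fX q y - fX q (y - 1 / (2 * (N + 1))) = ((aR q (p : ZMod q) * Real.log p : ℝ) : ℂ) ∧ Real.exp y ≤ N + 1 := by
  set h : ℝ := 1 / (2 * (N + 1)) with hh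
  have hp0 : 0 < (p:ℝ) := by exact_mod_cast hp.pos
  have hpN' : (p:ℝ) ≤ N := by exact_mod_cast hpN
  have hN : (0:ℝ) < N + 1 := by positivity
  have hh0 : 0 < h := by positivity
  have hhN : h * (N + 1) = 1 / 2 := by rw [hh]; field_simp
  have hh1 : h ≤ 1 / 2 := by nlinarith
  have h1 : 1 - h ≤ Real.exp (-h) := by linarith [Real.add_one_le_exp (-h)]
  have h2 : Real.exp h ≤ 1 + 2 * h := by
    have : Real.exp h * Real.exp (-h) = 1 := by rw [← Real.exp_add]; simp
    have h3 := Real.exp_pos h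
    nlinarith
  have hl : (p:ℝ) ≤ Real.exp y := by rw [← Real.exp_log hp0]; exact Real.exp_le_exp.2 hy.1
  have hu : Real.exp y < p + 1 := by
    calc Real.exp y < Real.exp (Real.log p + h) := Real.exp_lt_exp.2 hy.2
      _ = p * Real.exp h := by rw [Real.exp_add, Real.exp_log hp0]
      _ ≤ p * (1 + 2 * h) := by gcongr
      _ ≤ p + 1 := by nlinarith
  have hl2 : (p:ℝ) - 1 ≤ Real.exp (y - h) := by
    calc (p:ℝ) - 1 ≤ p * (1 - h) := by nlinarith
      _ ≤ p * Real.exp (-h) := by gcongr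
      _ ≤ Real.exp y * Real.exp (-h) := by gcongr
      _ = _ := by rw [← Real.exp_add]; rfl
  have hu2 : Real.exp (y - h) < p := by
    rw [← Real.exp_log hp0]; exact Real.exp_lt_exp.2 (by linarith [hy.2])
  have f1 : ⌊Real.exp y⌋₊ = (p - 1) + 1 := by
    rw [Nat.sub_add_cancel hp.one_lt.le]
    exact (Nat.floor_eq_iff (Real.exp_pos _).le).2 ⟨hl, hu⟩
  have f2 : ⌊Real.exp (y - h)⌋₊ = p - 1 := by
    refine (Nat.floor_eq_iff (Real.exp_pos _).le).2 ?_
    rw [Nat.cast_sub hp.one_lt.le]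
    push_cast
    exact ⟨hl2, by linarith⟩
  refine ⟨?_, by linarith⟩
  rw [fX_eq, fX_eq, f1, f2, Finset.sum_Icc_succ_top (by omega), Nat.sub_add_cancel hp.one_lt.le,
    ArithmeticFunction.vonMangoldt_apply_prime hp]
  push_cast
  ring

lemma fX_lower (q : ℕ) [NeZero q] (hq : 3 ≤ q) {σ : ℝ} (hσ : 0 < σ) {N : ℕ} (hN : q ≤ N) :
    ENNReal.ofReal ((1 / (2 * (N + 1))) * ((N + 1 : ℝ) ^ (-(2 * σ)) * Real.log 2) * (Chebyshev.theta N - Chebyshev.theta q)) ≤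
    ∫⁻ y : ℝ, ‖cexp (-σ * y) * (fX q y - fX q (y - 1 / (2 * (N + 1))))‖ₑ ^ 2 := by
  set h : ℝ := 1 / (2 * (N + 1)) with hh
  have hh0 : 0 < h := by positivity
  set P := (Finset.Ioc q N).filter Nat.Prime with hP
  have hth : Chebyshev.theta N - Chebyshev.theta q = ∑ p ∈ P, Real.log p := by
    rw [Chebyshev.theta, Chebyshev.theta, Nat.floor_natCast, Nat.floor_natCast, sub_eq_iff_eq_add, hP, add_comm,
      Finset.sum_filter, Finset.sum_filter, Finset.sum_filter, Finset.sum_Ioc_consecutive _ (Nat.zero_le _) hN]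
  have hmem : ∀ p ∈ P, p.Prime ∧ q < p ∧ p ≤ N := by
    intro p hp
    rw [hP, Finset.mem_filter, Finset.mem_Ioc] at hp
    exact ⟨hp.2, hp.1⟩
  have hdisj : Set.PairwiseDisjoint (P : Set ℕ) (fun p : ℕ => Set.Ico (Real.log p) (Real.log p + h)) := by
    intro p hp r hr hpr
    rw [Function.onFun, Set.disjoint_left]
    intro y hy hy'
    have e1 := (fX_jump q (hmem p hp).1 (hmem p hp).2.2 hy)
    have key : ∀ p ∈ P, y ∈ Set.Ico (Real.log p) (Real.log p + h) → ⌊Real.exp y⌋₊ = p := by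
      intro p hp hy
      obtain ⟨h1, h2, h3⟩ := hmem p hp
      have hp0 : 0 < (p:ℝ) := by exact_mod_cast h1.pos
      have hpN' : (p:ℝ) ≤ N := by exact_mod_cast h3
      have hN : (0:ℝ) < N + 1 := by positivity
      have hhN : h * (N + 1) = 1 / 2 := by rw [hh]; field_simp
      have hh1 : h ≤ 1 / 2 := by nlinarith
      have h1 : 1 - h ≤ Real.exp (-h) := by linarith [Real.add_one_le_exp (-h)]
      have h2 : Real.exp h ≤ 1 + 2 * h := by
        have : Real.exp h * Real.exp (-h) = 1 := by rw [← Real.exp_add]; simp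
        have h3 := Real.exp_pos h
        nlinarith
      refine (Nat.floor_eq_iff (Real.exp_pos _).le).2 ⟨?_, ?_⟩
      · rw [← Real.exp_log hp0]; exact Real.exp_le_exp.2 hy.1
      · calc Real.exp y < Real.exp (Real.log p + h) := Real.exp_lt_exp.2 hy.2
          _ = p * Real.exp h := by rw [Real.exp_add, Real.exp_log hp0]
          _ ≤ p * (1 + 2 * h) := by gcongr
          _ ≤ p + 1 := by nlinarith
    exact hpr ((key p hp hy).symm.trans (key r hr hy'))
  calc _ = ∑ p ∈ P, ENNReal.ofReal (((N + 1 : ℝ) ^ (-(2 * σ)) * Real.log 2 * Real.log p) * h) := by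
        rw [hth, Finset.mul_sum, ENNReal.ofReal_sum_of_nonneg]
        · refine Finset.sum_congr rfl fun p _ => ?_
          congr 1; ring
        · intro p hp
          have := Real.log_natCast_nonneg p
          have := Real.log_nonneg (show (1:ℝ) ≤ 2 by norm_num)
          positivity
    _ ≤ ∑ p ∈ P, ∫⁻ y in Set.Ico (Real.log p) (Real.log p + h), ‖cexp (-σ * y) * (fX q y - fX q (y - h))‖ₑ ^ 2 := by
        refine Finset.sum_le_sum fun p hp => ?_
        obtain ⟨h1, h2, h3⟩ := hmem p hp
        calc _ = ∫⁻ y in Set.Ico (Real.log p) (Real.log p + h), ENNReal.ofReal ((N + 1 : ℝ) ^ (-(2 * σ)) * Real.log 2 * Real.log p) := by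
              rw [setLIntegral_const, Real.volume_Ico, add_sub_cancel_left, ENNReal.ofReal_mul' hh0.le]
          _ ≤ _ := by
              refine setLIntegral_mono' measurableSet_Ico fun y hy => ?_
              obtain ⟨e1, e2⟩ := fX_jump q h1 h3 hy
              rw [enorm_sq_eq, e1, norm_mul, mul_pow, Complex.norm_exp, Complex.norm_real, Real.norm_eq_abs, sq_abs]
              apply ENNReal.ofReal_le_ofReal
              have ha := aR_sq_ge hq (isUnit_of_prime_gt h1 h2)
              have hl2 : Real.log 2 ≤ Real.log p := Real.log_le_log (by norm_num) (by exact_mod_cast h1.two_le)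
              have hl0 := Real.log_nonneg (show (1:ℝ) ≤ 2 by norm_num)
              have e3 : (N + 1 : ℝ) ^ (-(2 * σ)) ≤ Real.exp (-(↑σ:ℂ) * (↑y:ℂ)).re ^ 2 := by
                have : Real.exp (-(↑σ:ℂ) * (↑y:ℂ)).re ^ 2 = (Real.exp y) ^ (-(2 * σ)) := by
                  rw [← Real.exp_mul, ← Real.exp_nat_mul]
                  congr 1
                  simp
                  ring
                rw [this]
                exact Real.rpow_le_rpow_of_nonpos (Real.exp_pos _) e2 (by linarith)
              rw [mul_assoc]
              have : Real.log 2 * Real.log p ≤ (aR q (p : ZMod q) * Real.log p) ^ 2 := by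
                rw [mul_pow]
                nlinarith [mul_le_mul_of_nonneg_right hl2 (hl0.trans hl2), mul_le_mul_of_nonneg_right ha (sq_nonneg (Real.log p))]
              have : 0 ≤ Real.log p := hl0.trans hl2
              gcongr
    _ = ∫⁻ y in ⋃ p ∈ P, Set.Ico (Real.log p) (Real.log p + h), ‖cexp (-σ * y) * (fX q y - fX q (y - h))‖ₑ ^ 2 := by
        rw [lintegral_biUnion_finset hdisj (fun _ _ => measurableSet_Ico)]
    _ ≤ _ := setLIntegral_le_lintegral _ _

lemma one_sub_exp_rpow {z : ℂ} (hz : 0 ≤ z.re) {κ : ℝ} (h0 : 0 ≤ κ) (h1 : κ ≤ 1) : ‖1 - cexp (-z)‖ ≤ 2 * ‖z‖ ^ κ := by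
  by_cases h : ‖z‖ ≤ 1
  · refine (norm_one_sub_exp_le hz).trans ?_
    rcases eq_or_lt_of_le (norm_nonneg z) with h2 | h2
    · rw [← h2]; positivity
    have := Real.rpow_le_rpow_of_exponent_ge h2 h h1
    rw [Real.rpow_one] at this
    linarith [norm_nonneg z]
  · have h2 : ‖cexp (-z)‖ ≤ 1 := by rw [Complex.norm_exp]; simpa using hz
    have h3 : 1 ≤ ‖z‖ ^ κ := Real.one_le_rpow (not_le.1 h).le h0
    have := norm_sub_le (1:ℂ) (cexp (-z))
    rw [norm_one] at this
    linarith

lemma fX_upper (q : ℕ) [NeZero q] {b σ' σ κ : ℝ} (hb : 1/4 ≤ b) (hz : ∀ ρ : ℂ, 0 < ρ.re → LX q ρ = 0 → ρ.re ≤ b)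
    (h1 : b < σ') (h2 : σ' < σ) (h3 : σ < κ) (h4 : κ < 1/2) :
    ∃ D, 0 ≤ D ∧ ∀ h, 0 < h → ∫⁻ y : ℝ, ‖cexp (-σ * y) * (fX q y - fX q (y - h))‖ₑ ^ 2 ≤ ENNReal.ofReal (D * h ^ (2 * κ)) := by
  obtain ⟨K, hK, hpt⟩ := (LX_nice q).pointwise hb hz
  obtain ⟨D, hD, hbd⟩ := (LX_nice q).logDeriv_div_bound hb hz h1
  obtain ⟨C, hC, hCb⟩ := fX_bound q
  set η : ℝ := (1/2 - κ) / 2 with hη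
  have hη0 : 0 < η := by rw [hη]; linarith
  set p : ℝ := 2 * (1 - η - κ) with hp
  have hp1 : 1 < p := by rw [hp, hη]; linarith
  set E : ℝ := K * (1 + 1 / (σ - b)) * (2 ^ η / η) * (1 + 1 / σ) * 2 with hE
  have hσ0 : 0 < σ := by linarith
  have hσb : 0 < σ - b := by linarith
  have hE0 : 0 ≤ E := by positivity
  refine ⟨E ^ 2 * ∫ t : ℝ, (1 + |t|) ^ (-p), mul_nonneg (sq_nonneg _) (integral_nonneg fun t => by positivity), fun h hh => ?_⟩
  have hLd : ∀ s : ℂ, σ' ≤ s.re → DifferentiableAt ℂ (fun s => -logDeriv (LX q) s / s) s := by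
    intro s hs
    have hs0 : 0 < s.re := by linarith
    have : s ≠ 0 := fun h => by rw [h] at hs0; simp at hs0
    exact (logDeriv_diffOn (LX_nice q).diff hs0 (fun h => by linarith [hz s hs0 h])).neg.div differentiableAt_id this
  have key := laplace_plancherel (f := fun y => fX q y - fX q (y - h)) (C := C * 2) (σ' := σ') (σ := σ) (D := D * 2)
    (F := fun s => (-logDeriv (LX q) s / s) * (1 - cexp (-(h * s))))
    ((fX_measurable q).sub ((fX_measurable q).comp (measurable_id.sub_const h)))
    (fun y hy => by simp only [fX_neg q y hy, fX_neg q (y - h) (by linarith), sub_zero])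
    (fun y => by
      refine (norm_sub_le _ _).trans ?_
      have e1 := hCb y
      have e2 := hCb (y - h)
      have e3 : Real.exp (3/2 * (y - h)) ≤ Real.exp (3/2 * y) := Real.exp_le_exp.2 (by linarith)
      nlinarith) (by linarith) h2 (by linarith)
    (fun s hs => ((hLd s hs.1).mul (by fun_prop)).differentiableWithinAt)
    (fun s hs => by
      have i1 := integrable_laplace (fX_measurable q) (fX_neg q) hCb (s := s) (by rw [hs]; norm_num)
      have e : ∀ y : ℝ, cexp (-s * y) * fX q (y - h) = cexp (-(h * s)) * (cexp (-s * ((y - h : ℝ) : ℂ)) * fX q (y - h)) := by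
        intro y
        rw [← mul_assoc, ← Complex.exp_add]
        congr 2
        push_cast
        ring
      simp only [mul_sub, e]
      rw [integral_sub i1 ((i1.comp_sub_right h).const_mul _), integral_const_mul,
        integral_sub_right_eq_self (fun y : ℝ => cexp (-s * y) * fX q y) h, fX_laplace q s hs]
      ring)
    (fun s hs1 hs2 => by
      rw [norm_mul]
      have e1 := hbd s hs1 hs2
      have e2 : ‖1 - cexp (-(h * s))‖ ≤ 2 := by
        have : ‖cexp (-(h * s))‖ ≤ 1 := by
          rw [Complex.norm_exp, Real.exp_le_one_iff]
          simp
          nlinarith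
        have h5 := norm_sub_le (1:ℂ) (cexp (-(h * s)))
        rw [norm_one] at h5
        linarith
      calc _ ≤ (D * (1 + |s.im|) ^ (-(3/4):ℝ)) * 2 := by gcongr
        _ = _ := by ring)
  refine key.trans ?_
  have hpw : ∀ t : ℝ, ‖(-logDeriv (LX q) (σ + t * I) / (σ + t * I)) * (1 - cexp (-(h * (σ + t * I))))‖ ^ 2 ≤
      E ^ 2 * h ^ (2 * κ) * (1 + |t|) ^ (-p) := by
    intro t
    set s : ℂ := σ + t * I with hs
    have hre : s.re = σ := by simp [hs]
    have him : s.im = t := by simp [hs]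
    have h0 := abs_nonneg t
    have e1 := hpt s (by linarith) (by linarith)
    rw [hre, him] at e1
    have e2 : Real.log (|t| + 2) ≤ (2 ^ η / η) * (1 + |t|) ^ η := by
      refine (Real.log_le_rpow_div (by positivity) hη0).trans ?_
      rw [div_mul_eq_mul_div, ← Real.mul_rpow (by norm_num) (by positivity)]
      gcongr
      linarith
    have e3 := norm_ge_one_add hσ0 (s := s) (by linarith)
    rw [him] at e3
    have hs0 : 0 < ‖s‖ := by
      have := abs_re_le_norm s
      rw [hre, abs_of_pos hσ0] at this
      linarith
    have e4 := one_sub_exp_rpow (z := h * s) (by simp [hre]; positivity) (κ := κ) (by linarith) (by linarith)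
    have e5 : ‖s‖ ≤ 1 + |t| := by
      refine (norm_le_abs_re_add_abs_im s).trans ?_
      rw [hre, him, abs_of_pos hσ0]; linarith
    have e6 : ‖-logDeriv (LX q) s / s‖ ≤ K * (1 + 1 / (σ - b)) * ((2 ^ η / η) * (1 + |t|) ^ η) * ((1 + 1/σ) * (1 + |t|) ^ (-1:ℝ)) := by
      rw [norm_div, norm_neg, div_eq_mul_inv]
      have : ‖s‖⁻¹ ≤ (1 + 1/σ) * (1 + |t|) ^ (-1:ℝ) := by
        rw [Real.rpow_neg_one, ← div_eq_mul_inv, inv_eq_one_div, div_le_div_iff₀ hs0 (by positivity)]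
        linarith
      have e7 : ‖logDeriv (LX q) s‖ ≤ K * (1 + 1 / (σ - b)) * ((2 ^ η / η) * (1 + |t|) ^ η) := e1.trans (by gcongr)
      gcongr
    have e8 : ‖1 - cexp (-(h * s))‖ ≤ 2 * (h ^ κ * (1 + |t|) ^ κ) := by
      refine e4.trans ?_
      rw [norm_mul, Complex.norm_real, Real.norm_of_nonneg hh.le, Real.mul_rpow hh.le hs0.le]
      gcongr
      linarith
    have e9 : ‖(-logDeriv (LX q) s / s) * (1 - cexp (-(h * s)))‖ ≤ E * (h ^ κ * (1 + |t|) ^ (-(1 - η - κ))) := by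
      rw [norm_mul]
      calc _ ≤ (K * (1 + 1 / (σ - b)) * ((2 ^ η / η) * (1 + |t|) ^ η) * ((1 + 1/σ) * (1 + |t|) ^ (-1:ℝ))) * (2 * (h ^ κ * (1 + |t|) ^ κ)) := by
            gcongr
        _ = E * (h ^ κ * ((1 + |t|) ^ η * (1 + |t|) ^ (-1:ℝ) * (1 + |t|) ^ κ)) := by rw [hE]; ring
        _ = _ := by
            rw [← Real.rpow_add (by positivity), ← Real.rpow_add (by positivity)]
            congr 3
            ring
    calc _ ≤ (E * (h ^ κ * (1 + |t|) ^ (-(1 - η - κ)))) ^ 2 := by gcongr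
      _ = E ^ 2 * (h ^ κ) ^ 2 * ((1 + |t|) ^ (-(1 - η - κ))) ^ 2 := by ring
      _ = _ := by
          rw [← Real.rpow_natCast (h ^ κ), ← Real.rpow_natCast (_ ^ (-(1 - η - κ))), ← Real.rpow_mul hh.le,
            ← Real.rpow_mul (by positivity)]
          congr 2
          · congr 1
            push_cast; ring
          · rw [hp]; push_cast; ring
  calc _ ≤ ∫⁻ t : ℝ, ENNReal.ofReal (E ^ 2 * h ^ (2 * κ) * (1 + |t|) ^ (-p)) := by
        refine lintegral_mono fun t => ?_
        rw [enorm_sq_eq]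
        exact ENNReal.ofReal_le_ofReal (hpw t)
    _ = ENNReal.ofReal (∫ t : ℝ, E ^ 2 * h ^ (2 * κ) * (1 + |t|) ^ (-p)) := by
        rw [ofReal_integral_eq_lintegral_ofReal ((integrable_decay hp1).const_mul _)]
        exact Eventually.of_forall fun t => by positivity
    _ ≤ _ := by
        apply ENNReal.ofReal_le_ofReal
        rw [integral_const_mul]
        apply le_of_eq
        ring

lemma theta_lower (C : ℝ) : ∀ᶠ N : ℕ in atTop, (N:ℝ) / 4 ≤ Chebyshev.theta N - C := by
  have hl2 : (0.69:ℝ) < Real.log 2 := by have := Real.log_two_gt_d9; linarith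
  have h1 : (fun x : ℝ => Real.log x) =o[atTop] fun x : ℝ => x ^ (1/4:ℝ) := isLittleO_log_rpow_atTop (by norm_num)
  have h2 : Tendsto (fun N : ℕ => (N:ℝ)) atTop atTop := tendsto_natCast_atTop_atTop
  have h4 := (h1.bound (show (0:ℝ) < 1/20 by norm_num))
  filter_upwards [h2.eventually h4, h2.eventually_ge_atTop (20 * |C| + 20)] with N hN hN2
  have hge := Chebyshev.theta_ge N
  have hC := abs_nonneg C
  have hC' := le_abs_self C
  have hN1 : (1:ℝ) ≤ N := by linarith
  have hlog0 := Real.log_nonneg hN1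
  rw [Real.norm_of_nonneg hlog0, Real.norm_of_nonneg (by positivity)] at hN
  have h5 : (N:ℝ) ^ (1/4:ℝ) ≤ N ^ (1/2:ℝ) := Real.rpow_le_rpow_of_exponent_le hN1 (by norm_num)
  rw [← Real.sqrt_eq_rpow] at h5
  have hs := Real.sq_sqrt (show (0:ℝ) ≤ N by linarith)
  have hs0 := Real.sqrt_nonneg (N:ℝ)
  have hs1 : 1 ≤ √(N:ℝ) := by rw [Real.one_le_sqrt]; exact hN1
  have h6 : Real.log (N + 1) ≤ 1 + Real.log N := by
    have : Real.log (N + 1) ≤ Real.log (2 * N) := Real.log_le_log (by positivity) (by linarith)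
    rw [Real.log_mul (by norm_num) (by positivity)] at this
    linarith [Real.log_two_lt_d9]
  nlinarith

theorem zeros_ge_half (q : ℕ) [NeZero q] (hq : 3 ≤ q) {b : ℝ} (hb : b < 1/2) : ∃ ρ : ℂ, LX q ρ = 0 ∧ 0 < ρ.re ∧ b < ρ.re := by
  by_contra hcon
  push Not at hcon
  set b' := max b (1/4) with hb'
  have hb2 : b' < 1/2 := max_lt hb (by norm_num)
  have hz : ∀ ρ : ℂ, 0 < ρ.re → LX q ρ = 0 → ρ.re ≤ b' := fun ρ h1 h2 => (hcon ρ h2 h1).trans (le_max_left _ _)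
  set δ := (1/2 - b') / 4 with hδ
  have hδ0 : 0 < δ := by rw [hδ]; linarith
  have hb4 : 1/4 ≤ b' := le_max_right _ _
  obtain ⟨D, hD, hup⟩ := fX_upper q (b := b') (σ' := b' + δ) (σ := b' + 2 * δ) (κ := b' + 3 * δ) hb4 hz
    (by linarith) (by linarith) (by linarith) (by rw [hδ]; linarith)
  set σ := b' + 2 * δ with hσ
  set κ := b' + 3 * δ with hκ
  have hl2 : 0 < Real.log 2 := Real.log_pos (by norm_num)
  have key : ∀ᶠ N : ℕ in atTop, Real.log 2 / 16 ≤ D * (N + 1 : ℝ) ^ (-(2 * δ)) := by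
    filter_upwards [theta_lower (Chebyshev.theta q), eventually_ge_atTop q, eventually_ge_atTop 1] with N h1 h2 h3
    have h4 := (fX_lower q hq (σ := σ) (by linarith) h2).trans (hup (1 / (2 * (N + 1))) (by positivity))
    rw [ENNReal.ofReal_le_ofReal_iff (by positivity)] at h4
    have hM : (1:ℝ) ≤ N := by exact_mod_cast h3
    set M : ℝ := N + 1 with hMd
    have hM0 : 0 < M := by linarith
    have h5 : (1 / (2 * M)) * (M ^ (-(2 * σ)) * Real.log 2) * (M / 8) ≤ D * M ^ (-(2 * κ)) := by
      calc _ ≤ (1 / (2 * M)) * (M ^ (-(2 * σ)) * Real.log 2) * (Chebyshev.theta N - Chebyshev.theta q) := by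
            gcongr; linarith
        _ ≤ _ := h4
        _ ≤ D * (1 / M) ^ (2 * κ) := by
            gcongr
            linarith
        _ = _ := by rw [Real.rpow_neg hM0.le, one_div, Real.inv_rpow hM0.le]
    have h6 : M ^ (-(2 * κ)) = M ^ (-(2 * σ)) * M ^ (-(2 * δ)) := by
      rw [← Real.rpow_add hM0]; congr 1; rw [hκ, hσ]; ring
    have h7 : (1 / (2 * M)) * (M ^ (-(2 * σ)) * Real.log 2) * (M / 8) = M ^ (-(2 * σ)) * (Real.log 2 / 16) := by
      field_simp; ring
    rw [h6, h7] at h5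
    have h8 : 0 < M ^ (-(2 * σ)) := by positivity
    have : M ^ (-(2 * σ)) * (Real.log 2 / 16) ≤ M ^ (-(2 * σ)) * (D * M ^ (-(2 * δ))) := by linarith
    exact le_of_mul_le_mul_left this h8
  have ht : Tendsto (fun N : ℕ => D * (N + 1 : ℝ) ^ (-(2 * δ))) atTop (𝓝 (D * 0)) :=
    ((tendsto_rpow_neg_atTop (by positivity)).comp (tendsto_atTop_add_const_right _ _ tendsto_natCast_atTop_atTop)).const_mul D
  have := ge_of_tendsto ht key
  linarith

lemma zero_re_lt_one {q : ℕ} [NeZero q] {ρ : ℂ} (h : LX q ρ = 0) : ρ.re < 1 := by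
  obtain ⟨χ, hχ, h0⟩ := LX_eq_zero.1 h
  by_contra h1
  exact DirichletCharacter.LFunction_ne_zero_of_one_le_re χ (Or.inl ((mem_XX χ).1 hχ).1) (not_lt.1 h1) h0

lemma betaQ2_eq (q : ℕ) [NeZero q] : betaQ2 q = sSup {b : ℝ | ∃ ρ : ℂ, LX q ρ = 0 ∧ 0 < ρ.re ∧ ρ.re = b} := by
  unfold betaQ2
  congr 1
  ext b
  constructor
  · rintro ⟨χ, h1, h2, ρ, h3, h4, h5, h6⟩
    exact ⟨ρ, LX_eq_zero.2 ⟨χ, (mem_XX χ).2 ⟨h1, h2⟩, h3⟩, h4, h6⟩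
  · rintro ⟨ρ, h1, h2, h3⟩
    obtain ⟨χ, hχ, h0⟩ := LX_eq_zero.1 h1
    exact ⟨χ, ((mem_XX χ).1 hχ).1, ((mem_XX χ).1 hχ).2, ρ, h0, h2, zero_re_lt_one h1, h3⟩

lemma beta_bdd (q : ℕ) [NeZero q] : BddAbove {b : ℝ | ∃ ρ : ℂ, LX q ρ = 0 ∧ 0 < ρ.re ∧ ρ.re = b} := by
  refine ⟨1, ?_⟩
  rintro b ⟨ρ, h1, h2, rfl⟩
  exact (zero_re_lt_one h1).le

lemma zero_re_le_beta {q : ℕ} [NeZero q] : ∀ ρ : ℂ, 0 < ρ.re → LX q ρ = 0 → ρ.re ≤ betaQ2 q := by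
  intro ρ h1 h2
  rw [betaQ2_eq]
  exact le_csSup (beta_bdd q) ⟨ρ, h2, h1, rfl⟩

lemma half_le_beta (q : ℕ) [NeZero q] (hq : 3 ≤ q) : 1/2 ≤ betaQ2 q := by
  by_contra h
  obtain ⟨ρ, h1, h2, h3⟩ := zeros_ge_half q hq (not_le.1 h)
  linarith [zero_re_le_beta ρ h2 h1]

lemma beta_le_one (q : ℕ) [NeZero q] (hq : 3 ≤ q) : betaQ2 q ≤ 1 := by
  rw [betaQ2_eq]
  obtain ⟨ρ, h1, h2, h3⟩ := zeros_ge_half q hq (b := 0) (by norm_num)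
  refine csSup_le ⟨ρ.re, ρ, h1, h2, rfl⟩ ?_
  rintro b ⟨ρ, h1, h2, rfl⟩
  exact (zero_re_lt_one h1).le

/-- Smallness in Cesaro mean. -/
def MS (w : ℝ → ENNReal) : Prop := ∀ ε : ℝ, 0 < ε → ∀ᶠ Y : ℝ in atTop, ∫⁻ y in Set.Ioc 0 Y, w y ≤ ENNReal.ofReal (ε * Y)

lemma MS.mono {w v : ℝ → ENNReal} (hv : MS v) (h : ∀ y, 0 < y → w y ≤ v y) : MS w := by
  intro ε hε
  filter_upwards [hv ε hε] with Y hY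
  exact (setLIntegral_mono' measurableSet_Ioc fun y hy => h y hy.1).trans hY

lemma MS.add {w v : ℝ → ENNReal} (hw : MS w) (hv : MS v) (hm : Measurable w) : MS (fun y => w y + v y) := by
  intro ε hε
  filter_upwards [hw (ε/2) (by positivity), hv (ε/2) (by positivity), eventually_ge_atTop 0] with Y h1 h2 h3
  rw [lintegral_add_left hm]
  refine (add_le_add h1 h2).trans ?_
  rw [← ENNReal.ofReal_add (by positivity) (by positivity)]
  apply ENNReal.ofReal_le_ofReal
  linarith

lemma MS.const_mul {w : ℝ → ENNReal} (hw : MS w) {c : ℝ} (hc : 0 ≤ c) : MS (fun y => ENNReal.ofReal c * w y) := by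
  intro ε hε
  filter_upwards [hw (ε/(c+1)) (by positivity), eventually_ge_atTop 0] with Y h1 h3
  rw [lintegral_const_mul' _ _ ENNReal.ofReal_ne_top]
  refine (mul_le_mul_right h1 _).trans ?_
  rw [← ENNReal.ofReal_mul hc]
  apply ENNReal.ofReal_le_ofReal
  rw [show c * (ε / (c+1) * Y) = (ε * Y) * (c / (c+1)) by ring]
  have : c / (c+1) ≤ 1 := by rw [div_le_one (by positivity)]; linarith
  exact mul_le_of_le_one_right (by positivity) this

lemma MS.of_exp {C c : ℝ} (hc : 0 < c) (hC : 0 ≤ C) : MS (fun y => ENNReal.ofReal (C * Real.exp (-c * y))) := by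
  intro ε hε
  filter_upwards [eventually_ge_atTop (C / (c * ε)), eventually_ge_atTop 0] with Y h1 h2
  have hi : IntegrableOn (fun y : ℝ => C * Real.exp (-c * y)) (Set.Ioi 0) := (integrableOn_exp_mul_Ioi (by linarith) 0).const_mul C
  calc _ ≤ ∫⁻ y in Set.Ioi 0, ENNReal.ofReal (C * Real.exp (-c * y)) := lintegral_mono_set Set.Ioc_subset_Ioi_self
    _ = ENNReal.ofReal (∫ y in Set.Ioi 0, C * Real.exp (-c * y)) := by
        rw [ofReal_integral_eq_lintegral_ofReal hi]
        exact Eventually.of_forall fun y => by positivity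
    _ ≤ _ := by
        apply ENNReal.ofReal_le_ofReal
        rw [integral_const_mul, integral_exp_mul_Ioi (by linarith)]
        simp only [mul_zero, Real.exp_zero]
        rw [div_le_iff₀ (by positivity)] at h1
        rw [neg_div_neg_eq, mul_one_div, div_le_iff₀ hc]
        linarith

lemma lint_of_sq {z : ℝ → ℂ} {ε Y : ℝ} (hε : 0 < ε) (hY : 0 ≤ Y) (h : ∫⁻ y in Set.Ioc 0 Y, ‖z y‖ₑ ^ 2 ≤ ENNReal.ofReal (ε ^ 2 * Y)) :
    ∫⁻ y in Set.Ioc 0 Y, ‖z y‖ₑ ≤ ENNReal.ofReal (ε * Y) := by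
  have hp : ∀ y, ‖z y‖ₑ ≤ ENNReal.ofReal (ε / 2) + ENNReal.ofReal (1 / (2 * ε)) * ‖z y‖ₑ ^ 2 := by
    intro y
    rw [enorm_sq_eq, ← ENNReal.ofReal_mul (by positivity), ← ENNReal.ofReal_add (by positivity) (by positivity), ← ofReal_norm_eq_enorm]
    apply ENNReal.ofReal_le_ofReal
    have : ε / 2 + 1 / (2 * ε) * ‖z y‖ ^ 2 - ‖z y‖ = (ε - ‖z y‖) ^ 2 / (2 * ε) := by field_simp; ring
    have h2 : 0 ≤ (ε - ‖z y‖) ^ 2 / (2 * ε) := by positivity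
    linarith
  calc _ ≤ ∫⁻ y in Set.Ioc 0 Y, (ENNReal.ofReal (ε / 2) + ENNReal.ofReal (1 / (2 * ε)) * ‖z y‖ₑ ^ 2) := lintegral_mono hp
    _ = ENNReal.ofReal (ε / 2) * ENNReal.ofReal Y + ENNReal.ofReal (1 / (2 * ε)) * ∫⁻ y in Set.Ioc 0 Y, ‖z y‖ₑ ^ 2 := by
        rw [lintegral_add_left measurable_const, lintegral_const_mul' _ _ ENNReal.ofReal_ne_top, setLIntegral_const, Real.volume_Ioc, sub_zero]
    _ ≤ ENNReal.ofReal (ε / 2) * ENNReal.ofReal Y + ENNReal.ofReal (1 / (2 * ε)) * ENNReal.ofReal (ε ^ 2 * Y) := by gcongr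
    _ = _ := by
        rw [← ENNReal.ofReal_mul (by positivity), ← ENNReal.ofReal_mul (by positivity), ← ENNReal.ofReal_add (by positivity) (by positivity)]
        congr 1
        field_simp; ring

lemma MS.of_sq {z : ℝ → ℂ} (h : MS (fun y => ‖z y‖ₑ ^ 2)) : MS (fun y => ‖z y‖ₑ) := by
  intro ε hε
  filter_upwards [h (ε ^ 2) (by positivity), eventually_ge_atTop 0] with Y h1 h2
  exact lint_of_sq hε h2 h1

lemma MS.comp_half {w : ℝ → ENNReal} (h : MS w) : MS (fun y => w (y / 2)) := by
  intro ε hε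
  have h2 := (tendsto_id.atTop_div_const (show (0:ℝ) < 2 by norm_num)).eventually (h ε hε)
  filter_upwards [h2] with Y hY
  simp only [id] at hY
  have e1 : ∫⁻ y in Set.Ioc 0 Y, w (y / 2) = ∫⁻ y, ((Set.Ioc 0 (Y/2)).indicator w) ((1/2) * y) := by
    rw [← lintegral_indicator measurableSet_Ioc]
    refine lintegral_congr fun y => ?_
    have : y ∈ Set.Ioc 0 Y ↔ (1/2) * y ∈ Set.Ioc 0 (Y/2) := by
      simp only [Set.mem_Ioc]
      constructor <;> rintro ⟨h1, h2⟩ <;> constructor <;> linarith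
    by_cases hy : y ∈ Set.Ioc 0 Y
    · rw [Set.indicator_of_mem hy, Set.indicator_of_mem (this.1 hy)]; congr 1; ring
    · rw [Set.indicator_of_notMem hy, Set.indicator_of_notMem (mt this.2 hy)]
  have e2 : Measure.map (fun y : ℝ => (1/2) * y) volume = ENNReal.ofReal 2 • volume := by
    rw [Real.map_volume_mul_left (by norm_num)]; norm_num
  have hme : MeasurableEmbedding (fun y : ℝ => (1/2) * y) := (Homeomorph.mulLeft₀ (1/2:ℝ) (by norm_num)).measurableEmbedding
  rw [e1, ← hme.lintegral_map, e2, lintegral_smul_measure, lintegral_indicator measurableSet_Ioc, smul_eq_mul]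
  refine (mul_le_mul_right hY _).trans ?_
  rw [← ENNReal.ofReal_mul (by norm_num)]
  apply ENNReal.ofReal_le_ofReal
  linarith

def Th (q : ℕ) (y : ℝ) : ℝ := ∑ p ∈ (Finset.Icc 1 ⌊Real.exp y⌋₊).filter Nat.Prime, aR q (p : ZMod q) * Real.log p

lemma aR_abs_le {q : ℕ} [NeZero q] (z : ZMod q) : |aR q z| ≤ rhoQ q := by
  have h0 : (1:ℝ) ≤ rhoQ q := by
    have : rhoQ q ≠ 0 := Subgroup.index_ne_zero_of_finite
    exact_mod_cast Nat.one_le_iff_ne_zero.2 this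
  unfold aR
  split_ifs
  · rw [abs_of_nonneg (by linarith)]; linarith
  · simpa using h0
  · simp

lemma aR_sq_val {q : ℕ} [NeZero q] {z : ZMod q} (hz : IsUnit z) : aR q (z ^ 2) = (rhoQ q : ℝ) - 1 := by
  unfold aR
  rw [if_pos (hz.pow 2), if_pos ⟨z, (sq z).symm⟩]

lemma psi_sub_theta_third : ∃ C, 0 ≤ C ∧ ∀ x : ℝ, 1 ≤ x → Chebyshev.psi x - Chebyshev.theta x - Chebyshev.theta (√x) ≤ C * x ^ (1/3:ℝ) := by
  obtain ⟨C, hC⟩ := Chebyshev.psi_sub_theta_le_mul_sqrt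
  have hC1 : 0 ≤ C := by
    have := hC 1
    have h2 := Chebyshev.theta_le_psi 1
    simp at this
    linarith
  refine ⟨C + (Real.log 4 + 4) * 2, by positivity, fun x hx => ?_⟩
  have h0 : 0 ≤ x := by linarith
  have h1 := Chebyshev.psi_sub_theta_le_psi_add_psi_add_psi x
  have h2 := hC (√x)
  have h3 := Chebyshev.psi_le_const_mul_self (x := x ^ (3:ℝ)⁻¹) (by positivity)
  have h4 := Chebyshev.psi_le_const_mul_self (x := x ^ (5:ℝ)⁻¹) (by positivity)
  have e1 : x ^ (2:ℝ)⁻¹ = √x := by rw [Real.sqrt_eq_rpow]; norm_num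
  have e2 : √√x ≤ x ^ (1/3:ℝ) := by
    rw [Real.sqrt_eq_rpow, Real.sqrt_eq_rpow, ← Real.rpow_mul h0]
    exact Real.rpow_le_rpow_of_exponent_le hx (by norm_num)
  have e3 : x ^ (5:ℝ)⁻¹ ≤ x ^ (1/3:ℝ) := Real.rpow_le_rpow_of_exponent_le hx (by norm_num)
  have e4 : x ^ (3:ℝ)⁻¹ = x ^ (1/3:ℝ) := by norm_num
  rw [e1] at h1
  rw [e4] at h1 h3
  have h5 : 0 ≤ Real.log 4 + 4 := by positivity
  have h6 := mul_le_mul_of_nonneg_left e2 hC1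
  have h7 := mul_le_mul_of_nonneg_left e3 h5
  nlinarith

lemma Th_approx (q : ℕ) [NeZero q] : ∃ C, 0 ≤ C ∧ ∀ y : ℝ, 0 ≤ y →
    |Th q y - (∑ k ∈ Finset.Icc 1 ⌊Real.exp y⌋₊, aR q (k : ZMod q) * ArithmeticFunction.vonMangoldt k)
      + ((rhoQ q : ℝ) - 1) * Chebyshev.theta (Real.exp (y / 2))| ≤ C * Real.exp (y / 3) := by
  obtain ⟨C, hC, hCb⟩ := psi_sub_theta_third
  have hρ : (0:ℝ) ≤ rhoQ q := by positivity
  refine ⟨rhoQ q * C + rhoQ q * Chebyshev.theta q, by have := Chebyshev.theta_nonneg q; positivity, fun y hy => ?_⟩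
  set x := Real.exp y with hx
  have hx1 : 1 ≤ x := Real.one_le_exp hy
  have hsq : Real.exp (y / 2) = √x := by
    rw [Real.sqrt_eq_rpow, hx, ← Real.exp_mul]; congr 1; ring
  have hcb : Real.exp (y / 3) = x ^ (1/3:ℝ) := by
    rw [hx, ← Real.exp_mul]; congr 1; ring
  rw [hsq, hcb]
  set A := Finset.Icc 1 ⌊x⌋₊ with hA
  set B := (Finset.Icc 1 ⌊√x⌋₊).filter Nat.Prime with hB
  set T := B.image (fun p => p ^ 2) with hT
  have hTsub : T ⊆ A.filter (fun n => ¬ n.Prime) := by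
    intro n hn
    rw [hT, Finset.mem_image] at hn
    obtain ⟨p, hp, rfl⟩ := hn
    rw [hB, Finset.mem_filter, Finset.mem_Icc] at hp
    rw [Finset.mem_filter, hA, Finset.mem_Icc]
    refine ⟨⟨Nat.one_le_pow _ _ hp.2.pos, ?_⟩, Nat.Prime.not_prime_pow le_rfl⟩
    rw [Nat.le_floor_iff (by linarith)]
    have := (Nat.le_floor_iff (Real.sqrt_nonneg x)).1 hp.1.2
    push_cast
    calc (p:ℝ) ^ 2 ≤ √x ^ 2 := by gcongr
      _ = x := Real.sq_sqrt (by linarith)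
  have hinj : ∀ (g : ℕ → ℝ), ∑ n ∈ T, g n = ∑ p ∈ B, g (p ^ 2) := by
    intro g
    rw [hT, Finset.sum_image]
    intro a _ b _ hab
    exact Nat.pow_left_injective (n := 2) (by norm_num) hab
  have hΛ : ∀ p ∈ B, ArithmeticFunction.vonMangoldt (p ^ 2) = Real.log p := by
    intro p hp
    rw [hB, Finset.mem_filter] at hp
    rw [ArithmeticFunction.vonMangoldt_apply_pow (by norm_num), ArithmeticFunction.vonMangoldt_apply_prime hp.2]
  have hθ : Chebyshev.theta (√x) = ∑ n ∈ T, ArithmeticFunction.vonMangoldt n := by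
    rw [hinj, Finset.sum_congr rfl hΛ]
    rfl
  have hF : ∑ k ∈ A, aR q (k : ZMod q) * ArithmeticFunction.vonMangoldt k = Th q y +
      ∑ k ∈ A.filter (fun n => ¬ n.Prime), aR q (k : ZMod q) * ArithmeticFunction.vonMangoldt k := by
    rw [← Finset.sum_filter_add_sum_filter_not A Nat.Prime]
    congr 1
    refine Finset.sum_congr rfl fun p hp => ?_
    rw [ArithmeticFunction.vonMangoldt_apply_prime (Finset.mem_filter.1 hp).2]
  have hψ : ∑ k ∈ A.filter (fun n => ¬ n.Prime), ArithmeticFunction.vonMangoldt k = Chebyshev.psi x - Chebyshev.theta x :=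
    (Chebyshev.psi_sub_theta_eq_sum_not_prime x).symm
  rw [← Finset.sum_sdiff hTsub] at hψ
  rw [hF, ← Finset.sum_sdiff hTsub]
  have b1 : |∑ k ∈ A.filter (fun n => ¬ n.Prime) \ T, aR q (k : ZMod q) * ArithmeticFunction.vonMangoldt k| ≤
      rhoQ q * (C * x ^ (1/3:ℝ)) := by
    refine (Finset.abs_sum_le_sum_abs _ _).trans ?_
    calc _ ≤ ∑ k ∈ A.filter (fun n => ¬ n.Prime) \ T, (rhoQ q : ℝ) * ArithmeticFunction.vonMangoldt k := by
          refine Finset.sum_le_sum fun k _ => ?_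
          rw [abs_mul, abs_of_nonneg (ArithmeticFunction.vonMangoldt_nonneg (n := k))]
          exact mul_le_mul_of_nonneg_right (aR_abs_le _) ArithmeticFunction.vonMangoldt_nonneg
      _ = rhoQ q * (Chebyshev.psi x - Chebyshev.theta x - Chebyshev.theta (√x)) := by
          rw [← Finset.mul_sum, ← hψ, hθ]; ring
      _ ≤ _ := by gcongr; exact hCb x hx1
  have b2 : |∑ k ∈ T, aR q (k : ZMod q) * ArithmeticFunction.vonMangoldt k - ((rhoQ q : ℝ) - 1) * Chebyshev.theta (√x)| ≤
      rhoQ q * Chebyshev.theta q := by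
    rw [hθ, Finset.mul_sum, ← Finset.sum_sub_distrib, hinj]
    refine (Finset.abs_sum_le_sum_abs _ _).trans ?_
    calc _ ≤ ∑ p ∈ B, if p ≤ q then rhoQ q * Real.log p else 0 := by
          refine Finset.sum_le_sum fun p hp => ?_
          rw [hΛ p hp, ← sub_mul, Nat.cast_pow]
          rw [hB, Finset.mem_filter] at hp
          have hl := Real.log_natCast_nonneg p
          have h1 : (1:ℝ) ≤ rhoQ q := by
            have : rhoQ q ≠ 0 := Subgroup.index_ne_zero_of_finite
            exact_mod_cast Nat.one_le_iff_ne_zero.2 this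
          by_cases hu : IsUnit (p : ZMod q)
          · rw [aR_sq_val hu, sub_self, zero_mul, abs_zero]
            split_ifs <;> positivity
          · have hpq : p ≤ q := by
              by_contra hlt
              exact hu (isUnit_of_prime_gt hp.2 (not_le.1 hlt))
            have hu2 : ¬ IsUnit ((p : ZMod q) ^ 2) := by rwa [isUnit_pow_iff (by norm_num)]
            rw [if_pos hpq, aR, if_neg hu2, zero_sub, abs_mul, abs_of_nonneg hl, abs_neg, abs_of_nonneg (by linarith)]
            gcongr
            linarith
      _ = ∑ p ∈ B.filter (fun p => p ≤ q), rhoQ q * Real.log p := (Finset.sum_filter _ _).symm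
      _ ≤ ∑ p ∈ (Finset.Ioc 0 ⌊(q:ℝ)⌋₊).filter Nat.Prime, rhoQ q * Real.log p := by
          refine Finset.sum_le_sum_of_subset_of_nonneg ?_ fun p _ _ => by
            have hl := Real.log_natCast_nonneg p
            positivity
          intro p hp
          rw [Finset.mem_filter, hB, Finset.mem_filter] at hp
          rw [Finset.mem_filter, Finset.mem_Ioc, Nat.floor_natCast]
          exact ⟨⟨hp.1.2.pos, hp.2⟩, hp.1.2⟩
      _ = _ := by rw [← Finset.mul_sum]; rfl
  have hone : 1 ≤ x ^ (1/3:ℝ) := Real.one_le_rpow hx1 (by norm_num)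
  have hθq := Chebyshev.theta_nonneg q
  have b3 : (rhoQ q : ℝ) * Chebyshev.theta q ≤ rhoQ q * Chebyshev.theta q * x ^ (1/3:ℝ) := le_mul_of_one_le_right (by positivity) hone
  rw [abs_le] at b1 b2 ⊢
  constructor <;> nlinarith [b1.1, b1.2, b2.1, b2.2]

lemma bias0 : MS (fun u => ‖Chebyshev.theta (Real.exp u) * Real.exp (-u) - 1‖ₑ) := by
  obtain ⟨C, hC⟩ := Chebyshev.psi_sub_theta_le_mul_sqrt
  have hC1 : 0 ≤ C := by
    have := hC 1
    have h2 := Chebyshev.theta_le_psi 1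
    simp at this
    linarith
  have m1 : MS (fun y => ‖cexp (-y) * fZ y‖ₑ) := MS.of_sq (fun ε hε => fZ_cesaro hε)
  have m2 : MS (fun y => ENNReal.ofReal ((C + 1) * Real.exp (-(1/2) * y))) := MS.of_exp (by norm_num) (by positivity)
  refine (m2.add m1 (by fun_prop)).mono fun u hu => ?_
  have e1 : fZ u = ((Chebyshev.psi (Real.exp u) - (Real.exp u - 1) : ℝ) : ℂ) := by
    rw [fZ, Set.indicator_of_mem (show u ∈ Set.Ici (0:ℝ) from hu.le), psi_eq_Icc_one]
    push_cast
    rfl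
  have e2 : cexp (-u) * fZ u = ((Real.exp (-u) * (Chebyshev.psi (Real.exp u) - (Real.exp u - 1)) : ℝ) : ℂ) := by
    rw [e1]; push_cast; rfl
  rw [e2, ← ofReal_norm_eq_enorm, ← ofReal_norm_eq_enorm, Complex.norm_real, ← ENNReal.ofReal_add (by positivity) (by positivity)]
  apply ENNReal.ofReal_le_ofReal
  have h1 := hC (Real.exp u)
  have h2 := Chebyshev.theta_le_psi (Real.exp u)
  have hs : √(Real.exp u) * Real.exp (-u) = Real.exp (-(1/2) * u) := by
    rw [Real.sqrt_eq_rpow, ← Real.exp_mul, ← Real.exp_add]; congr 1; ring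
  have hx : Real.exp u * Real.exp (-u) = 1 := by rw [← Real.exp_add]; simp
  have h3 : Real.exp (-u) ≤ Real.exp (-(1/2) * u) := Real.exp_le_exp.2 (by linarith)
  have hp := Real.exp_pos (-u)
  have e3 : Chebyshev.theta (Real.exp u) * Real.exp (-u) - 1 = Real.exp (-u) * (Chebyshev.psi (Real.exp u) - (Real.exp u - 1))
      - (Chebyshev.psi (Real.exp u) - Chebyshev.theta (Real.exp u)) * Real.exp (-u) - Real.exp (-u) := by
    linear_combination hx
  rw [e3]
  refine (norm_sub_le _ _).trans ?_
  have := norm_sub_le (Real.exp (-u) * (Chebyshev.psi (Real.exp u) - (Real.exp u - 1)))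
    ((Chebyshev.psi (Real.exp u) - Chebyshev.theta (Real.exp u)) * Real.exp (-u))
  have h4 : ‖(Chebyshev.psi (Real.exp u) - Chebyshev.theta (Real.exp u)) * Real.exp (-u)‖ ≤ C * Real.exp (-(1/2) * u) := by
    rw [Real.norm_of_nonneg (mul_nonneg (by linarith) hp.le), ← hs, ← mul_assoc]
    gcongr
  have h5 : ‖Real.exp (-u)‖ = Real.exp (-u) := Real.norm_of_nonneg hp.le
  linarith

def c0 (q : ℕ) [NeZero q] : ℝ := if betaQ2 q = 1/2 then 1 else 0

lemma bias (q : ℕ) [NeZero q] (hq : 3 ≤ q) :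
    MS (fun y => ‖Chebyshev.theta (Real.exp (y / 2)) * Real.exp (-betaQ2 q * y) - c0 q‖ₑ) := by
  unfold c0
  have hβ := half_le_beta q hq
  split_ifs with h
  · refine bias0.comp_half.mono fun y hy => ?_
    rw [h]
    apply le_of_eq
    congr 4
    ring
  · have h' : 0 < betaQ2 q - 1/2 := sub_pos.2 (lt_of_le_of_ne hβ (Ne.symm h))
    refine (MS.of_exp (C := Real.log 4) h' (by positivity)).mono fun y hy => ?_
    rw [sub_zero, ← ofReal_norm_eq_enorm]
    apply ENNReal.ofReal_le_ofReal
    have h1 := Chebyshev.theta_le_log4_mul_x (Real.exp_pos (y/2)).le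
    have h0 := Chebyshev.theta_nonneg (Real.exp (y/2))
    rw [Real.norm_of_nonneg (by positivity)]
    calc _ ≤ (Real.log 4 * Real.exp (y/2)) * Real.exp (-betaQ2 q * y) := by gcongr
      _ = _ := by rw [mul_assoc, ← Real.exp_add]; congr 2; ring

lemma Th_measurable (q : ℕ) : Measurable (Th q) :=
  (measurable_from_nat (f := fun n : ℕ => ∑ p ∈ (Finset.Icc 1 n).filter Nat.Prime, aR q (p : ZMod q) * Real.log p)).comp
    (Nat.measurable_floor.comp Real.measurable_exp)

/-- The finite trigonometric sum attached to a set of zeros. -/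
def trigS (q : ℕ) [NeZero q] (S : Finset ℂ) (y : ℝ) : ℂ :=
  ∑ ρ ∈ S, ((analyticOrderNatAt (LX q) ρ : ℂ) / ρ) * cexp (ρ.im * I * y)

lemma trigS_continuous (q : ℕ) [NeZero q] (S : Finset ℂ) : Continuous (trigS q S) := by
  unfold trigS; fun_prop

lemma Th_mean (q : ℕ) [NeZero q] (hq : 3 ≤ q) {ε : ℝ} (hε : 0 < ε) :
    ∃ S : Finset ℂ, (∀ ρ ∈ S, LX q ρ = 0 ∧ ρ.re = betaQ2 q) ∧ ∀ᶠ Y : ℝ in atTop,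
      ∫⁻ y in Set.Ioc 0 Y, ‖((Real.exp (-betaQ2 q * y) * Th q y + ((rhoQ q : ℝ) - 1) * c0 q : ℝ) : ℂ) + trigS q S y‖ₑ
        ≤ ENNReal.ofReal (ε * Y) := by
  set β := betaQ2 q with hβd
  have hβ : 1/2 ≤ β := half_le_beta q hq
  have hρ : (2:ℝ) ≤ rhoQ q := by exact_mod_cast rho_ge_two hq
  obtain ⟨C, hC, hfb⟩ := fX_bound q
  obtain ⟨S, hS, hce⟩ := (LX_nice q).cesaro (by linarith) (beta_le_one q hq) zero_re_le_beta
    (fX_measurable q) (fX_neg q) hfb (fX_laplace q) (show 0 < (ε/2)^2 by positivity)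
  refine ⟨S, hS, ?_⟩
  obtain ⟨C', hC', hTh⟩ := Th_approx q
  have m1 : MS (fun y => ENNReal.ofReal (C' * Real.exp (-(1/6) * y))) := MS.of_exp (by norm_num) hC'
  have m2 := (bias q hq).const_mul (c := (rhoQ q : ℝ) - 1) (by linarith)
  have m3 := m1.add m2 (by fun_prop)
  filter_upwards [hce, m3 (ε/2) (by positivity), eventually_ge_atTop 0] with Y h1 h2 h3
  have h4 := lint_of_sq (by positivity) h3 h1
  have hpw : ∀ y ∈ Set.Ioc 0 Y, ‖((Real.exp (-β * y) * Th q y + ((rhoQ q : ℝ) - 1) * c0 q : ℝ) : ℂ) + trigS q S y‖ₑ ≤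
      ‖cexp (-β * y) * fX q y + trigS q S y‖ₑ + (ENNReal.ofReal (C' * Real.exp (-(1/6) * y)) +
      ENNReal.ofReal ((rhoQ q : ℝ) - 1) * ‖Chebyshev.theta (Real.exp (y / 2)) * Real.exp (-β * y) - c0 q‖ₑ) := by
    intro y hy
    rw [← ofReal_norm_eq_enorm, ← ofReal_norm_eq_enorm, ← ofReal_norm_eq_enorm, ← ENNReal.ofReal_mul (by linarith),
      ← ENNReal.ofReal_add (by positivity) (mul_nonneg (by linarith) (norm_nonneg _)),
      ← ENNReal.ofReal_add (by positivity) (add_nonneg (by positivity) (mul_nonneg (by linarith) (norm_nonneg _)))]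
    apply ENNReal.ofReal_le_ofReal
    have ha := hTh y hy.1.le
    set F := ∑ k ∈ Finset.Icc 1 ⌊Real.exp y⌋₊, aR q (k : ZMod q) * ArithmeticFunction.vonMangoldt k with hF
    set W := Th q y - F + ((rhoQ q : ℝ) - 1) * Chebyshev.theta (Real.exp (y / 2)) with hW
    have hfF : fX q y = (F : ℂ) := fX_eq q y
    have e1 : ((Real.exp (-β * y) * Th q y + ((rhoQ q : ℝ) - 1) * c0 q : ℝ) : ℂ) + trigS q S y =
      (cexp (-β * y) * fX q y + trigS q S y) + (((Real.exp (-β * y) * W : ℝ) : ℂ) -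
        ((((rhoQ q : ℝ) - 1) * (Chebyshev.theta (Real.exp (y / 2)) * Real.exp (-β * y) - c0 q) : ℝ) : ℂ)) := by
      rw [hfF, hW]
      push_cast
      ring
    rw [e1]
    refine (norm_add_le _ _).trans (add_le_add le_rfl ((norm_sub_le _ _).trans (add_le_add ?_ ?_)))
    · rw [Complex.norm_real, norm_mul, Real.norm_of_nonneg (Real.exp_pos _).le, Real.norm_eq_abs]
      calc _ ≤ Real.exp (-β * y) * (C' * Real.exp (y / 3)) := by gcongr
        _ = C' * Real.exp (-β * y + y/3) := by rw [Real.exp_add]; ring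
        _ ≤ _ := by
          have := hy.1
          gcongr
          nlinarith
    · rw [Complex.norm_real, norm_mul, Real.norm_of_nonneg (show (0:ℝ) ≤ (rhoQ q : ℝ) - 1 by linarith)]
  calc _ ≤ ∫⁻ y in Set.Ioc 0 Y, (‖cexp (-β * y) * fX q y + trigS q S y‖ₑ + (ENNReal.ofReal (C' * Real.exp (-(1/6) * y)) +
      ENNReal.ofReal ((rhoQ q : ℝ) - 1) * ‖Chebyshev.theta (Real.exp (y / 2)) * Real.exp (-β * y) - c0 q‖ₑ)) :=
        setLIntegral_mono' measurableSet_Ioc hpw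
    _ ≤ ENNReal.ofReal (ε/2 * Y) + ENNReal.ofReal (ε/2 * Y) := by
        rw [lintegral_add_left]
        · exact add_le_add h4 h2
        · have := fX_measurable q
          have := (trigS_continuous q S).measurable
          fun_prop
    _ = _ := by
        rw [← ENNReal.ofReal_add (by positivity) (by positivity)]
        congr 1; ring

lemma Th_bdd (q : ℕ) [NeZero q] (hq : 3 ≤ q) : ∃ B, 0 ≤ B ∧ ∀ᶠ Y : ℝ in atTop,
    ∫⁻ y in Set.Ioc 0 Y, ENNReal.ofReal (Real.exp (-betaQ2 q * y) * |Th q y|) ≤ ENNReal.ofReal (B * Y) := by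
  obtain ⟨S, -, h⟩ := Th_mean q hq one_pos
  set K : ℝ := |((rhoQ q : ℝ) - 1) * c0 q| + ∑ ρ ∈ S, ‖(analyticOrderNatAt (LX q) ρ : ℂ) / ρ‖ with hK
  have hK0 : 0 ≤ K := by positivity
  refine ⟨1 + K, by positivity, ?_⟩
  filter_upwards [h, eventually_ge_atTop 0] with Y h1 h2
  have htr : ∀ y : ℝ, ‖trigS q S y‖ ≤ ∑ ρ ∈ S, ‖(analyticOrderNatAt (LX q) ρ : ℂ) / ρ‖ := by
    intro y
    refine (norm_sum_le _ _).trans (Finset.sum_le_sum fun ρ _ => ?_)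
    rw [norm_mul, show ((ρ.im : ℂ) * I * y) = ((ρ.im * y : ℝ) : ℂ) * I by push_cast; ring, Complex.norm_exp_ofReal_mul_I, mul_one]
  calc _ ≤ ∫⁻ y in Set.Ioc 0 Y, (ENNReal.ofReal K + ‖((Real.exp (-betaQ2 q * y) * Th q y + ((rhoQ q : ℝ) - 1) * c0 q : ℝ) : ℂ) + trigS q S y‖ₑ) := by
        refine lintegral_mono fun y => ?_
        rw [← ofReal_norm_eq_enorm, ← ENNReal.ofReal_add hK0 (norm_nonneg _)]
        apply ENNReal.ofReal_le_ofReal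
        have e1 : Real.exp (-betaQ2 q * y) * |Th q y| = ‖((Real.exp (-betaQ2 q * y) * Th q y : ℝ) : ℂ)‖ := by
          rw [Complex.norm_real, norm_mul, Real.norm_of_nonneg (Real.exp_pos _).le, Real.norm_eq_abs]
        have e2 : ((Real.exp (-betaQ2 q * y) * Th q y : ℝ) : ℂ) = (((Real.exp (-betaQ2 q * y) * Th q y + ((rhoQ q : ℝ) - 1) * c0 q : ℝ) : ℂ) + trigS q S y)
          - (((((rhoQ q : ℝ) - 1) * c0 q : ℝ) : ℂ) + trigS q S y) := by push_cast; ring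
        rw [e1, e2]
        refine (norm_sub_le _ _).trans ?_
        have e3 := norm_add_le ((((rhoQ q : ℝ) - 1) * c0 q : ℝ) : ℂ) (trigS q S y)
        rw [Complex.norm_real, Real.norm_eq_abs] at e3
        linarith [htr y]
    _ = ENNReal.ofReal (K * Y) + ∫⁻ y in Set.Ioc 0 Y, ‖((Real.exp (-betaQ2 q * y) * Th q y + ((rhoQ q : ℝ) - 1) * c0 q : ℝ) : ℂ) + trigS q S y‖ₑ := by
        rw [lintegral_add_left measurable_const, setLIntegral_const, Real.volume_Ioc, sub_zero, ENNReal.ofReal_mul hK0]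
    _ ≤ ENNReal.ofReal (K * Y) + ENNReal.ofReal (1 * Y) := by gcongr
    _ = _ := by
        rw [← ENNReal.ofReal_add (by positivity) (by positivity)]
        congr 1; ring

def PiA (q : ℕ) (y : ℝ) : ℝ := ∑ p ∈ (Finset.Icc 1 ⌊Real.exp y⌋₊).filter Nat.Prime, aR q (p : ZMod q)

lemma PiA_measurable (q : ℕ) : Measurable (PiA q) :=
  (measurable_from_nat (f := fun n : ℕ => ∑ p ∈ (Finset.Icc 1 n).filter Nat.Prime, aR q (p : ZMod q))).comp
    (Nat.measurable_floor.comp Real.measurable_exp)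

lemma Th_zero (q : ℕ) {u : ℝ} (hu : u < Real.log 2) : Th q u = 0 := by
  unfold Th
  apply Finset.sum_eq_zero
  intro p hp
  rw [Finset.mem_filter, Finset.mem_Icc] at hp
  exfalso
  have h1 := hp.2.two_le
  have h2 : (p:ℝ) ≤ Real.exp u := (Nat.le_floor_iff (Real.exp_pos u).le).1 hp.1.2
  have h3 : Real.exp u < 2 := by
    rw [← Real.exp_log (show (0:ℝ) < 2 by norm_num)]; exact Real.exp_lt_exp.2 hu
  have h4 : (2:ℝ) ≤ p := by exact_mod_cast h1
  linarith

lemma Th_ind (q : ℕ) {u y : ℝ} (huy : u ≤ y) :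
    Th q u = ∑ p ∈ (Finset.Icc 1 ⌊Real.exp y⌋₊).filter Nat.Prime,
      if Real.log p ≤ u then aR q (p : ZMod q) * Real.log p else 0 := by
  unfold Th
  rw [← Finset.sum_filter]
  apply Finset.sum_congr _ fun _ _ => rfl
  ext p
  simp only [Finset.mem_filter, Finset.mem_Icc]
  have key : ∀ v : ℝ, 1 ≤ p → (p ≤ ⌊Real.exp v⌋₊ ↔ Real.log p ≤ v) := by
    intro v hp
    rw [Nat.le_floor_iff (Real.exp_pos v).le, Real.log_le_iff_le_exp (by exact_mod_cast hp)]
  constructor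
  · rintro ⟨⟨h1, h2⟩, h3⟩
    rw [key u h1] at h2
    exact ⟨⟨⟨h1, (key y h1).2 (h2.trans huy)⟩, h3⟩, h2⟩
  · rintro ⟨⟨⟨h1, h2⟩, h3⟩, h4⟩
    exact ⟨⟨h1, (key u h1).2 h4⟩, h3⟩

lemma int_inv_sq {l y : ℝ} (hl : 0 < l) (hly : l ≤ y) : ∫ u in l..y, 1 / u ^ 2 = 1 / l - 1 / y := by
  have : ∀ u ∈ Set.uIcc l y, HasDerivAt (fun u : ℝ => - u⁻¹) (1 / u ^ 2) u := by
    intro u hu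
    rw [Set.uIcc_of_le hly] at hu
    have hu0 : u ≠ 0 := (hl.trans_le hu.1).ne'
    have := (hasDerivAt_inv hu0).neg
    rw [neg_neg, ← one_div] at this
    exact this
  rw [intervalIntegral.integral_eq_sub_of_hasDerivAt this]
  · simp; ring
  · apply ContinuousOn.intervalIntegrable
    rw [Set.uIcc_of_le hly]
    refine continuousOn_const.div (by fun_prop) fun u hu => ?_
    have : 0 < u := hl.trans_le hu.1
    positivity

lemma part_sum (q : ℕ) {y : ℝ} (hy : 0 < y) :
    y * PiA q y - Th q y = y * ∫ u in Set.Ioc 0 y, Th q u / u ^ 2 := by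
  have h1 : ∫ u in Set.Ioc 0 y, Th q u / u ^ 2 = ∫ u in Set.Ioc 0 y,
      ∑ p ∈ (Finset.Icc 1 ⌊Real.exp y⌋₊).filter Nat.Prime,
        (Set.Ici (Real.log p)).indicator (fun u => aR q (p : ZMod q) * Real.log p * (1 / u ^ 2)) u := by
    apply setIntegral_congr_fun measurableSet_Ioc
    intro u hu
    simp only
    rw [Th_ind q hu.2, Finset.sum_div]
    apply Finset.sum_congr rfl
    intro p _
    simp only [Set.indicator, Set.mem_Ici]
    split_ifs <;> ring
  have hpp : ∀ p ∈ (Finset.Icc 1 ⌊Real.exp y⌋₊).filter Nat.Prime, 0 < Real.log p ∧ Real.log p ≤ y := by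
    intro p hp
    rw [Finset.mem_filter, Finset.mem_Icc] at hp
    have h1 := hp.2.two_le
    refine ⟨Real.log_pos (by exact_mod_cast h1), ?_⟩
    rw [Real.log_le_iff_le_exp (by exact_mod_cast hp.1.1)]
    exact (Nat.le_floor_iff (Real.exp_pos y).le).1 hp.1.2
  have hset : ∀ l, 0 < l → Set.Ioc 0 y ∩ Set.Ici l = Set.Icc l y := by
    intro l hl; ext u
    simp only [Set.mem_inter_iff, Set.mem_Ioc, Set.mem_Ici, Set.mem_Icc]
    constructor
    · rintro ⟨⟨_, a⟩, b⟩; exact ⟨b, a⟩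
    · rintro ⟨a, b⟩; exact ⟨⟨hl.trans_le a, b⟩, a⟩
  rw [h1, integral_finset_sum]
  · have h2 : ∀ p ∈ (Finset.Icc 1 ⌊Real.exp y⌋₊).filter Nat.Prime,
        ∫ u in Set.Ioc 0 y, (Set.Ici (Real.log p)).indicator (fun u => aR q (p : ZMod q) * Real.log p * (1 / u ^ 2)) u
        = aR q (p : ZMod q) - aR q (p : ZMod q) * Real.log p / y := by
      intro p hp
      obtain ⟨ha, hb⟩ := hpp p hp
      rw [setIntegral_indicator measurableSet_Ici, hset _ ha, integral_const_mul, integral_Icc_eq_integral_Ioc,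
        ← intervalIntegral.integral_of_le hb, int_inv_sq ha hb]
      field_simp
    rw [Finset.sum_congr rfl h2, Finset.sum_sub_distrib, ← Finset.sum_div]
    unfold PiA Th
    field_simp
  · intro p hp
    obtain ⟨ha, hb⟩ := hpp p hp
    rw [integrable_indicator_iff measurableSet_Ici, IntegrableOn, Measure.restrict_restrict measurableSet_Ici, Set.inter_comm, hset _ ha]
    apply ContinuousOn.integrableOn_Icc
    refine continuousOn_const.mul (continuousOn_const.div (by fun_prop) fun u hu => ?_)
    have : 0 < u := ha.trans_le hu.1
    positivity

lemma tail_int {b u Y : ℝ} (hb : 1/2 ≤ b) (hu : Real.log 2 ≤ u) :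
    ∫⁻ y in Set.Icc u Y, ENNReal.ofReal (y * Real.exp (-b * y)) ≤ ENNReal.ofReal (28 * u * Real.exp (-b * u)) := by
  have hl : (2:ℝ)/3 ≤ Real.log 2 := by have := Real.log_two_gt_d9; linarith
  have hu0 : 0 < u := by linarith
  have h1 : ∀ y ∈ Set.Icc u Y, ENNReal.ofReal (y * Real.exp (-b * y)) ≤
      ENNReal.ofReal (7 * u * Real.exp (-b * u) * Real.exp (u / 4)) * ENNReal.ofReal (Real.exp (-(1/4) * y)) := by
    intro y hy
    rw [← ENNReal.ofReal_mul (by positivity)]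
    apply ENNReal.ofReal_le_ofReal
    have e1 : y ≤ 7 * u * Real.exp ((y - u) / 4) := by
      have h2 := Real.add_one_le_exp ((y - u) / 4)
      have h3 : 0 ≤ y - u := sub_nonneg.2 hy.1
      nlinarith
    have e2 : Real.exp (-b * y) ≤ Real.exp (-b * u) * Real.exp (-(1/2) * (y - u)) := by
      rw [← Real.exp_add]
      apply Real.exp_le_exp.2
      nlinarith [hy.1]
    calc y * Real.exp (-b * y) ≤ (7 * u * Real.exp ((y - u) / 4)) * (Real.exp (-b * u) * Real.exp (-(1/2) * (y - u))) := by
          gcongr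
      _ = 7 * u * Real.exp (-b * u) * (Real.exp ((y - u) / 4) * Real.exp (-(1/2) * (y - u))) := by ring
      _ = 7 * u * Real.exp (-b * u) * (Real.exp (u / 4) * Real.exp (-(1/4) * y)) := by
          rw [← Real.exp_add, ← Real.exp_add]; congr 2; ring
      _ = _ := by ring
  refine (setLIntegral_mono' measurableSet_Icc h1).trans ?_
  rw [lintegral_const_mul _ (by fun_prop)]
  have h2 : ∫⁻ y in Set.Icc u Y, ENNReal.ofReal (Real.exp (-(1/4) * y)) ≤ ENNReal.ofReal (4 * Real.exp (-(1/4) * u)) := by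
    calc _ ≤ ∫⁻ y in Set.Ici u, ENNReal.ofReal (Real.exp (-(1/4) * y)) := lintegral_mono_set Set.Icc_subset_Ici_self
      _ = ∫⁻ y in Set.Ioi u, ENNReal.ofReal (Real.exp (-(1/4) * y)) := by
          rw [Measure.restrict_congr_set Ioi_ae_eq_Ici]
      _ = ENNReal.ofReal (∫ y in Set.Ioi u, Real.exp (-(1/4) * y)) := by
          rw [ofReal_integral_eq_lintegral_ofReal (integrableOn_exp_mul_Ioi (by norm_num) u)]
          exact Eventually.of_forall fun _ => (Real.exp_pos _).le
      _ = _ := by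
          rw [integral_exp_mul_Ioi (by norm_num)]; congr 1; ring
  refine (mul_le_mul_right h2 _).trans ?_
  rw [← ENNReal.ofReal_mul (by positivity)]
  apply ENNReal.ofReal_le_ofReal
  have : Real.exp (u / 4) * Real.exp (-(1/4) * u) = 1 := by rw [← Real.exp_add]; simp; ring
  apply le_of_eq
  linear_combination (28 * u * Real.exp (-b * u)) * this

lemma tonelli_bound (q : ℕ) [NeZero q] (hq : 3 ≤ q) (Y : ℝ) :
    ∫⁻ y in Set.Ioc 0 Y, ‖Real.exp (-betaQ2 q * y) * (y * PiA q y - Th q y)‖ₑ ≤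
      ENNReal.ofReal 28 * ∫⁻ u in Set.Ioc 0 Y, ENNReal.ofReal (Real.exp (-betaQ2 q * u) * |Th q u|) * ENNReal.ofReal (1 / u) := by
  set b := betaQ2 q with hbd
  have hb : 1/2 ≤ b := half_le_beta q hq
  have hTm := Th_measurable q
  set G : ℝ → ℝ → ENNReal := fun y u => (Set.Ici u).indicator (fun y => ENNReal.ofReal (y * Real.exp (-b * y)) * ‖Th q u / u ^ 2‖ₑ) y with hG
  have hGm : Measurable (Function.uncurry G) := by
    have : Function.uncurry G = Set.indicator {z : ℝ × ℝ | z.2 ≤ z.1}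
        (fun z => ENNReal.ofReal (z.1 * Real.exp (-b * z.1)) * ‖Th q z.2 / z.2 ^ 2‖ₑ) := by
      ext z; simp [G, Function.uncurry, Set.indicator]
    rw [this]
    refine Measurable.indicator ?_ (measurableSet_le measurable_snd measurable_fst)
    have : Measurable fun z : ℝ × ℝ => Th q z.2 := hTm.comp measurable_snd
    fun_prop
  calc _ ≤ ∫⁻ y in Set.Ioc 0 Y, ∫⁻ u in Set.Ioc 0 Y, G y u := by
        apply setLIntegral_mono' measurableSet_Ioc
        intro y hy
        rw [part_sum q hy.1, ← mul_assoc, enorm_mul]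
        calc _ ≤ ‖Real.exp (-b * y) * y‖ₑ * ∫⁻ u in Set.Ioc 0 y, ‖Th q u / u ^ 2‖ₑ := by
              gcongr; exact enorm_integral_le_lintegral_enorm _
          _ = ∫⁻ u in Set.Ioc 0 y, ‖Real.exp (-b * y) * y‖ₑ * ‖Th q u / u ^ 2‖ₑ := by
              rw [lintegral_const_mul _ (by fun_prop)]
          _ = ∫⁻ u in Set.Ioc 0 y, G y u := by
              apply setLIntegral_congr_fun measurableSet_Ioc
              intro u hu
              simp only [G]
              rw [Set.indicator_of_mem (by exact hu.2), Real.enorm_of_nonneg (mul_nonneg (Real.exp_pos _).le hy.1.le), mul_comm y]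
          _ ≤ _ := lintegral_mono_set (Set.Ioc_subset_Ioc_right hy.2)
    _ = ∫⁻ u in Set.Ioc 0 Y, ∫⁻ y in Set.Ioc 0 Y, G y u := lintegral_lintegral_swap hGm.aemeasurable
    _ ≤ ∫⁻ u in Set.Ioc 0 Y, ENNReal.ofReal 28 * (ENNReal.ofReal (Real.exp (-b * u) * |Th q u|) * ENNReal.ofReal (1 / u)) := by
        apply setLIntegral_mono' measurableSet_Ioc
        intro u hu
        by_cases hu2 : u < Real.log 2
        · simp only [G, Th_zero q hu2]; simp
        push Not at hu2
        simp only [G]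
        rw [lintegral_indicator measurableSet_Ici, Measure.restrict_restrict measurableSet_Ici]
        have hs : Set.Ici u ∩ Set.Ioc 0 Y ⊆ Set.Icc u Y := fun y hy => ⟨hy.1, hy.2.2⟩
        refine (lintegral_mono_set hs).trans ?_
        rw [lintegral_mul_const _ (by fun_prop)]
        refine (mul_le_mul_left (tail_int hb hu2) _).trans ?_
        have hu0 := hu.1
        rw [← ofReal_norm_eq_enorm, ← ENNReal.ofReal_mul (by positivity), ← ENNReal.ofReal_mul (by positivity),
          ← ENNReal.ofReal_mul (by positivity)]
        apply ENNReal.ofReal_le_ofReal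
        rw [norm_div, Real.norm_eq_abs, Real.norm_of_nonneg (by positivity : (0:ℝ) ≤ u ^ 2)]
        apply le_of_eq
        field_simp
    _ = _ := by rw [lintegral_const_mul _ (by fun_prop)]

lemma PiA_MS (q : ℕ) [NeZero q] (hq : 3 ≤ q) :
    MS (fun y => ‖Real.exp (-betaQ2 q * y) * (y * PiA q y - Th q y)‖ₑ) := by
  obtain ⟨B, hB, hBY⟩ := Th_bdd q hq
  have hTm := Th_measurable q
  set W : ℝ → ENNReal := fun u => ENNReal.ofReal (Real.exp (-betaQ2 q * u) * |Th q u|) with hW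
  have hWm : Measurable W := by
    have : Measurable fun u => |Th q u| := hTm.abs
    fun_prop
  have hl : (2:ℝ)/3 ≤ Real.log 2 := by have := Real.log_two_gt_d9; linarith
  intro ε hε
  set M : ℝ := 1 + 56 * B / ε with hM
  have hM0 : 0 < M := by positivity
  obtain ⟨Y0, hY0, hY0M, hY00⟩ := (hBY.and ((eventually_ge_atTop M).and (eventually_ge_atTop 0))).exists
  filter_upwards [hBY, eventually_ge_atTop (112 * (B * Y0) / ε), eventually_ge_atTop 0] with Y h1 h2 h3
  refine (tonelli_bound q hq Y).trans ?_
  have hpt : ∀ u ∈ Set.Ioc 0 Y, W u * ENNReal.ofReal (1 / u) ≤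
      ENNReal.ofReal 2 * (Set.Ioc 0 Y0).indicator W u + ENNReal.ofReal (1 / M) * W u := by
    intro u hu
    by_cases hu2 : u < Real.log 2
    · simp [W, Th_zero q hu2]
    push Not at hu2
    by_cases huY : u ≤ Y0
    · rw [Set.indicator_of_mem (by exact ⟨hu.1, huY⟩), mul_comm]
      refine le_add_right ?_
      gcongr
      rw [div_le_iff₀ hu.1]; linarith
    · push Not at huY
      refine le_add_left ?_
      rw [mul_comm]
      gcongr
      linarith
  calc _ ≤ ENNReal.ofReal 28 * ∫⁻ u in Set.Ioc 0 Y, (ENNReal.ofReal 2 * (Set.Ioc 0 Y0).indicator W u + ENNReal.ofReal (1 / M) * W u) :=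
        mul_le_mul_right (setLIntegral_mono' measurableSet_Ioc hpt) _
    _ = ENNReal.ofReal 28 * (ENNReal.ofReal 2 * (∫⁻ u in Set.Ioc 0 Y, (Set.Ioc 0 Y0).indicator W u)
          + ENNReal.ofReal (1 / M) * ∫⁻ u in Set.Ioc 0 Y, W u) := by
        have hi : Measurable ((Set.Ioc 0 Y0).indicator W) := hWm.indicator measurableSet_Ioc
        rw [lintegral_add_left (by fun_prop), lintegral_const_mul _ hi, lintegral_const_mul _ hWm]
    _ ≤ ENNReal.ofReal 28 * (ENNReal.ofReal 2 * ENNReal.ofReal (B * Y0) + ENNReal.ofReal (1 / M) * ENNReal.ofReal (B * Y)) := by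
        gcongr
        refine le_trans ?_ hY0
        rw [lintegral_indicator measurableSet_Ioc, Measure.restrict_restrict measurableSet_Ioc]
        exact lintegral_mono_set Set.inter_subset_left
    _ = ENNReal.ofReal (28 * (2 * (B * Y0) + 1 / M * (B * Y))) := by
        rw [← ENNReal.ofReal_mul (by positivity), ← ENNReal.ofReal_mul (by positivity), ← ENNReal.ofReal_add (by positivity) (by positivity),
          ← ENNReal.ofReal_mul (by positivity)]
    _ ≤ _ := by
        apply ENNReal.ofReal_le_ofReal
        have a1 : 56 * (B * Y0) ≤ ε * Y / 2 := by
          rw [div_le_iff₀ hε] at h2; linarith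
        have a2 : 1 / M * (28 * B) ≤ ε / 2 := by
          rw [one_div, inv_mul_le_iff₀ hM0, hM]
          have : 56 * B / ε * ε = 56 * B := by field_simp
          nlinarith
        nlinarith [mul_le_mul_of_nonneg_right a2 h3]

lemma Ernr_exp (q : ℕ) [NeZero q] (y : ℝ) :
    Ernr q (Real.exp y) = (1 / (rhoQ q : ℝ)) * (Real.exp (-betaQ2 q * y) * (y * PiA q y)) := by
  unfold Ernr
  rw [race_eq, Real.log_exp, ← Real.exp_mul]
  have : Real.exp (-betaQ2 q * y) = (Real.exp (y * betaQ2 q))⁻¹ := by rw [← Real.exp_neg]; congr 1; ring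
  rw [this]
  unfold PiA
  field_simp

lemma Ernr_measurable (q : ℕ) [NeZero q] : Measurable fun y => Ernr q (Real.exp y) := by
  simp only [Ernr_exp]
  have := PiA_measurable q
  fun_prop

lemma Ernr_approx (q : ℕ) [NeZero q] (hq : 3 ≤ q) {ε : ℝ} (hε : 0 < ε) :
    ∃ S : Finset ℂ, (∀ ρ ∈ S, LX q ρ = 0 ∧ ρ.re = betaQ2 q) ∧ ∀ᶠ Y : ℝ in atTop,
      ∫⁻ y in Set.Ioc 0 Y, ‖Ernr q (Real.exp y) - ((1 - (rhoQ q : ℝ)) / rhoQ q * c0 q - (1 / (rhoQ q : ℝ)) * (trigS q S y).re)‖ₑ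
        ≤ ENNReal.ofReal (ε * Y) := by
  obtain ⟨S, hS, h⟩ := Th_mean q hq (half_pos hε)
  refine ⟨S, hS, ?_⟩
  have hρ : (2:ℝ) ≤ rhoQ q := by exact_mod_cast rho_ge_two hq
  filter_upwards [h, PiA_MS q hq _ (half_pos hε), eventually_ge_atTop 0] with Y h1 h2 h3
  have hPm := PiA_measurable q
  have hTm := Th_measurable q
  calc _ ≤ ∫⁻ y in Set.Ioc 0 Y, (‖Real.exp (-betaQ2 q * y) * (y * PiA q y - Th q y)‖ₑ +
        ‖((Real.exp (-betaQ2 q * y) * Th q y + ((rhoQ q : ℝ) - 1) * c0 q : ℝ) : ℂ) + trigS q S y‖ₑ) := by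
        apply lintegral_mono
        intro y
        simp only
        rw [← ofReal_norm_eq_enorm, ← ofReal_norm_eq_enorm, ← ofReal_norm_eq_enorm, ← ENNReal.ofReal_add (by positivity) (by positivity)]
        apply ENNReal.ofReal_le_ofReal
        have e1 : Ernr q (Real.exp y) - ((1 - (rhoQ q : ℝ)) / rhoQ q * c0 q - (1 / (rhoQ q : ℝ)) * (trigS q S y).re)
          = (1 / (rhoQ q : ℝ)) * (Real.exp (-betaQ2 q * y) * (y * PiA q y - Th q y) +
            (((Real.exp (-betaQ2 q * y) * Th q y + ((rhoQ q : ℝ) - 1) * c0 q : ℝ) : ℂ) + trigS q S y).re) := by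
          rw [Ernr_exp, Complex.add_re, Complex.ofReal_re]
          field_simp; ring
        rw [e1, norm_mul, Real.norm_of_nonneg (by positivity : (0:ℝ) ≤ 1 / (rhoQ q : ℝ))]
        have e2 : 1 / (rhoQ q : ℝ) ≤ 1 := by rw [div_le_one (by linarith)]; linarith
        refine (mul_le_of_le_one_left (norm_nonneg _) e2).trans ?_
        refine (norm_add_le _ _).trans ?_
        gcongr
        exact Complex.abs_re_le_norm _
    _ ≤ ENNReal.ofReal (ε / 2 * Y) + ENNReal.ofReal (ε / 2 * Y) := by
        rw [lintegral_add_left (by fun_prop)]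
        gcongr
    _ = _ := by rw [← ENNReal.ofReal_add (by positivity) (by positivity)]; congr 1; ring

def HM (f : ℝ → ℂ) (m : ℂ) : Prop :=
  Tendsto (fun Y : ℝ => ((1 / Y : ℝ) : ℂ) * ∫ y in (0:ℝ)..Y, f y) atTop (𝓝 m)

lemma HM.add {f g : ℝ → ℂ} {m n : ℂ} (hf : HM f m) (hg : HM g n) (hfc : Continuous f) (hgc : Continuous g) :
    HM (f + g) (m + n) := by
  refine (Tendsto.add hf hg).congr fun Y => ?_
  simp only [Pi.add_apply]
  rw [intervalIntegral.integral_add (hfc.intervalIntegrable _ _) (hgc.intervalIntegrable _ _)]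
  ring

lemma HM.smul {f : ℝ → ℂ} {m : ℂ} (hf : HM f m) (c : ℂ) : HM (c • f) (c * m) := by
  refine (Tendsto.const_mul c hf).congr fun Y => ?_
  simp only [Pi.smul_apply, smul_eq_mul]
  rw [intervalIntegral.integral_const_mul]
  ring

lemma HM_const (c : ℂ) : HM (fun _ => c) c := by
  refine tendsto_const_nhds.congr' ?_
  filter_upwards [eventually_gt_atTop 0] with Y hY
  rw [intervalIntegral.integral_const]
  have : (Y:ℂ) ≠ 0 := by exact_mod_cast hY.ne'
  simp
  field_simp

lemma HM_exp {l : ℝ} (hl : l ≠ 0) : HM (fun y : ℝ => cexp (l * I * y)) 0 := by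
  have hl' : (l * I : ℂ) ≠ 0 := mul_ne_zero (by exact_mod_cast hl) I_ne_zero
  unfold HM
  rw [tendsto_zero_iff_norm_tendsto_zero]
  have h1 : Tendsto (fun Y : ℝ => Y⁻¹ * (2 / |l|)) atTop (𝓝 0) := by
    simpa using tendsto_inv_atTop_zero.mul_const (2 / |l|)
  refine squeeze_zero' (Eventually.of_forall fun _ => norm_nonneg _) ?_ h1
  filter_upwards [eventually_gt_atTop 0] with Y hY
  rw [integral_exp_mul_complex hl', norm_mul, norm_div, Complex.norm_real, Real.norm_of_nonneg (by positivity), one_div]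
  gcongr
  · refine (norm_sub_le _ _).trans ?_
    have : ∀ t : ℝ, ‖cexp (l * I * t)‖ = 1 := by
      intro t
      rw [show (l * I * t : ℂ) = ((l * t : ℝ) : ℂ) * I by push_cast; ring, Complex.norm_exp_ofReal_mul_I]
    rw [this, this]; norm_num
  · simp

def eHom : Multiplicative ℝ →* (ℝ → ℂ) where
  toFun l := fun y => cexp (l.toAdd * I * y)
  map_one' := by ext y; simp
  map_mul' a b := by ext y; simp [add_mul, Complex.exp_add]

/-- The algebra of trigonometric polynomials. -/
def TP : Subalgebra ℂ (ℝ → ℂ) := Algebra.adjoin ℂ (Set.range eHom)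

lemma exp_mem_TP (l : ℝ) : (fun y : ℝ => cexp (l * I * y)) ∈ TP :=
  Algebra.subset_adjoin ⟨Multiplicative.ofAdd l, rfl⟩

lemma TP_prop {f : ℝ → ℂ} (hf : f ∈ TP) : Continuous f ∧ (∃ m, HM f m) ∧ ∃ R, ∀ y, ‖f y‖ ≤ R := by
  have h1 : f ∈ Submodule.span ℂ (Set.range eHom) := by
    have h2 : Subalgebra.toSubmodule TP = Submodule.span ℂ (Submonoid.closure (Set.range eHom)) := Algebra.adjoin_eq_span _ _
    have h3 : (Submonoid.closure (Set.range eHom) : Set (ℝ → ℂ)) = Set.range eHom := by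
      have : Set.range eHom = (MonoidHom.mrange eHom : Set (ℝ → ℂ)) := rfl
      rw [this, Submonoid.closure_eq]
    rw [h3] at h2
    rw [← h2]; exact hf
  induction h1 using Submodule.span_induction with
  | mem x hx =>
    obtain ⟨l, rfl⟩ := hx
    have hc : Continuous (fun y : ℝ => cexp (l.toAdd * I * y)) := by fun_prop
    refine ⟨hc, ?_, 1, ?_⟩
    · by_cases hl : l.toAdd = 0
      · refine ⟨1, ?_⟩
        have : (eHom l) = fun _ => (1:ℂ) := by ext y; simp [eHom, hl]
        rw [this]; exact HM_const 1
      · exact ⟨0, HM_exp hl⟩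
    · intro y
      change ‖cexp (l.toAdd * I * y)‖ ≤ 1
      rw [show (l.toAdd * I * y : ℂ) = ((l.toAdd * y : ℝ) : ℂ) * I by push_cast; ring, Complex.norm_exp_ofReal_mul_I]
  | zero => exact ⟨continuous_const, ⟨0, HM_const 0⟩, 0, fun y => by simp⟩
  | add x y hx hy h1 h2 =>
    have hx' : x ∈ TP := by
      have := Algebra.span_le_adjoin ℂ (Set.range eHom) hx; exact this
    have hy' : y ∈ TP := by
      have := Algebra.span_le_adjoin ℂ (Set.range eHom) hy; exact this
    obtain ⟨a1, ⟨m, a2⟩, R, a3⟩ := h1 hx'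
    obtain ⟨b1, ⟨n, b2⟩, R', b3⟩ := h2 hy'
    exact ⟨a1.add b1, ⟨m + n, a2.add b2 a1 b1⟩, R + R', fun t => (norm_add_le _ _).trans (add_le_add (a3 t) (b3 t))⟩
  | smul c x hx h1 =>
    have hx' : x ∈ TP := by
      have := Algebra.span_le_adjoin ℂ (Set.range eHom) hx; exact this
    obtain ⟨a1, ⟨m, a2⟩, R, a3⟩ := h1 hx'
    refine ⟨a1.const_smul c, ⟨c * m, a2.smul c⟩, ‖c‖ * R, fun t => ?_⟩
    simp only [Pi.smul_apply, smul_eq_mul, norm_mul]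
    gcongr; exact a3 t

lemma exists_lim_of_approx {A : ℝ → ℝ} (h : ∀ ε > 0, ∃ B : ℝ → ℝ, (∃ m, Tendsto B atTop (𝓝 m)) ∧
    ∀ᶠ Y in atTop, |A Y - B Y| ≤ ε) : ∃ m, Tendsto A atTop (𝓝 m) := by
  apply cauchy_map_iff_exists_tendsto.1
  rw [Metric.cauchy_iff]
  refine ⟨inferInstance, fun ε hε => ?_⟩
  obtain ⟨B, ⟨m, hm⟩, hB⟩ := h (ε / 8) (by positivity)
  have h2 := (Metric.tendsto_nhds.1 hm (ε / 8) (by positivity)).and hB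
  refine ⟨A '' {Y | dist (B Y) m < ε / 8 ∧ |A Y - B Y| ≤ ε / 8}, image_mem_map h2, ?_⟩
  rintro _ ⟨x, ⟨hx1, hx2⟩, rfl⟩ _ ⟨y, ⟨hy1, hy2⟩, rfl⟩
  rw [Real.dist_eq] at *
  rw [abs_lt] at *
  rw [abs_le] at *
  constructor <;> linarith

/-- Cesaro mean. -/
def CM (f : ℝ → ℝ) (Y : ℝ) : ℝ := (1 / Y) * ∫ y in (0:ℝ)..Y, f y

lemma CM_close {f g : ℝ → ℝ} (hf : ∀ a b, IntervalIntegrable f volume a b) (hg : ∀ a b, IntervalIntegrable g volume a b)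
    {Y K e : ℝ} (hY : 0 < Y) (hK : 0 ≤ K) (he : 0 ≤ e) {d : ℝ → ℝ} (hd : ∀ y, |f y - g y| ≤ K * |d y|)
    (h : ∫⁻ y in Set.Ioc 0 Y, ‖d y‖ₑ ≤ ENNReal.ofReal (e * Y)) : |CM f Y - CM g Y| ≤ K * e := by
  have h1 : CM f Y - CM g Y = (1 / Y) * ∫ y in (0:ℝ)..Y, (f y - g y) := by
    rw [intervalIntegral.integral_sub (hf _ _) (hg _ _)]; unfold CM; ring
  have h2 : ‖∫ y in (0:ℝ)..Y, (f y - g y)‖ ≤ K * (e * Y) := by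
    rw [intervalIntegral.integral_of_le hY.le]
    refine (norm_integral_le_lintegral_norm _).trans ?_
    apply ENNReal.toReal_le_of_le_ofReal (by positivity)
    calc _ ≤ ∫⁻ y in Set.Ioc 0 Y, ENNReal.ofReal K * ‖d y‖ₑ := by
          apply lintegral_mono
          intro y
          simp only
          rw [← ofReal_norm_eq_enorm, ← ENNReal.ofReal_mul hK]
          exact ENNReal.ofReal_le_ofReal (hd y)
      _ = ENNReal.ofReal K * ∫⁻ y in Set.Ioc 0 Y, ‖d y‖ₑ := lintegral_const_mul' _ _ ENNReal.ofReal_ne_top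
      _ ≤ ENNReal.ofReal K * ENNReal.ofReal (e * Y) := by gcongr
      _ = _ := by rw [← ENNReal.ofReal_mul hK]
  rw [h1, abs_mul, abs_of_pos (by positivity : 0 < 1 / Y)]
  calc 1 / Y * |∫ y in (0:ℝ)..Y, (f y - g y)| ≤ 1 / Y * (K * (e * Y)) := by gcongr; exact h2
    _ = _ := by field_simp

lemma poly_mem_TP {Q : ℝ → ℝ} (hQ : (fun y => (Q y : ℂ)) ∈ TP) (p : Polynomial ℝ) :
    (fun y => ((p.eval (Q y) : ℝ) : ℂ)) ∈ TP := by
  induction p using Polynomial.induction_on' with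
  | add p r hp hr => 
    have := TP.add_mem hp hr
    convert this using 1
    ext y; simp
  | monomial n a =>
    have := TP.smul_mem (TP.pow_mem hQ n) (a : ℂ)
    convert this using 1
    ext y; simp

lemma TP_real_mean {Q : ℝ → ℝ} (hQ : (fun y => (Q y : ℂ)) ∈ TP) : Continuous Q ∧ ∃ m, Tendsto (CM Q) atTop (𝓝 m) := by
  obtain ⟨h1, ⟨m, h2⟩, -⟩ := TP_prop hQ
  refine ⟨Complex.continuous_re.comp h1, m.re, ?_⟩
  refine ((Complex.continuous_re.tendsto _).comp h2).congr fun Y => ?_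
  simp only [Function.comp, CM]
  rw [intervalIntegral.integral_ofReal, ← Complex.ofReal_mul, Complex.ofReal_re]

lemma TP_comp_mean {Q : ℝ → ℝ} (hQ : (fun y => (Q y : ℂ)) ∈ TP) {g : ℝ → ℝ} (hg : Continuous g) :
    ∃ m, Tendsto (CM (fun y => g (Q y))) atTop (𝓝 m) := by
  obtain ⟨h1, -, R, hR⟩ := TP_prop hQ
  have hQc := (TP_real_mean hQ).1
  apply exists_lim_of_approx
  intro ε hε
  obtain ⟨p, hp⟩ := exists_polynomial_near_of_continuousOn (-R) R g hg.continuousOn ε hε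
  refine ⟨CM (fun y => p.eval (Q y)), (TP_real_mean (poly_mem_TP hQ p)).2, ?_⟩
  filter_upwards [eventually_gt_atTop 0] with Y hY
  have hpc : Continuous fun y => p.eval (Q y) := p.continuous.comp hQc
  have := CM_close (f := fun y => g (Q y)) (g := fun y => p.eval (Q y)) (d := fun _ => ε) (K := 1) (e := ε)
    (fun a b => (hg.comp hQc).intervalIntegrable a b) (fun a b => hpc.intervalIntegrable a b) hY zero_le_one hε.le ?_ ?_
  · linarith
  · intro y
    have hy := hR y
    rw [Complex.norm_real, Real.norm_eq_abs, abs_le] at hy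
    have := hp (Q y) hy
    rw [abs_sub_comm, one_mul, abs_of_pos hε]; exact this.le
  · simp [hY.le, Real.enorm_of_nonneg hε.le, ENNReal.ofReal_mul hε.le]

def TPapprox (F : ℝ → ℝ) : Prop := ∀ ε : ℝ, 0 < ε → ∃ Q : ℝ → ℝ, (fun y => (Q y : ℂ)) ∈ TP ∧
  ∀ᶠ Y : ℝ in atTop, ∫⁻ y in Set.Ioc 0 Y, ‖F y - Q y‖ₑ ≤ ENNReal.ofReal (ε * Y)

lemma int_of_bdd {f : ℝ → ℝ} (hf : Measurable f) {B : ℝ} (hB : ∀ x, |f x| ≤ B) (a b : ℝ) :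
    IntervalIntegrable f volume a b := by
  rw [intervalIntegrable_iff]
  exact Measure.integrableOn_of_bounded (M := B) (by simp [Set.uIoc]) hf.aestronglyMeasurable
    (Eventually.of_forall hB)

lemma TPapprox.mean {F : ℝ → ℝ} (hF : TPapprox F) (hFm : Measurable F) {g : ℝ → ℝ} {C : NNReal} (hg : LipschitzWith C g)
    {B : ℝ} (hB : ∀ x, |g x| ≤ B) : ∃ m, Tendsto (CM (fun y => g (F y))) atTop (𝓝 m) := by
  apply exists_lim_of_approx
  intro ε hε
  obtain ⟨Q, hQ, h⟩ := hF (ε / (C + 1)) (by positivity)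
  refine ⟨CM (fun y => g (Q y)), TP_comp_mean hQ hg.continuous, ?_⟩
  have hQc := (TP_real_mean hQ).1
  filter_upwards [h, eventually_gt_atTop 0] with Y h1 hY
  refine (CM_close (int_of_bdd (hg.continuous.measurable.comp hFm) fun x => hB _)
    (fun a b => (hg.continuous.comp hQc).intervalIntegrable a b) hY C.2 (by positivity)
    (fun y => ?_) h1).trans ?_
  · have := hg.dist_le_mul (F y) (Q y)
    rw [Real.dist_eq, Real.dist_eq] at this
    exact this
  · change (C:ℝ) * (ε / (C + 1)) ≤ ε
    rw [mul_div_assoc', div_le_iff₀ (by positivity)]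
    nlinarith [C.2]

lemma TPapprox.bdd {F : ℝ → ℝ} (hF : TPapprox F) : ∃ B, 0 ≤ B ∧ ∀ᶠ Y : ℝ in atTop,
    ∫⁻ y in Set.Ioc 0 Y, ‖F y‖ₑ ≤ ENNReal.ofReal (B * Y) := by
  obtain ⟨Q, hQ, h⟩ := hF 1 one_pos
  obtain ⟨h1, -, R, hR⟩ := TP_prop hQ
  have hR0 : 0 ≤ R := (norm_nonneg _).trans (hR 0)
  refine ⟨1 + R, by positivity, ?_⟩
  filter_upwards [h, eventually_gt_atTop 0] with Y h1 hY
  calc _ ≤ ∫⁻ y in Set.Ioc 0 Y, (‖F y - Q y‖ₑ + ENNReal.ofReal R) := by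
        apply lintegral_mono
        intro y
        simp only
        rw [← ofReal_norm_eq_enorm, ← ofReal_norm_eq_enorm, ← ENNReal.ofReal_add (norm_nonneg _) hR0]
        apply ENNReal.ofReal_le_ofReal
        have h2 := hR y
        rw [Complex.norm_real] at h2
        have := norm_add_le (F y - Q y) (Q y)
        rw [sub_add_cancel] at this
        linarith
    _ = (∫⁻ y in Set.Ioc 0 Y, ‖F y - Q y‖ₑ) + ENNReal.ofReal (R * Y) := by
        rw [lintegral_add_right _ measurable_const]
        simp [ENNReal.ofReal_mul hR0]
    _ ≤ ENNReal.ofReal (1 * Y) + ENNReal.ofReal (R * Y) := by gcongr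
    _ = _ := by rw [← ENNReal.ofReal_add (by positivity) (by positivity)]; congr 1; ring

/-- empirical law of `F` on `(0, max Y 1]`. -/
def nuM (F : ℝ → ℝ) (Y : ℝ) : Measure ℝ :=
  Measure.map F (ENNReal.ofReal (1 / max Y 1) • volume.restrict (Set.Ioc 0 (max Y 1)))

lemma nuM_prob {F : ℝ → ℝ} (hFm : Measurable F) (Y : ℝ) : IsProbabilityMeasure (nuM F Y) := by
  have h0 : 0 < max Y 1 := lt_max_of_lt_right one_pos
  have : IsProbabilityMeasure (ENNReal.ofReal (1 / max Y 1) • volume.restrict (Set.Ioc 0 (max Y 1))) := by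
    constructor
    simp only [Measure.smul_apply, Measure.restrict_apply_univ, Real.volume_Ioc, smul_eq_mul, sub_zero]
    rw [← ENNReal.ofReal_mul (by positivity), one_div, inv_mul_cancel₀ h0.ne', ENNReal.ofReal_one]
  exact Measure.isProbabilityMeasure_map hFm.aemeasurable

lemma nuM_integral {F : ℝ → ℝ} (hFm : Measurable F) {Y : ℝ} (hY : 1 ≤ Y) {g : ℝ → ℝ} (hg : Continuous g) :
    ∫ t, g t ∂(nuM F Y) = CM (fun y => g (F y)) Y := by
  unfold nuM CM
  rw [integral_map hFm.aemeasurable hg.aestronglyMeasurable, integral_smul_measure, max_eq_left hY,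
    intervalIntegral.integral_of_le (by linarith), ENNReal.toReal_ofReal (by positivity), smul_eq_mul]

lemma nuM_lint {F : ℝ → ℝ} (hFm : Measurable F) {Y : ℝ} (hY : 1 ≤ Y) {B : ℝ} (hB : 0 ≤ B)
    (h : ∫⁻ y in Set.Ioc 0 Y, ‖F y‖ₑ ≤ ENNReal.ofReal (B * Y)) : ∫⁻ t, ‖t‖ₑ ∂(nuM F Y) ≤ ENNReal.ofReal B := by
  unfold nuM
  rw [lintegral_map (by fun_prop) hFm, lintegral_smul_measure, max_eq_left hY, smul_eq_mul]
  calc _ ≤ ENNReal.ofReal (1 / Y) * ENNReal.ofReal (B * Y) := by gcongr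
    _ = _ := by
      rw [← ENNReal.ofReal_mul (by positivity)]; congr 1; field_simp

lemma TPapprox.exists_measure {F : ℝ → ℝ} (hF : TPapprox F) (hFm : Measurable F) :
    ∃ μ : Measure ℝ, IsProbabilityMeasure μ ∧ ∀ g : ℝ → ℝ, (∃ C, LipschitzWith C g) → (∃ B, ∀ x, |g x| ≤ B) →
      Tendsto (CM (fun y => g (F y))) atTop (𝓝 (∫ t, g t ∂μ)) := by
  obtain ⟨B, hB, hBY⟩ := hF.bdd
  obtain ⟨Y0, hY0⟩ := eventually_atTop.1 (hBY.and (eventually_ge_atTop 1))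
  let nu : ℝ → ProbabilityMeasure ℝ := fun Y => ⟨nuM F Y, nuM_prob hFm Y⟩
  have htight : IsTightMeasureSet {((μ : ProbabilityMeasure ℝ) : Measure ℝ) | μ ∈ nu '' Set.Ici Y0} := by
    apply isTightMeasureSet_of_tendsto_measure_norm_gt
    have hlim : Tendsto (fun r : ℝ => ENNReal.ofReal (B * r⁻¹)) atTop (𝓝 0) := by
      have := ENNReal.tendsto_ofReal (tendsto_inv_atTop_zero.const_mul B)
      simpa using this
    refine tendsto_of_tendsto_of_tendsto_of_le_of_le' tendsto_const_nhds hlim (Eventually.of_forall fun _ => zero_le) ?_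
    filter_upwards [eventually_gt_atTop 0] with r hr
    refine iSup₂_le ?_
    rintro _ ⟨_, ⟨Y, hY, rfl⟩, rfl⟩
    obtain ⟨h1, h2⟩ := hY0 Y hY
    have h3 := nuM_lint hFm h2 hB h1
    have h4 : ENNReal.ofReal r * (nuM F Y) {x | ENNReal.ofReal r ≤ ‖x‖ₑ} ≤ ∫⁻ t, ‖t‖ₑ ∂(nuM F Y) :=
      mul_meas_ge_le_lintegral (by fun_prop) _
    have h5 : (nuM F Y) {x | r < ‖x‖} ≤ (nuM F Y) {x | ENNReal.ofReal r ≤ ‖x‖ₑ} := by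
      apply measure_mono
      intro x hx
      simp only [Set.mem_setOf_eq] at *
      rw [← ofReal_norm_eq_enorm]
      exact ENNReal.ofReal_le_ofReal hx.le
    change (nuM F Y) {x | r < ‖x‖} ≤ _
    have hr0 : ENNReal.ofReal r ≠ 0 := by simpa using hr
    rw [ENNReal.ofReal_mul hB, ENNReal.ofReal_inv_of_pos hr, ← div_eq_mul_inv,
      ENNReal.le_div_iff_mul_le (Or.inl hr0) (Or.inl ENNReal.ofReal_ne_top), mul_comm]
    calc _ ≤ _ := mul_le_mul_right h5 _
      _ ≤ _ := h4.trans h3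
  have hcomp := isCompact_closure_of_isTightMeasureSet htight
  let U : Ultrafilter ℝ := Ultrafilter.of atTop
  have hU : (U : Filter ℝ) ≤ atTop := Ultrafilter.of_le _
  obtain ⟨μ, -, hμ⟩ := hcomp.ultrafilter_le_nhds (U.map nu) (by
    rw [le_principal_iff]
    have : nu ⁻¹' (closure (nu '' Set.Ici Y0)) ∈ (U : Filter ℝ) := by
      apply hU
      filter_upwards [eventually_ge_atTop Y0] with Y hY
      exact subset_closure ⟨Y, hY, rfl⟩
    exact this)
  have hμ' : Tendsto nu U (𝓝 μ) := hμ
  rw [ProbabilityMeasure.tendsto_iff_forall_integral_tendsto] at hμ'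
  refine ⟨μ, μ.2, ?_⟩
  rintro g ⟨C, hC⟩ ⟨D, hD⟩
  obtain ⟨m, hm⟩ := hF.mean hFm hC hD
  have h1 := hμ' (BoundedContinuousFunction.ofNormedAddCommGroup g hC.continuous D hD)
  have h2 : Tendsto (fun Y => ∫ t, g t ∂(nuM F Y)) U (𝓝 m) := by
    refine (hm.mono_left hU).congr' ?_
    apply hU
    filter_upwards [eventually_ge_atTop 1] with Y hY
    exact (nuM_integral hFm hY hC.continuous).symm
  have h3 : m = ∫ t, g t ∂(μ : Measure ℝ) := tendsto_nhds_unique h2 h1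
  rw [← h3]; exact hm

/-- truncation. -/
def clampM (M t : ℝ) : ℝ := max (-M) (min t M)

lemma clampM_lip (M : ℝ) : LipschitzWith 1 (clampM M) := by
  unfold clampM
  exact (LipschitzWith.id.min_const M).const_max (-M)

lemma clampM_abs {M : ℝ} (hM : 0 ≤ M) (t : ℝ) : |clampM M t| ≤ M := by
  unfold clampM
  rw [abs_le]
  exact ⟨le_max_left _ _, max_le (by linarith) (min_le_right _ _)⟩

lemma clampM_abs' {M : ℝ} (hM : 0 ≤ M) (t : ℝ) : |clampM M t| ≤ |t| := by
  unfold clampM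
  rw [abs_le]
  have h1 := neg_abs_le t
  have h2 := le_abs_self t
  have h3 := abs_nonneg t
  refine ⟨?_, max_le (by linarith) ((min_le_left _ _).trans h2)⟩
  rcases le_total t M with h | h
  · rw [min_eq_left h]; exact h1.trans (le_max_right _ _)
  · rw [min_eq_right h]; exact le_trans (by linarith) (le_max_right _ _)

lemma clampM_eq {M t : ℝ} (h : |t| ≤ M) : clampM M t = t := by
  rw [abs_le] at h
  unfold clampM
  rw [min_eq_left h.2, max_eq_right h.1]

lemma clampM_tendsto (t : ℝ) : Tendsto (fun n : ℕ => clampM n t) atTop (𝓝 t) := by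
  refine tendsto_const_nhds.congr' ?_
  obtain ⟨N, hN⟩ := exists_nat_ge |t|
  filter_upwards [eventually_ge_atTop N] with n hn
  exact (clampM_eq (hN.trans (by exact_mod_cast hn))).symm

lemma TPapprox.mean_eq {F : ℝ → ℝ} (hFm : Measurable F) {μ : Measure ℝ} [IsProbabilityMeasure μ] {m : ℝ}
    (hF : ∀ ε : ℝ, 0 < ε → ∃ Q : ℝ → ℝ, (fun y => (Q y : ℂ)) ∈ TP ∧ Tendsto (CM Q) atTop (𝓝 m) ∧
      ∀ᶠ Y : ℝ in atTop, ∫⁻ y in Set.Ioc 0 Y, ‖F y - Q y‖ₑ ≤ ENNReal.ofReal (ε * Y))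
    (hμ : ∀ g : ℝ → ℝ, (∃ C, LipschitzWith C g) → (∃ B, ∀ x, |g x| ≤ B) →
      Tendsto (CM (fun y => g (F y))) atTop (𝓝 (∫ t, g t ∂μ))) : ∫ t, t ∂μ = m := by
  have hF' : TPapprox F := fun ε hε => by
    obtain ⟨Q, h1, -, h2⟩ := hF ε hε; exact ⟨Q, h1, h2⟩
  obtain ⟨B, hB, hBY⟩ := hF'.bdd
  -- integrability
  have hbd : ∀ n : ℕ, ∫ t, |clampM n t| ∂μ ≤ B := by
    intro n
    have hn : (0:ℝ) ≤ n := Nat.cast_nonneg n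
    have hc : LipschitzWith 1 (fun t => |clampM n t|) := by
      have := (lipschitzWith_one_norm (E := ℝ)).comp (clampM_lip n)
      rw [mul_one] at this
      exact this
    have := hμ (fun t => |clampM n t|) ⟨1, hc⟩ ⟨n, fun x => by rw [abs_abs]; exact clampM_abs hn x⟩
    refine le_of_tendsto this ?_
    filter_upwards [hBY, eventually_gt_atTop 0] with Y h1 hY
    have h2 := CM_close (f := fun y => |clampM n (F y)|) (g := fun _ => 0) (d := F) (K := 1) (e := B)
      (int_of_bdd (hc.continuous.measurable.comp hFm) (B := n) fun x => by rw [abs_abs]; exact clampM_abs hn _)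
      (fun a b => intervalIntegrable_const) hY zero_le_one hB
      (fun y => by rw [sub_zero, abs_abs, one_mul]; exact clampM_abs' hn _) h1
    have h3 : CM (fun _ => 0) Y = 0 := by simp [CM]
    rw [h3, sub_zero, one_mul] at h2
    exact (le_abs_self _).trans h2
  have hcm : ∀ n : ℕ, Measurable (clampM n) := fun n => (clampM_lip n).continuous.measurable
  have hIntg : Integrable (fun t : ℝ => t) μ := by
    refine ⟨aestronglyMeasurable_id, ?_⟩
    have hfatou : ∫⁻ t, ‖t‖ₑ ∂μ ≤ ENNReal.ofReal B := by
      have h1 : ∀ t : ℝ, ‖t‖ₑ = liminf (fun n : ℕ => ‖clampM n t‖ₑ) atTop := fun t =>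
        (((continuous_enorm.tendsto t).comp (clampM_tendsto t)).liminf_eq).symm
      calc ∫⁻ t, ‖t‖ₑ ∂μ = ∫⁻ t, liminf (fun n : ℕ => ‖clampM n t‖ₑ) atTop ∂μ := lintegral_congr h1
        _ ≤ liminf (fun n : ℕ => ∫⁻ t, ‖clampM n t‖ₑ ∂μ) atTop := lintegral_liminf_le fun n => (hcm n).enorm
        _ ≤ _ := by
          refine liminf_le_of_frequently_le' (Frequently.of_forall fun n => ?_)
          have hn : (0:ℝ) ≤ n := Nat.cast_nonneg n
          have hi : Integrable (fun t => |clampM n t|) μ :=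
            Integrable.of_bound (hcm n).abs.aestronglyMeasurable n
              (Eventually.of_forall fun t => by rw [Real.norm_eq_abs, abs_abs]; exact clampM_abs hn t)
          have := ofReal_integral_eq_lintegral_ofReal hi (Eventually.of_forall fun _ => abs_nonneg _)
          have e : ∫⁻ t, ‖clampM n t‖ₑ ∂μ = ∫⁻ t, ENNReal.ofReal |clampM n t| ∂μ := 
            lintegral_congr fun t => by rw [← ofReal_norm_eq_enorm, Real.norm_eq_abs]
          rw [e, ← this]
          exact ENNReal.ofReal_le_ofReal (hbd n)
    exact hfatou.trans_lt ENNReal.ofReal_lt_top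
  have hdct : Tendsto (fun n : ℕ => ∫ t, clampM n t ∂μ) atTop (𝓝 (∫ t, t ∂μ)) := by
    refine tendsto_integral_of_dominated_convergence (fun t => |t|) (fun n => (hcm n).aestronglyMeasurable) hIntg.abs
      (fun n => Eventually.of_forall fun t => clampM_abs' (Nat.cast_nonneg n) t) (Eventually.of_forall clampM_tendsto)
  have hle : ∀ ε : ℝ, 0 < ε → |∫ t, t ∂μ - m| ≤ ε := by
    intro ε hε
    obtain ⟨Q, hQ, hQm, h⟩ := hF ε hε
    obtain ⟨h1, -, R, hR⟩ := TP_prop hQ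
    have hQc := (TP_real_mean hQ).1
    refine le_of_tendsto ((hdct.sub_const m).abs) ?_
    obtain ⟨N, hN⟩ := exists_nat_ge R
    filter_upwards [eventually_ge_atTop N] with n hn
    have hn0 : (0:ℝ) ≤ n := Nat.cast_nonneg n
    have h2 := hμ (clampM n) ⟨1, clampM_lip n⟩ ⟨n, clampM_abs hn0⟩
    refine le_of_tendsto ((h2.sub hQm).abs) ?_
    filter_upwards [h, eventually_gt_atTop 0] with Y h3 hY
    have h4 := CM_close (f := fun y => clampM n (F y)) (g := Q) (d := fun y => F y - Q y) (K := 1) (e := ε)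
      (int_of_bdd ((hcm n).comp hFm) (B := n) fun x => clampM_abs hn0 _)
      (fun a b => hQc.intervalIntegrable a b) hY zero_le_one hε.le ?_ h3
    · linarith
    · intro y
      have hq : clampM n (Q y) = Q y := by
        apply clampM_eq
        have := hR y
        rw [Complex.norm_real, Real.norm_eq_abs] at this
        exact this.trans (hN.trans (by exact_mod_cast hn))
      have := (clampM_lip n).dist_le_mul (F y) (Q y)
      rw [Real.dist_eq, Real.dist_eq, hq] at this
      exact this
  have : |∫ t, t ∂μ - m| ≤ 0 := le_of_forall_pos_le_add fun ε hε => by simpa using hle ε hε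
  have := abs_nonpos_iff.1 this
  linarith

lemma trigS_re (q : ℕ) [NeZero q] (S : Finset ℂ) (c d : ℝ) :
    (fun y : ℝ => ((c - d * (trigS q S y).re : ℝ) : ℂ)) = (fun _ => (c : ℂ)) +
      ∑ ρ ∈ S, ((-(d / 2 : ℂ) * ((analyticOrderNatAt (LX q) ρ : ℂ) / ρ)) • (fun y : ℝ => cexp (ρ.im * I * y)) +
        (-(d / 2 : ℂ) * (starRingEnd ℂ) ((analyticOrderNatAt (LX q) ρ : ℂ) / ρ)) • (fun y : ℝ => cexp ((-ρ.im : ℝ) * I * y))) := by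
  ext y
  have h1 : (((trigS q S y).re : ℝ) : ℂ) = (1 / 2) * (trigS q S y + (starRingEnd ℂ) (trigS q S y)) := by
    rw [Complex.add_conj]; push_cast; ring
  push_cast
  rw [h1]
  simp only [Pi.add_apply, Finset.sum_apply, Pi.smul_apply, smul_eq_mul]
  unfold trigS
  rw [map_sum, ← Finset.sum_add_distrib, sub_eq_add_neg, ← mul_assoc, ← neg_mul, Finset.mul_sum]
  congr 1
  apply Finset.sum_congr rfl
  intro ρ _
  rw [map_mul, ← Complex.exp_conj]
  simp only [map_mul, Complex.conj_ofReal, Complex.conj_I]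
  push_cast
  have : (ρ.im : ℂ) * -I * y = -ρ.im * I * y := by ring
  rw [this]
  ring

lemma trigS_TP (q : ℕ) [NeZero q] (S : Finset ℂ) (c d : ℝ) :
    (fun y : ℝ => ((c - d * (trigS q S y).re : ℝ) : ℂ)) ∈ TP := by
  rw [trigS_re]
  refine TP.add_mem (TP.algebraMap_mem (c : ℂ)) (TP.sum_mem fun ρ _ => TP.add_mem ?_ ?_)
  · exact TP.smul_mem (exp_mem_TP _) _
  · exact TP.smul_mem (exp_mem_TP _) _

lemma HM_sum {ι : Type} (S : Finset ι) (f : ι → ℝ → ℂ) (hc : ∀ i ∈ S, Continuous (f i)) (h : ∀ i ∈ S, HM (f i) 0) :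
    Continuous (∑ i ∈ S, f i) ∧ HM (∑ i ∈ S, f i) 0 := by
  induction S using Finset.induction_on with
  | empty => rw [Finset.sum_empty]; exact ⟨continuous_zero, HM_const 0⟩
  | insert a s ha ih =>
    rw [Finset.sum_insert ha]
    obtain ⟨h1, h2⟩ := ih (fun i hi => hc i (Finset.mem_insert_of_mem hi)) (fun i hi => h i (Finset.mem_insert_of_mem hi))
    refine ⟨(hc a (Finset.mem_insert_self _ _)).add h1, ?_⟩
    have := (h a (Finset.mem_insert_self _ _)).add h2 (hc a (Finset.mem_insert_self _ _)) h1
    rwa [add_zero] at this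

lemma trigS_mean (q : ℕ) [NeZero q] (S : Finset ℂ) (c d : ℝ) (hS : ∀ ρ ∈ S, ρ.im ≠ 0) :
    Tendsto (CM (fun y : ℝ => c - d * (trigS q S y).re)) atTop (𝓝 c) := by
  have h : HM (fun y : ℝ => ((c - d * (trigS q S y).re : ℝ) : ℂ)) c := by
    rw [trigS_re]
    obtain ⟨h1, h2⟩ := HM_sum S (fun ρ => ((-(d / 2 : ℂ) * ((analyticOrderNatAt (LX q) ρ : ℂ) / ρ)) • (fun y : ℝ => cexp (ρ.im * I * y)) +
        (-(d / 2 : ℂ) * (starRingEnd ℂ) ((analyticOrderNatAt (LX q) ρ : ℂ) / ρ)) • (fun y : ℝ => cexp ((-ρ.im : ℝ) * I * y))))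
        (fun ρ _ => by
          have a1 : Continuous (fun y : ℝ => cexp (ρ.im * I * y)) := by fun_prop
          have a2 : Continuous (fun y : ℝ => cexp ((-ρ.im : ℝ) * I * y)) := by fun_prop
          exact (a1.const_smul _).add (a2.const_smul _))
        (fun ρ hρ => by
          have a1 : Continuous (fun y : ℝ => cexp (ρ.im * I * y)) := by fun_prop
          have a2 : Continuous (fun y : ℝ => cexp ((-ρ.im : ℝ) * I * y)) := by fun_prop
          have := ((HM_exp (hS ρ hρ)).smul (-(d / 2 : ℂ) * ((analyticOrderNatAt (LX q) ρ : ℂ) / ρ))).add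
            ((HM_exp (neg_ne_zero.2 (hS ρ hρ))).smul (-(d / 2 : ℂ) * (starRingEnd ℂ) ((analyticOrderNatAt (LX q) ρ : ℂ) / ρ)))
            (a1.const_smul _) (a2.const_smul _)
          rwa [mul_zero, mul_zero, add_zero] at this)
    have := (HM_const (c : ℂ)).add h2 continuous_const h1
    rwa [add_zero] at this
  refine ((Complex.continuous_re.tendsto _).comp h).congr fun Y => ?_
  simp only [Function.comp, CM]
  rw [intervalIntegral.integral_ofReal, ← Complex.ofReal_mul, Complex.ofReal_re]

lemma CM_shift {f : ℝ → ℝ} (hf : ∀ a b, IntervalIntegrable f volume a b) {m : ℝ} (h : Tendsto (CM f) atTop (𝓝 m)) :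
    Tendsto (fun Y : ℝ => (1 / Y) * ∫ y in (2:ℝ)..Y, f y) atTop (𝓝 m) := by
  have h1 : Tendsto (fun Y : ℝ => Y⁻¹ * ∫ y in (0:ℝ)..2, f y) atTop (𝓝 0) := by
    simpa using tendsto_inv_atTop_zero.mul_const (∫ y in (0:ℝ)..2, f y)
  have h2 := h.sub h1
  rw [sub_zero] at h2
  refine h2.congr fun Y => ?_
  unfold CM
  rw [← intervalIntegral.integral_add_adjacent_intervals (hf 0 2) (hf 2 Y)]
  ring

/-- The race between quadratic residues and non-residues mod `q` admits a limiting
logarithmic distribution; under GRH for real characters and non-vanishing at `1/2`,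
its mean is `(1 − ρ(q))/ρ(q)`. -/
theorem stmt9 (q : ℕ) [NeZero q] (hq : 3 ≤ q) :
    ∃ μ : Measure ℝ, HasLimitingLogDistribution (Ernr q) μ ∧
      (((∀ χ : DirichletCharacter ℂ q, χ ≠ 1 → χ ^ 2 = 1 →
          ∀ ρ : ℂ, χ.LFunction ρ = 0 → 0 < ρ.re → ρ.re < 1 → ρ.re = 1 / 2) ∧
        (∀ χ : DirichletCharacter ℂ q, χ ≠ 1 → χ ^ 2 = 1 → χ.LFunction (1 / 2) ≠ 0)) →
        (∫ t, t ∂μ) = (1 - (rhoQ q : ℝ)) / (rhoQ q : ℝ)) := by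
  have hm := Ernr_measurable q
  have hT : TPapprox (fun y => Ernr q (Real.exp y)) := by
    intro ε hε
    obtain ⟨S, -, h⟩ := Ernr_approx q hq hε
    exact ⟨_, trigS_TP q S ((1 - (rhoQ q : ℝ)) / rhoQ q * c0 q) (1 / (rhoQ q : ℝ)), h⟩
  obtain ⟨μ, hμp, hμ⟩ := hT.exists_measure hm
  refine ⟨μ, ⟨hμp, ?_⟩, ?_⟩
  · rintro g ⟨C, hC⟩ ⟨B, hB⟩
    exact CM_shift (int_of_bdd (hC.continuous.measurable.comp hm) fun x => hB _) (hμ g ⟨C, hC⟩ ⟨B, hB⟩)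
  · rintro ⟨h1, h2⟩
    have hβ : betaQ2 q = 1 / 2 := by
      refine le_antisymm ?_ (half_le_beta q hq)
      unfold betaQ2
      refine Real.sSup_le ?_ (by norm_num)
      rintro b ⟨χ, a1, a2, ρ, a3, a4, a5, rfl⟩
      exact (h1 χ a1 a2 ρ a3 a4 a5).le
    have hc : c0 q = 1 := by unfold c0; rw [if_pos hβ]
    refine TPapprox.mean_eq hm ?_ hμ
    intro ε hε
    obtain ⟨S, hS, h⟩ := Ernr_approx q hq hε
    rw [hc, mul_one] at h
    refine ⟨_, trigS_TP q S _ (1 / (rhoQ q : ℝ)), trigS_mean q S _ _ ?_, h⟩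
    intro ρ hρ him
    obtain ⟨a1, a2⟩ := hS ρ hρ
    obtain ⟨χ, hχ, h0⟩ := LX_eq_zero.1 a1
    have hρ2 : ρ = 1 / 2 := by
      apply Complex.ext
      · rw [a2, hβ]; norm_num
      · rw [him]; norm_num
    rw [hρ2] at h0
    exact h2 χ ((mem_XX χ).1 hχ).1 ((mem_XX χ).1 hχ).2 h0

end
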